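/- Let G and G′ be finite subgroups of U(2) acting freely on S^3 (i.e., no element other than the identity has 1 as an eigenvalue). Suppose that for every positive integer λ, Σ over pairs (p,q) with q ≥ 1 and 2q(p+1) = λ of dim_ℂ H_{p,q}^G equals Σ over the same pairs of dim_ℂ H_{p,q}^{G′}. Then G and G′ are isomorphic as groups. -/

import Mathlib

noncomputable section

open MvPolynomial Matrix Complex Real Filter

/-- Variables: `Sum.inl i` is `z i`, `Sum.inr i` is `conj (z i)`. -/
abbrev Var (n : ℕ) := Fin n ⊕ Fin n

/-- Bidegree weight: `z`-variables have weight (1,0), `z̄`-variables weight (0,1). -/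
def bidegWt (n : ℕ) : Var n → ℕ × ℕ :=
  Sum.elim (fun _ => ((1 : ℕ), (0 : ℕ))) (fun _ => ((0 : ℕ), (1 : ℕ)))

/-- The Laplacian `∑ i, ∂²/∂zᵢ∂z̄ᵢ` on polynomials in `z, z̄`. -/
def kohnLap (n : ℕ) : MvPolynomial (Var n) ℂ →ₗ[ℂ] MvPolynomial (Var n) ℂ :=
  ∑ i : Fin n, ((pderiv (R := ℂ) (Sum.inl i)).toLinearMap.comp
    (pderiv (R := ℂ) (Sum.inr i)).toLinearMap)

/-- `H_{p,q}`: harmonic polynomials on ℂⁿ of bidegree `(p,q)`. -/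
def Hpq (n p q : ℕ) : Submodule ℂ (MvPolynomial (Var n) ℂ) :=
  (weightedHomogeneousSubmodule ℂ (bidegWt n) (p, q)) ⊓ (LinearMap.ker (kohnLap n))

/-- The action of a unitary matrix `g` on polynomials, `(g · f)(z) = f(g⁻¹ z)`:
substitution `zᵢ ↦ ∑ⱼ (g⁻¹)ᵢⱼ zⱼ`, `z̄ᵢ ↦ ∑ⱼ conj((g⁻¹)ᵢⱼ) z̄ⱼ`. -/
def uAct (n : ℕ) (g : Matrix.unitaryGroup (Fin n) ℂ) :
    MvPolynomial (Var n) ℂ →ₐ[ℂ] MvPolynomial (Var n) ℂ :=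
  aeval (Sum.elim
    (fun i => ∑ j : Fin n,
      MvPolynomial.C ((g⁻¹ : Matrix.unitaryGroup (Fin n) ℂ) i j) * X (Sum.inl j))
    (fun i => ∑ j : Fin n,
      MvPolynomial.C ((starRingEnd ℂ) ((g⁻¹ : Matrix.unitaryGroup (Fin n) ℂ) i j)) * X (Sum.inr j)))

/-- `H_{p,q}^S`: the subspace of `H_{p,q}` invariant under every element of `S`. -/
def HpqInv (n p q : ℕ) (S : Set (Matrix.unitaryGroup (Fin n) ℂ)) :
    Submodule ℂ (MvPolynomial (Var n) ℂ) :=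
  Hpq n p q ⊓ (⨅ g ∈ S, LinearMap.ker ((uAct n g).toLinearMap - LinearMap.id))

/-- `dim_ℂ H_{p,q}^S`. -/
def dimHpqInv (n p q : ℕ) (S : Set (Matrix.unitaryGroup (Fin n) ℂ)) : ℕ :=
  Module.finrank ℂ (HpqInv n p q S)

/-- A set of unitary matrices acts freely on the sphere iff no element other than
the identity has `1` as an eigenvalue. -/
def actsFreely {n : ℕ} (S : Set (Matrix.unitaryGroup (Fin n) ℂ)) : Prop :=
  ∀ g ∈ S, ((g : Matrix (Fin n) (Fin n) ℂ) - 1).det = 0 → g = 1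

/-- The multiplicity of `λ` in the spectrum of the Kohn Laplacian on `G\S³`:
the sum of `dim H_{p,q}^G` over pairs with `q ≥ 1` and `2q(p+1) = λ`. -/
def specMult (S : Set (Matrix.unitaryGroup (Fin 2) ℂ)) (lam : ℕ) : ℕ :=
  ∑ pq ∈ (Finset.range (lam + 1) ×ˢ Finset.range (lam + 1)).filter
      (fun pq => 1 ≤ pq.2 ∧ 2 * pq.2 * (pq.1 + 1) = lam),
    dimHpqInv 2 pq.1 pq.2 S

section Action

variable {n : ℕ}

lemma pderiv_aeval {σ τ : Type*} [Fintype σ] (s : σ → MvPolynomial τ ℂ) (i : τ)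
    (f : MvPolynomial σ ℂ) :
    pderiv i (aeval s f) = ∑ v, aeval s (pderiv v f) * pderiv i (s v) := by
  classical
  induction f using MvPolynomial.induction_on with
  | C a => simp [MvPolynomial.algebraMap_eq]
  | add p q hp hq => simp only [map_add, hp, hq, add_mul, Finset.sum_add_distrib]
  | mul_X p w hp =>
    have h : ∀ v, aeval s (pderiv v (p * X w)) * pderiv i (s v) =
        aeval s (pderiv v p) * pderiv i (s v) * s w +
          if v = w then aeval s p * pderiv i (s w) else 0 := by
      intro v
      rw [pderiv_mul, pderiv_X, map_add, map_mul, map_mul, aeval_X]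
      split_ifs with hv
      · subst hv
        rw [Pi.single_eq_same, map_one]; ring
      · rw [Pi.single_eq_of_ne (Ne.symm hv), map_zero]; ring
    rw [map_mul, aeval_X, pderiv_mul, hp, Finset.sum_congr rfl fun v _ => h v,
      Finset.sum_add_distrib, Finset.sum_mul]
    simp

lemma uAct_X_inl (g : unitaryGroup (Fin n) ℂ) (i : Fin n) :
    uAct n g (X (Sum.inl i)) = ∑ j, C ((g⁻¹ : unitaryGroup (Fin n) ℂ) i j) * X (Sum.inl j) := by
  simp [uAct]

lemma uAct_X_inr (g : unitaryGroup (Fin n) ℂ) (i : Fin n) :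
    uAct n g (X (Sum.inr i)) =
      ∑ j, C (starRingEnd ℂ ((g⁻¹ : unitaryGroup (Fin n) ℂ) i j)) * X (Sum.inr j) := by
  simp [uAct]

lemma uAct_one : uAct n 1 = AlgHom.id ℂ _ := by
  apply MvPolynomial.algHom_ext
  rintro (i | i)
  · rw [uAct_X_inl, inv_one, Finset.sum_eq_single i] <;> simp +contextual [Matrix.one_apply]
    intro b hb h; exact absurd h.symm hb
  · rw [uAct_X_inr, inv_one, Finset.sum_eq_single i] <;> simp +contextual [Matrix.one_apply]
    intro b hb h; exact absurd h.symm hb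

lemma uAct_mul (g h : unitaryGroup (Fin n) ℂ) : uAct n (g * h) = (uAct n g).comp (uAct n h) := by
  apply MvPolynomial.algHom_ext
  rintro (i | i)
  · rw [AlgHom.comp_apply, uAct_X_inl, uAct_X_inl, _root_.mul_inv_rev, map_sum]
    simp only [map_mul, uAct_X_inl, MvPolynomial.algHom_C, Finset.mul_sum,
      UnitaryGroup.mul_val, Matrix.mul_apply, map_sum, Finset.sum_mul, MvPolynomial.algebraMap_eq]
    rw [Finset.sum_comm]
    exact Finset.sum_congr rfl fun x _ => Finset.sum_congr rfl fun y _ => by ring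
  · rw [AlgHom.comp_apply, uAct_X_inr, uAct_X_inr, _root_.mul_inv_rev, map_sum]
    simp only [map_mul, uAct_X_inr, MvPolynomial.algHom_C, Finset.mul_sum,
      UnitaryGroup.mul_val, Matrix.mul_apply, map_sum, Finset.sum_mul, MvPolynomial.algebraMap_eq]
    rw [Finset.sum_comm]
    exact Finset.sum_congr rfl fun x _ => Finset.sum_congr rfl fun y _ => by ring

lemma pderiv_inl_uAct (g : unitaryGroup (Fin n) ℂ) (i : Fin n) (f : MvPolynomial (Var n) ℂ) :
    pderiv (Sum.inl i) (uAct n g f) =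
      ∑ j, C ((g⁻¹ : unitaryGroup (Fin n) ℂ) j i) * uAct n g (pderiv (Sum.inl j) f) := by
  classical
  rw [uAct, pderiv_aeval, ← uAct, Fintype.sum_sum_type]
  simp [pderiv_X, Pi.single_apply, mul_comm]

lemma pderiv_inr_uAct (g : unitaryGroup (Fin n) ℂ) (i : Fin n) (f : MvPolynomial (Var n) ℂ) :
    pderiv (Sum.inr i) (uAct n g f) =
      ∑ j, C (starRingEnd ℂ ((g⁻¹ : unitaryGroup (Fin n) ℂ) j i)) *
        uAct n g (pderiv (Sum.inr j) f) := by
  classical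
  rw [uAct, pderiv_aeval, ← uAct, Fintype.sum_sum_type]
  simp [pderiv_X, Pi.single_apply, mul_comm]

lemma kohnLap_apply (f : MvPolynomial (Var n) ℂ) :
    kohnLap n f = ∑ i, pderiv (Sum.inl i) (pderiv (Sum.inr i) f) := by
  simp [kohnLap, LinearMap.sum_apply]

lemma unitary_sum_mul_conj (h : unitaryGroup (Fin n) ℂ) (j k : Fin n) :
    ∑ i, h k i * starRingEnd ℂ (h j i) = (1 : Matrix (Fin n) (Fin n) ℂ) k j := by
  have := congrFun (congrFun (Unitary.coe_mul_star_self h) k) j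
  rw [← this, Matrix.mul_apply]
  rfl

lemma kohnLap_uAct (g : unitaryGroup (Fin n) ℂ) (f : MvPolynomial (Var n) ℂ) :
    kohnLap n (uAct n g f) = uAct n g (kohnLap n f) := by
  rw [kohnLap_apply, kohnLap_apply, map_sum]
  have key : ∀ i, pderiv (Sum.inl i) (pderiv (Sum.inr i) (uAct n g f)) =
      ∑ j, ∑ k, C ((g⁻¹ : unitaryGroup (Fin n) ℂ) k i *
        starRingEnd ℂ ((g⁻¹ : unitaryGroup (Fin n) ℂ) j i)) *
          uAct n g (pderiv (Sum.inl k) (pderiv (Sum.inr j) f)) := by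
    intro i
    rw [pderiv_inr_uAct, map_sum]
    refine Finset.sum_congr rfl fun j _ => ?_
    rw [pderiv_C_mul, pderiv_inl_uAct, Finset.mul_sum]
    refine Finset.sum_congr rfl fun k _ => ?_
    rw [map_mul]; ring
  simp only [key]
  rw [Finset.sum_comm]
  refine Finset.sum_congr rfl fun j _ => ?_
  rw [Finset.sum_comm]
  simp only [← Finset.sum_mul, ← map_sum, unitary_sum_mul_conj]
  rw [Finset.sum_eq_single j]
  · simp
  · intro b _ hb; simp [hb]
  · simp

lemma uAct_weightedHomogeneous (g : unitaryGroup (Fin n) ℂ) {f : MvPolynomial (Var n) ℂ}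
    {d : ℕ × ℕ} (hf : IsWeightedHomogeneous (bidegWt n) f d) :
    IsWeightedHomogeneous (bidegWt n) (uAct n g f) d := by
  have hX : ∀ v, IsWeightedHomogeneous (bidegWt n) (uAct n g (X v)) (bidegWt n v) := by
    rintro (i | i)
    · rw [uAct_X_inl]
      refine (mem_weightedHomogeneousSubmodule ..).1 (Submodule.sum_mem _ fun j _ => ?_)
      refine (mem_weightedHomogeneousSubmodule ..).2 ?_
      exact (isWeightedHomogeneous_X ℂ (bidegWt n) (Sum.inl j)).C_mul _
    · rw [uAct_X_inr]
      refine (mem_weightedHomogeneousSubmodule ..).1 (Submodule.sum_mem _ fun j _ => ?_)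
      refine (mem_weightedHomogeneousSubmodule ..).2 ?_
      exact (isWeightedHomogeneous_X ℂ (bidegWt n) (Sum.inr j)).C_mul _
  rw [f.as_sum, map_sum]
  refine (mem_weightedHomogeneousSubmodule ..).1 (Submodule.sum_mem _ fun m hm => ?_)
  refine (mem_weightedHomogeneousSubmodule ..).2 ?_
  rw [MvPolynomial.monomial_eq, map_mul, MvPolynomial.algHom_C, MvPolynomial.algebraMap_eq]
  refine IsWeightedHomogeneous.C_mul ?_ _
  rw [← hf (MvPolynomial.mem_support_iff.1 hm), Finsupp.prod, map_prod, Finsupp.weight_apply,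
    Finsupp.sum]
  refine IsWeightedHomogeneous.prod _ _ _ fun v _ => ?_
  rw [map_pow]
  exact (hX v).pow _

lemma uAct_mem_Hpq (g : unitaryGroup (Fin n) ℂ) {p q : ℕ} {f : MvPolynomial (Var n) ℂ}
    (hf : f ∈ Hpq n p q) : uAct n g f ∈ Hpq n p q := by
  refine ⟨(mem_weightedHomogeneousSubmodule ..).2
    (uAct_weightedHomogeneous g ((mem_weightedHomogeneousSubmodule ..).1 hf.1)), ?_⟩
  rw [SetLike.mem_coe, LinearMap.mem_ker, kohnLap_uAct, LinearMap.mem_ker.1 hf.2, map_zero]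

/-- The representation of the unitary group on `H_{p,q}`. -/
def rhoPQ (n p q : ℕ) : Representation ℂ (unitaryGroup (Fin n) ℂ) (Hpq n p q) where
  toFun g := (uAct n g).toLinearMap.restrict fun _ hf => uAct_mem_Hpq g hf
  map_one' := by
    ext f
    simp [uAct_one]
  map_mul' g h := by
    refine LinearMap.ext fun f => Subtype.ext ?_
    exact DFunLike.congr_fun (uAct_mul g h) (f : MvPolynomial (Var n) ℂ)

@[simp]
lemma rhoPQ_coe (p q : ℕ) (g : unitaryGroup (Fin n) ℂ) (f : Hpq n p q) :
    (rhoPQ n p q g f : MvPolynomial (Var n) ℂ) = uAct n g f := rfl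

end Action

section Coefficients

/-- The exponent vector of `z₁ ^ a * z₂ ^ b * z̄₁ ^ c * z̄₂ ^ d`. -/
def mono (a b c d : ℕ) : Var 2 →₀ ℕ := Finsupp.equivFunOnFinite.symm (Sum.elim ![a, b] ![c, d])

lemma mono_surj (m : Var 2 →₀ ℕ) :
    m = mono (m (Sum.inl 0)) (m (Sum.inl 1)) (m (Sum.inr 0)) (m (Sum.inr 1)) := by
  ext v
  rcases v with i | i <;> fin_cases i <;> simp [mono]

lemma mono_inj {a b c d a' b' c' d' : ℕ} :
    mono a b c d = mono a' b' c' d' ↔ a = a' ∧ b = b' ∧ c = c' ∧ d = d' := by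
  constructor
  · intro h
    refine ⟨?_, ?_, ?_, ?_⟩
    · simpa [mono] using DFunLike.congr_fun h (Sum.inl 0)
    · simpa [mono] using DFunLike.congr_fun h (Sum.inl 1)
    · simpa [mono] using DFunLike.congr_fun h (Sum.inr 0)
    · simpa [mono] using DFunLike.congr_fun h (Sum.inr 1)
  · rintro ⟨rfl, rfl, rfl, rfl⟩; rfl

lemma weight_mono (a b c d : ℕ) :
    Finsupp.weight (bidegWt 2) (mono a b c d) = (a + b, c + d) := by
  rw [Finsupp.weight_apply, Finsupp.sum_fintype _ _ (by simp), Fintype.sum_sum_type]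
  simp [mono, bidegWt]

lemma coeff_kohnLap (f : MvPolynomial (Var 2) ℂ) (a b c d : ℕ) :
    coeff (mono a b c d) (kohnLap 2 f) =
      coeff (mono (a + 1) b (c + 1) d) f * ((a + 1) * (c + 1)) +
      coeff (mono a (b + 1) c (d + 1)) f * ((b + 1) * (d + 1)) := by
  have e1 : mono a b c d + Finsupp.single (Sum.inl 0) 1 + Finsupp.single (Sum.inr 0) 1 =
      mono (a + 1) b (c + 1) d := by
    ext v
    rcases v with i | i <;> fin_cases i <;> simp [mono]
  have e2 : mono a b c d + Finsupp.single (Sum.inl 1) 1 + Finsupp.single (Sum.inr 1) 1 =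
      mono a (b + 1) c (d + 1) := by
    ext v
    rcases v with i | i <;> fin_cases i <;> simp [mono]
  rw [kohnLap_apply, Fin.sum_univ_two, coeff_add]
  simp only [coeff_pderiv, e1, e2]
  simp [mono]
  ring

/-- The coefficient of a monomial, normalised so that harmonicity becomes invariance. -/
def normCoeff (f : MvPolynomial (Var 2) ℂ) (a b c d : ℕ) : ℂ :=
  coeff (mono a b c d) f * (-1) ^ c * (a.factorial * b.factorial * c.factorial * d.factorial : ℕ)

lemma normCoeff_eq_zero {f : MvPolynomial (Var 2) ℂ} {a b c d : ℕ} :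
    normCoeff f a b c d = 0 ↔ coeff (mono a b c d) f = 0 := by
  simp [normCoeff, Nat.factorial_ne_zero]

lemma normCoeff_shift {f : MvPolynomial (Var 2) ℂ} (hf : kohnLap 2 f = 0) (a b c d : ℕ) :
    normCoeff f (a + 1) b (c + 1) d = normCoeff f a (b + 1) c (d + 1) := by
  have h := coeff_kohnLap f a b c d
  rw [hf, coeff_zero] at h
  simp only [normCoeff, Nat.factorial_succ]
  push_cast
  linear_combination (-(-1) ^ c * (a.factorial * b.factorial * c.factorial * d.factorial : ℂ)) * (-h)

/-- The `k`-th representative monomial of bidegree `(p,q)`. -/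
def repMono (p q k : ℕ) : Var 2 →₀ ℕ := mono (k - q) (p - (k - q)) (q - k) (q - (q - k))

lemma coeff_eq_zero_of_repMono {p q : ℕ} {f : MvPolynomial (Var 2) ℂ} (hf : kohnLap 2 f = 0)
    (h : ∀ k < p + q + 1, coeff (repMono p q k) f = 0) (a : ℕ) :
    ∀ b c d, a + b = p → c + d = q → coeff (mono a b c d) f = 0 := by
  induction a with
  | zero =>
    intro b c d hab hcd
    have := h (q - c) (by omega)
    rw [repMono] at this
    convert this using 2
    rw [mono_inj]; omega
  | succ a ih =>
    intro b c d hab hcd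
    rcases c with _ | c
    · have := h (q + (a + 1)) (by omega)
      rw [repMono] at this
      convert this using 2
      rw [mono_inj]; omega
    · rw [← normCoeff_eq_zero, normCoeff_shift hf, normCoeff_eq_zero]
      exact ih _ _ _ (by omega) (by omega)

/-- The harmonic polynomial of bidegree `(p,q)` with prescribed weight components. -/
def harmPoly (p q : ℕ) (φ : ℕ → ℂ) : MvPolynomial (Var 2) ℂ :=
  ∑ x ∈ Finset.HasAntidiagonal.antidiagonal p ×ˢ Finset.HasAntidiagonal.antidiagonal q,
    monomial (mono x.1.1 x.1.2 x.2.1 x.2.2) (φ (x.1.1 + x.2.2) * (-1) ^ x.2.1 /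
      (x.1.1.factorial * x.1.2.factorial * x.2.1.factorial * x.2.2.factorial : ℕ))

lemma coeff_harmPoly (p q : ℕ) (φ : ℕ → ℂ) (a b c d : ℕ) :
    coeff (mono a b c d) (harmPoly p q φ) = if a + b = p ∧ c + d = q then
      φ (a + d) * (-1) ^ c / (a.factorial * b.factorial * c.factorial * d.factorial : ℕ) else 0 := by
  rw [harmPoly, coeff_sum]
  simp only [coeff_monomial, mono_inj]
  split_ifs with h
  · rw [Finset.sum_eq_single ((a, b), (c, d))]
    · simp
    · rintro ⟨⟨x, y⟩, ⟨z, w⟩⟩ - hne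
      rw [if_neg]
      rintro ⟨rfl, rfl, rfl, rfl⟩
      exact hne rfl
    · intro hn
      simp [h] at hn
  · refine Finset.sum_eq_zero ?_
    rintro ⟨⟨x, y⟩, ⟨z, w⟩⟩ hx
    rw [if_neg]
    rintro ⟨rfl, rfl, rfl, rfl⟩
    simp at hx
    exact h hx

lemma harmPoly_mem (p q : ℕ) (φ : ℕ → ℂ) : harmPoly p q φ ∈ Hpq 2 p q := by
  refine ⟨?_, ?_⟩
  · refine (mem_weightedHomogeneousSubmodule ..).2 fun m hm => ?_
    rw [mono_surj m, coeff_harmPoly] at hm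
    rw [mono_surj m, weight_mono]
    by_contra hne
    rw [if_neg] at hm
    · exact hm rfl
    · rintro ⟨h1, h2⟩
      exact hne (by rw [h1, h2])
  · rw [SetLike.mem_coe, LinearMap.mem_ker]
    ext m
    rw [mono_surj m, coeff_kohnLap, coeff_harmPoly, coeff_harmPoly, coeff_zero]
    generalize m (Sum.inl 0) = a, m (Sum.inl 1) = b, m (Sum.inr 0) = c, m (Sum.inr 1) = d
    have e1 : (a + 1 + b = p ∧ c + 1 + d = q) ↔ (a + (b + 1) = p ∧ c + (d + 1) = q) := by omega
    simp only [e1]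
    split_ifs
    · have ha : (a.factorial : ℂ) ≠ 0 := by exact_mod_cast a.factorial_ne_zero
      have hb : (b.factorial : ℂ) ≠ 0 := by exact_mod_cast b.factorial_ne_zero
      have hc : (c.factorial : ℂ) ≠ 0 := by exact_mod_cast c.factorial_ne_zero
      have hd : (d.factorial : ℂ) ≠ 0 := by exact_mod_cast d.factorial_ne_zero
      have ha' : (a + 1 : ℂ) ≠ 0 := by exact_mod_cast a.succ_ne_zero
      have hb' : (b + 1 : ℂ) ≠ 0 := by exact_mod_cast b.succ_ne_zero
      have hc' : (c + 1 : ℂ) ≠ 0 := by exact_mod_cast c.succ_ne_zero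
      have hd' : (d + 1 : ℂ) ≠ 0 := by exact_mod_cast d.succ_ne_zero
      simp only [Nat.factorial_succ]
      push_cast
      rw [show a + 1 + d = a + (d + 1) by omega]
      field_simp
      ring
    · simp

/-- `H_{p,q}` is parametrised by the coefficients of the representative monomials. -/
def coeffEquiv (p q : ℕ) : Hpq 2 p q ≃ₗ[ℂ] (Fin (p + q + 1) → ℂ) :=
  LinearEquiv.ofBijective
    (LinearMap.pi fun k : Fin (p + q + 1) => (lcoeff ℂ (repMono p q k)).comp (Hpq 2 p q).subtype)
    (by
      constructor
      · rw [injective_iff_map_eq_zero]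
        rintro ⟨f, hf⟩ h0
        have hL : kohnLap 2 f = 0 := LinearMap.mem_ker.1 hf.2
        ext m
        rw [ZeroMemClass.coe_zero, coeff_zero]
        by_contra hm
        have hw := (mem_weightedHomogeneousSubmodule ..).1 hf.1 hm
        rw [mono_surj m, weight_mono, Prod.mk.injEq] at hw
        rw [mono_surj m] at hm
        refine hm (coeff_eq_zero_of_repMono hL (fun k hk => ?_) _ _ _ _ hw.1 hw.2)
        exact congrFun h0 ⟨k, hk⟩
      · intro ψ
        let φ : ℕ → ℂ := fun k => if h : k < p + q + 1 then ψ ⟨k, h⟩ * (-1) ^ (q - k) *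
          ((k - q).factorial * (p - (k - q)).factorial * (q - k).factorial *
            (q - (q - k)).factorial : ℕ) else 0
        refine ⟨⟨harmPoly p q φ, harmPoly_mem p q φ⟩, ?_⟩
        ext k
        have hk := k.2
        change coeff (repMono p q k) (harmPoly p q φ) = ψ k
        rw [repMono, coeff_harmPoly, if_pos (by omega)]
        have e : (k : ℕ) - q + (q - (q - k)) = k := by omega
        have hne : (((k - q : ℕ).factorial * (p - (k - q)).factorial * (q - k).factorial *
            (q - (q - k)).factorial : ℕ) : ℂ) ≠ 0 := by
          simp [Nat.factorial_ne_zero]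
        rw [e]
        simp only [φ, dif_pos hk]
        rw [div_eq_iff hne]
        have hs : ((-1 : ℂ) ^ (q - (k : ℕ))) * (-1) ^ (q - (k : ℕ)) = 1 := by
          rw [← mul_pow]; simp
        linear_combination (ψ k * (((k - q : ℕ).factorial * (p - (k - q)).factorial *
          (q - k).factorial * (q - (q - k)).factorial : ℕ) : ℂ)) * hs)

lemma coeffEquiv_apply (p q : ℕ) (f : Hpq 2 p q) (k : Fin (p + q + 1)) :
    coeffEquiv p q f k = coeff (repMono p q k) (f : MvPolynomial (Var 2) ℂ) := rfl

instance (p q : ℕ) : FiniteDimensional ℂ (Hpq 2 p q) := (coeffEquiv p q).symm.finiteDimensional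

lemma coeff_aeval_scale {σ : Type*} (w : σ → ℂ) (f : MvPolynomial σ ℂ) (m : σ →₀ ℕ) :
    coeff m (aeval (fun v => C (w v) * X v) f) = (m.prod fun v k => w v ^ k) * coeff m f := by
  classical
  induction f using MvPolynomial.induction_on' with
  | monomial u a =>
    have : aeval (fun v => C (w v) * X v) (monomial u a) =
        (monomial u ((u.prod fun v k => w v ^ k) * a) : MvPolynomial σ ℂ) := by
      rw [aeval_monomial, monomial_eq (s := u) (a := _ * a)]
      simp only [mul_pow, Finset.prod_mul_distrib, MvPolynomial.algebraMap_eq, map_mul, Finsupp.prod,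
        map_prod, map_pow]
      ring
    rw [this, coeff_monomial, coeff_monomial]
    split_ifs with h
    · rw [h]
    · simp
  | add p q hp hq => rw [map_add, coeff_add, coeff_add, hp, hq, mul_add]

end Coefficients

section Trace

/-- Unitary `2 × 2` matrices. -/
abbrev U2 := unitaryGroup (Fin 2) ℂ

/-- The character of `H_{p,q}` at an element with eigenvalues `u`, `v`. -/
def chi (p q : ℕ) (u v : ℂ) : ℂ :=
  ∑ k ∈ Finset.range (p + q + 1), u ^ ((q : ℤ) - k) * v ^ ((k : ℤ) - p)

lemma chi_comm (p q : ℕ) (u v : ℂ) : chi p q u v = chi p q v u := by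
  rw [chi, chi, ← Finset.sum_range_reflect]
  refine Finset.sum_congr rfl fun k hk => ?_
  rw [Finset.mem_range] at hk
  have : ((p + q + 1 - 1 - k : ℕ) : ℤ) = p + q - k := by omega
  rw [this, mul_comm]
  congr 2 <;> ring

lemma U2_inv_apply (g : U2) (i j : Fin 2) :
    (g⁻¹ : U2) i j = starRingEnd ℂ (g j i) := rfl

lemma trace_rhoPQ_of_diag (p q : ℕ) (g : U2) (h01 : g 0 1 = 0) (h10 : g 1 0 = 0) :
    LinearMap.trace ℂ _ (rhoPQ 2 p q g) = chi p q (g 0 0) (g 1 1) := by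
  have hu : g 0 0 * starRingEnd ℂ (g 0 0) = 1 := by
    have := unitary_sum_mul_conj g 0 0
    simpa [Fin.sum_univ_two, h01] using this
  have hv : g 1 1 * starRingEnd ℂ (g 1 1) = 1 := by
    have := unitary_sum_mul_conj g 1 1
    simpa [Fin.sum_univ_two, h10] using this
  have hu0 : g 0 0 ≠ 0 := left_ne_zero_of_mul_eq_one hu
  have hv0 : g 1 1 ≠ 0 := left_ne_zero_of_mul_eq_one hv
  have hu' : starRingEnd ℂ (g 0 0) = (g 0 0)⁻¹ := eq_inv_of_mul_eq_one_right hu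
  have hv' : starRingEnd ℂ (g 1 1) = (g 1 1)⁻¹ := eq_inv_of_mul_eq_one_right hv
  set w : Var 2 → ℂ := Sum.elim ![(g 0 0)⁻¹, (g 1 1)⁻¹] ![g 0 0, g 1 1] with hw
  have hact : uAct 2 g = aeval (fun v => C (w v) * X v) := by
    rw [uAct]
    congr 1
    funext v
    rcases v with i | i <;> fin_cases i <;>
      simp [hw, U2_inv_apply, Fin.sum_univ_two, h01, h10, hu', hv']
  have hdiag : (coeffEquiv p q).conj (rhoPQ 2 p q g) =
      Matrix.toLin' (Matrix.diagonal fun k : Fin (p + q + 1) =>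
        g 0 0 ^ ((q : ℤ) - (k : ℕ)) * g 1 1 ^ (((k : ℕ) : ℤ) - p)) := by
    refine LinearMap.ext fun x => ?_
    obtain ⟨f, rfl⟩ := (coeffEquiv p q).surjective x
    funext k
    have hk := k.2
    rw [LinearEquiv.conj_apply_apply, LinearEquiv.symm_apply_apply, Matrix.toLin'_apply,
      Matrix.mulVec_diagonal, coeffEquiv_apply, coeffEquiv_apply, rhoPQ_coe, hact,
      coeff_aeval_scale]
    congr 1
    rw [Finsupp.prod_fintype _ _ (by simp), Fintype.prod_sum_type]
    simp only [Fin.prod_univ_two, hw, repMono, mono]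
    simp only [Finsupp.equivFunOnFinite_symm_apply_apply, Sum.elim_inl, Sum.elim_inr,
      Matrix.cons_val_zero, Matrix.cons_val_one]
    rw [mul_mul_mul_comm]
    rw [_root_.inv_pow, _root_.inv_pow, ← zpow_natCast, ← zpow_natCast, ← zpow_natCast, ← zpow_natCast,
      ← _root_.zpow_neg, ← _root_.zpow_neg]
    rw [← zpow_add₀ hu0, ← zpow_add₀ hv0]
    congr 2 <;> omega
  rw [← LinearMap.trace_conj' (rhoPQ 2 p q g) (coeffEquiv p q), hdiag, Matrix.trace_toLin'_eq,
    Matrix.trace_diagonal, chi,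
    Finset.sum_range fun k : ℕ => g 0 0 ^ ((q : ℤ) - k) * g 1 1 ^ ((k : ℤ) - p)]

lemma exists_unitary_conj_diag (g : U2) : ∃ s : U2, (s⁻¹ * g * s) 0 1 = 0 ∧
    (s⁻¹ * g * s) 1 0 = 0 := by
  obtain ⟨u, hu⟩ := Module.End.exists_eigenvalue (Matrix.toLin' (g : Matrix (Fin 2) (Fin 2) ℂ))
  obtain ⟨x, hx⟩ := hu.exists_hasEigenvector
  have hx0 : x ≠ 0 := hx.2
  have hgx : (g : Matrix (Fin 2) (Fin 2) ℂ) *ᵥ x = u • x := by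
    simpa using hx.apply_eq_smul
  set r : ℝ := √(‖x 0‖ ^ 2 + ‖x 1‖ ^ 2) with hr
  have hpos : 0 < ‖x 0‖ ^ 2 + ‖x 1‖ ^ 2 := by
    by_contra hcon
    have h0 : ‖x 0‖ = 0 := by nlinarith [norm_nonneg (x 0), norm_nonneg (x 1)]
    have h1 : ‖x 1‖ = 0 := by nlinarith [norm_nonneg (x 0), norm_nonneg (x 1)]
    exact hx0 (by funext i; fin_cases i <;> [exact norm_eq_zero.1 h0; exact norm_eq_zero.1 h1])
  have hr2 : (r : ℂ) * r = x 0 * starRingEnd ℂ (x 0) + x 1 * starRingEnd ℂ (x 1) := by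
    rw [Complex.mul_conj, Complex.mul_conj, Complex.normSq_eq_norm_sq, Complex.normSq_eq_norm_sq]
    rw [← Complex.ofReal_mul, hr, Real.mul_self_sqrt hpos.le]
    push_cast; ring
  have hr0 : (r : ℂ) ≠ 0 := by
    have : 0 < r := Real.sqrt_pos.2 hpos
    exact_mod_cast this.ne'
  set S : Matrix (Fin 2) (Fin 2) ℂ :=
    !![x 0 / r, -starRingEnd ℂ (x 1) / r; x 1 / r, starRingEnd ℂ (x 0) / r] with hS
  have hmem : S ∈ unitaryGroup (Fin 2) ℂ := by
    rw [mem_unitaryGroup_iff']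
    ext i j
    fin_cases i <;> fin_cases j <;>
      simp [hS, Matrix.mul_apply, Fin.sum_univ_two, Matrix.star_apply] <;> field_simp
    · linear_combination -hr2
    · ring
    · ring
    · linear_combination -hr2
  let s : U2 := ⟨S, hmem⟩
  set t : U2 := s⁻¹ * g * s with ht
  have hst : (s : Matrix (Fin 2) (Fin 2) ℂ) * t = g * s := by
    rw [← UnitaryGroup.mul_val, ← UnitaryGroup.mul_val, ht]
    congr 1
    group
  have hcol : (t : Matrix (Fin 2) (Fin 2) ℂ) *ᵥ ![1, 0] = u • ![1, 0] := by
    have h1 : (s : Matrix (Fin 2) (Fin 2) ℂ) *ᵥ ![1, 0] = (r : ℂ)⁻¹ • x := by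
      funext i
      fin_cases i <;> simp [s, hS, Matrix.mulVec, dotProduct, Fin.sum_univ_two] <;> field_simp
    have h2 : (s : Matrix (Fin 2) (Fin 2) ℂ) *ᵥ ((t : Matrix (Fin 2) (Fin 2) ℂ) *ᵥ ![1, 0]) =
        (s : Matrix (Fin 2) (Fin 2) ℂ) *ᵥ (u • ![1, 0]) := by
      rw [Matrix.mulVec_mulVec, hst, ← Matrix.mulVec_mulVec, h1, Matrix.mulVec_smul, hgx,
        Matrix.mulVec_smul, h1, smul_comm]
    have h3 := congrArg (fun y => ((s⁻¹ : U2) : Matrix (Fin 2) (Fin 2) ℂ) *ᵥ y) h2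
    simp only [Matrix.mulVec_mulVec, ← UnitaryGroup.mul_val, inv_mul_cancel] at h3
    simpa using h3
  have h10 : t 1 0 = 0 := by
    have := congrFun hcol 1
    simpa [Matrix.mulVec, dotProduct, Fin.sum_univ_two] using this
  have ha : t 0 0 ≠ 0 := by
    intro h
    have := unitary_sum_mul_conj (t⁻¹) 0 0
    simp [Fin.sum_univ_two, U2_inv_apply, h, h10] at this
  refine ⟨s, ?_, h10⟩
  have := unitary_sum_mul_conj (t⁻¹) 0 1
  simp [Fin.sum_univ_two, U2_inv_apply, h10, ha] at this
  exact this

lemma trace_rhoPQ (p q : ℕ) (g : U2) {u v : ℂ}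
    (htr : u + v = (g : Matrix (Fin 2) (Fin 2) ℂ).trace)
    (hdet : u * v = (g : Matrix (Fin 2) (Fin 2) ℂ).det) :
    LinearMap.trace ℂ _ (rhoPQ 2 p q g) = chi p q u v := by
  obtain ⟨s, h01, h10⟩ := exists_unitary_conj_diag g
  set t : U2 := s⁻¹ * g * s with ht
  have h1 : LinearMap.trace ℂ _ (rhoPQ 2 p q g) = LinearMap.trace ℂ _ (rhoPQ 2 p q t) := by
    have : t = s⁻¹ * g * s⁻¹⁻¹ := by rw [inv_inv]
    rw [this]
    exact (Representation.char_conj (rhoPQ 2 p q) g s⁻¹).symm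
  have hss : (s : Matrix (Fin 2) (Fin 2) ℂ) * ((s⁻¹ : U2) : Matrix (Fin 2) (Fin 2) ℂ) = 1 := by
    rw [← UnitaryGroup.mul_val, mul_inv_cancel]; rfl
  have htm : (t : Matrix (Fin 2) (Fin 2) ℂ) = ((s⁻¹ : U2) : Matrix (Fin 2) (Fin 2) ℂ) * g * s := rfl
  have htr' : u + v = t 0 0 + t 1 1 := by
    rw [← Matrix.trace_fin_two, htm, Matrix.trace_mul_comm, ← Matrix.mul_assoc, hss,
      Matrix.one_mul, htr]
  have hdet' : u * v = t 0 0 * t 1 1 := by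
    have h := Matrix.det_fin_two (t : Matrix (Fin 2) (Fin 2) ℂ)
    rw [h01, zero_mul, sub_zero] at h
    have hd := congrArg Matrix.det hss
    rw [Matrix.det_mul, Matrix.det_one] at hd
    rw [← h, htm, Matrix.det_mul, Matrix.det_mul]
    linear_combination hdet - (g : Matrix (Fin 2) (Fin 2) ℂ).det * hd
  rw [h1, trace_rhoPQ_of_diag p q t h01 h10]
  have : (u - t 0 0) * (u - t 1 1) = 0 := by linear_combination u * htr' - hdet'
  rcases mul_eq_zero.1 this with h | h
  · have hu : u = t 0 0 := sub_eq_zero.1 h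
    have hv : v = t 1 1 := by linear_combination htr' - hu
    rw [hu, hv]
  · have hu : u = t 1 1 := sub_eq_zero.1 h
    have hv : v = t 0 0 := by linear_combination htr' - hu
    rw [hu, hv, chi_comm]

lemma card_mul_dimHpqInv (p q : ℕ) (G : Subgroup U2) [Fintype G] :
    (Nat.card G : ℂ) * dimHpqInv 2 p q (G : Set U2) =
      ∑ g : G, LinearMap.trace ℂ _ (rhoPQ 2 p q g) := by
  set ρ : Representation ℂ G (Hpq 2 p q) := (rhoPQ 2 p q).comp G.subtype with hρ
  have hc : (Nat.card G : ℂ) ≠ 0 := by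
    exact_mod_cast Nat.card_pos.ne'
  let _ : Invertible (Nat.card G : ℂ) := invertibleOfNonzero hc
  have h := ρ.card_inv_mul_sum_char_eq_finrank
  have hinv : HpqInv 2 p q (G : Set U2) = ρ.invariants.map (Hpq 2 p q).subtype := by
    ext f
    simp only [HpqInv, Submodule.mem_inf, Submodule.mem_iInf, LinearMap.mem_ker,
      Submodule.mem_map, Representation.mem_invariants]
    constructor
    · rintro ⟨hf, hG⟩
      refine ⟨⟨f, hf⟩, fun g => ?_, rfl⟩
      have := hG g g.2
      rw [LinearMap.sub_apply, sub_eq_zero] at this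
      exact Subtype.ext this
    · rintro ⟨f, hG, rfl⟩
      refine ⟨f.2, fun g hg => ?_⟩
      rw [LinearMap.sub_apply, sub_eq_zero]
      exact congrArg Subtype.val (hG ⟨g, hg⟩)
  have hdim : dimHpqInv 2 p q (G : Set U2) = Module.finrank ℂ ρ.invariants := by
    rw [dimHpqInv, hinv]
    exact (Submodule.equivMapOfInjective _ (Submodule.injective_subtype _) _).finrank_eq.symm
  rw [hdim, ← h, mul_inv_cancel_left₀ hc]
  rfl

end Trace

section Characters

variable {A : Type*} [Group A] [Finite A]

lemma injHom_pow_eq_one (φ : A →* ℂ) (hφ : Function.Injective φ) (m : ℤ) :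
    (∀ a, φ a ^ m = 1) ↔ (Nat.card A : ℤ) ∣ m := by
  have hφ0 : ∀ a, φ a ≠ 0 := fun a h => by
    have : φ a * φ a⁻¹ = 1 := by rw [← map_mul, mul_inv_cancel, map_one]
    simp [h] at this
  have key : ∀ a, φ a ^ m = φ (a ^ m) := fun a =>
    (map_zpow' φ (fun x => eq_inv_of_mul_eq_one_left (by rw [← map_mul, inv_mul_cancel, map_one]))
      a m).symm
  constructor
  · intro h
    have := isCyclic_of_injective_ringHom φ hφ
    obtain ⟨g, hg⟩ := IsCyclic.exists_ofOrder_eq_natCard (α := A)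
    rw [← hg, orderOf_dvd_iff_zpow_eq_one]
    exact hφ (by rw [← key, h, map_one])
  · rintro h a
    rw [key, orderOf_dvd_iff_zpow_eq_one.1 ((Int.natCast_dvd_natCast.2 (orderOf_dvd_natCard a)).trans h),
      map_one]

lemma injHom_sum_zpow [Fintype A] (φ : A →* ℂ) (hφ : Function.Injective φ) (m : ℤ) :
    ∑ a, φ a ^ m = if (Nat.card A : ℤ) ∣ m then (Nat.card A : ℂ) else 0 := by
  classical
  let ψ : A →* ℂ :=
    { toFun := fun a => φ a ^ m
      map_one' := by simp
      map_mul' := fun a b => by rw [map_mul, mul_zpow] }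
  have h := sum_hom_units ψ
  have h1 : ψ = 1 ↔ (Nat.card A : ℤ) ∣ m := by
    rw [← injHom_pow_eq_one φ hφ, DFunLike.ext_iff]; rfl
  simp only [h1, Fintype.card_eq_nat_card] at h
  split_ifs with h2
  · rw [if_pos h2] at h; exact h
  · rw [if_neg h2] at h; exact h.trans Nat.cast_zero

lemma injHom_range (φ : A →* ℂ) (hφ : Function.Injective φ) {x : ℂ}
    (hx : x ^ Nat.card A = 1) : ∃ a, φ a = x := by
  classical
  have := Fintype.ofFinite A
  have hpos : 0 < Nat.card A := Nat.card_pos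
  have h1 : Finset.univ.image φ ⊆ Polynomial.nthRootsFinset (Nat.card A) (1 : ℂ) := by
    intro y hy
    obtain ⟨a, -, rfl⟩ := Finset.mem_image.1 hy
    rw [Polynomial.mem_nthRootsFinset hpos, ← map_pow, pow_card_eq_one', map_one]
  have h2 : Finset.univ.image φ = Polynomial.nthRootsFinset (Nat.card A) (1 : ℂ) := by
    refine Finset.eq_of_subset_of_card_le h1 ?_
    rw [Finset.card_image_of_injective _ hφ, Finset.card_univ, Fintype.card_eq_nat_card]
    exact (Multiset.toFinset_card_le _).trans (Polynomial.card_nthRoots _ _)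
  have h3 : x ∈ Finset.univ.image φ := by
    rw [h2, Polynomial.mem_nthRootsFinset hpos]; exact hx
  obtain ⟨a, -, ha⟩ := Finset.mem_image.1 h3
  exact ⟨a, ha⟩

end Characters

section Scalars

/-- The matrix is a scalar matrix. -/
def IsScal (g : Matrix (Fin 2) (Fin 2) ℂ) : Prop := ∃ c : ℂ, g = c • 1

lemma IsScal.eq_smul {g : Matrix (Fin 2) (Fin 2) ℂ} (h : IsScal g) : g = g 0 0 • 1 := by
  obtain ⟨c, rfl⟩ := h
  simp

lemma exists_eigenvalues (g : U2) : ∃ u v : ℂ, u + v = (g : Matrix (Fin 2) (Fin 2) ℂ).trace ∧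
    u * v = (g : Matrix (Fin 2) (Fin 2) ℂ).det ∧ u ≠ 0 ∧ v ≠ 0 ∧
    (u = v → (g : Matrix (Fin 2) (Fin 2) ℂ) = u • 1) ∧
    ∀ m, g ^ m = 1 → u ^ m = 1 ∧ v ^ m = 1 := by
  obtain ⟨s, h01, h10⟩ := exists_unitary_conj_diag g
  set t : U2 := s⁻¹ * g * s with ht
  have hg : g = s * t * s⁻¹ := by rw [ht]; group
  have hss : (s : Matrix (Fin 2) (Fin 2) ℂ) * ((s⁻¹ : U2) : Matrix (Fin 2) (Fin 2) ℂ) = 1 := by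
    rw [← UnitaryGroup.mul_val, mul_inv_cancel]; rfl
  have hgm : (g : Matrix (Fin 2) (Fin 2) ℂ) = s * t * ((s⁻¹ : U2) : Matrix (Fin 2) (Fin 2) ℂ) := by
    rw [hg]; rfl
  have hss' : ((s⁻¹ : U2) : Matrix (Fin 2) (Fin 2) ℂ) * (s : Matrix (Fin 2) (Fin 2) ℂ) = 1 := by
    rw [← UnitaryGroup.mul_val, inv_mul_cancel]; rfl
  have htd : (t : Matrix (Fin 2) (Fin 2) ℂ) = Matrix.diagonal ![t 0 0, t 1 1] := by
    ext i j
    fin_cases i <;> fin_cases j <;> simp [h01, h10]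
  have htdet : (t : Matrix (Fin 2) (Fin 2) ℂ).det = t 0 0 * t 1 1 := by
    rw [Matrix.det_fin_two, h01]; ring
  have hdet : (g : Matrix (Fin 2) (Fin 2) ℂ).det = t 0 0 * t 1 1 := by
    rw [← htdet, hgm, Matrix.det_mul, Matrix.det_mul, mul_right_comm, ← Matrix.det_mul, hss,
      Matrix.det_one, one_mul]
  have hne : (t : Matrix (Fin 2) (Fin 2) ℂ).det ≠ 0 := by
    have h := congrArg Matrix.det (Unitary.coe_mul_star_self t)
    rw [Matrix.det_mul, Matrix.det_one] at h
    exact left_ne_zero_of_mul_eq_one h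
  rw [htdet] at hne
  refine ⟨t 0 0, t 1 1, ?_, hdet.symm, left_ne_zero_of_mul hne, right_ne_zero_of_mul hne, ?_, ?_⟩
  · rw [hgm, Matrix.trace_mul_comm, ← Matrix.mul_assoc, hss', Matrix.one_mul, Matrix.trace_fin_two]
  · intro h
    have h1 : (t : Matrix (Fin 2) (Fin 2) ℂ) = (t 0 0) • (1 : Matrix (Fin 2) (Fin 2) ℂ) := by
      ext i j
      fin_cases i <;> fin_cases j <;> simp [h01, h10, h]
    rw [hgm, h1]
    simp
  · intro m hm
    have h1 : t ^ m = 1 := by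
      have : t = s⁻¹ * g * s⁻¹⁻¹ := by rw [inv_inv]
      rw [this, conj_pow, hm]; simp
    have h2 : (t : Matrix (Fin 2) (Fin 2) ℂ) ^ m = 1 := by
      rw [← SubmonoidClass.coe_pow, h1]; rfl
    rw [htd, Matrix.diagonal_pow, ← Matrix.diagonal_one, Matrix.diagonal_eq_diagonal_iff] at h2
    exact ⟨by simpa using h2 0, by simpa using h2 1⟩

/-- The scalar elements of a subgroup. -/
def scal (G : Subgroup U2) : Subgroup U2 where
  carrier := {g | g ∈ G ∧ IsScal g}
  mul_mem' := by
    rintro a b ⟨ha, c, hc⟩ ⟨hb, d, hd⟩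
    exact ⟨mul_mem ha hb, c * d, by rw [UnitaryGroup.mul_val, hc, hd]; simp [smul_smul, mul_comm]⟩
  one_mem' := ⟨one_mem _, 1, by simp⟩
  inv_mem' := by
    rintro a ⟨ha, hs⟩
    refine ⟨inv_mem ha, starRingEnd ℂ (a 0 0), ?_⟩
    have h := hs.eq_smul
    have e : ((a⁻¹ : U2) : Matrix (Fin 2) (Fin 2) ℂ) = star (a : Matrix (Fin 2) (Fin 2) ℂ) := rfl
    rw [e, h, star_smul, star_one]
    simp

lemma mem_scal {G : Subgroup U2} {g : U2} : g ∈ scal G ↔ g ∈ G ∧ IsScal g := Iff.rfl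

/-- The scalar by which a scalar element acts. -/
def scalHom (G : Subgroup U2) : scal G →* ℂ where
  toFun g := (g : U2) 0 0
  map_one' := by simp
  map_mul' a b := by
    rw [Subgroup.coe_mul, UnitaryGroup.mul_val, b.2.2.eq_smul]
    simp [mul_comm]

lemma scalHom_apply {G : Subgroup U2} (g : scal G) :
    ((g : U2) : Matrix (Fin 2) (Fin 2) ℂ) = scalHom G g • 1 := g.2.2.eq_smul

lemma scalHom_injective (G : Subgroup U2) : Function.Injective (scalHom G) := by
  intro a b h
  refine Subtype.ext (Subtype.ext ?_)
  rw [scalHom_apply, scalHom_apply, h]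

instance (G : Subgroup U2) [hG : Finite G] : Finite (scal G) :=
  Finite.of_injective (Subgroup.inclusion (fun _ h => h.1 : scal G ≤ G))
    (Subgroup.inclusion_injective _)

lemma card_scal_dvd (G : Subgroup U2) : Nat.card (scal G) ∣ Nat.card G :=
  Subgroup.card_dvd_of_le fun _ h => h.1

/-- The elements of a finite subgroup as a finset. -/
def elems (G : Subgroup U2) [Finite G] : Finset U2 := (Set.toFinite (G : Set U2)).toFinset

@[simp]
lemma mem_elems {G : Subgroup U2} [Finite G] {g : U2} : g ∈ elems G ↔ g ∈ G := by
  simp [elems]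

lemma card_elems (G : Subgroup U2) [Finite G] : (elems G).card = Nat.card G := by
  rw [elems, ← Set.ncard_eq_toFinset_card (G : Set U2) (Set.toFinite _)]; rfl

lemma sum_elems {M : Type*} [AddCommMonoid M] (G : Subgroup U2) [Finite G] [Fintype G]
    (f : U2 → M) : ∑ g ∈ elems G, f g = ∑ g : G, f g :=
  Finset.sum_subtype _ (fun _ => mem_elems) f

end Scalars

section Spectrum

lemma chi_closed (p q : ℕ) {u v : ℂ} (hu : u ≠ 0) (hv : v ≠ 0) :
    (v - u) * chi p q u v = u ^ (-(p : ℤ)) * v ^ ((q : ℤ) + 1) - u ^ ((q : ℤ) + 1) * v ^ (-(p : ℤ)) := by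
  have h : ∀ m : ℕ, (v - u) * ∑ k ∈ Finset.range m, u ^ ((q : ℤ) - k) * v ^ ((k : ℤ) - p) =
      u ^ ((q : ℤ) + 1 - m) * v ^ ((m : ℤ) - p) - u ^ ((q : ℤ) + 1) * v ^ (-(p : ℤ)) := by
    intro m
    induction m with
    | zero => simp
    | succ m ih =>
      rw [Finset.sum_range_succ, mul_add, ih]
      have e1 : (q : ℤ) + 1 - m = (q - m) + 1 := by ring
      have e2 : ((m + 1 : ℕ) : ℤ) - p = (m - p) + 1 := by push_cast; ring
      have e3 : (q : ℤ) + 1 - (m + 1 : ℕ) = q - m := by push_cast; ring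
      rw [e1, e2, e3, zpow_add_one₀ hu, zpow_add_one₀ hv]
      ring
  rw [chi, h]
  congr 3 <;> · push_cast; ring

lemma chi_self (p q : ℕ) {c : ℂ} (hc : c ≠ 0) :
    chi p q c c = (p + q + 1 : ℕ) * c ^ ((q : ℤ) - p) := by
  rw [chi, Finset.sum_congr rfl (g := fun _ => c ^ ((q : ℤ) - p))]
  · simp
  · intro k _
    rw [← zpow_add₀ hc]
    congr 1; ring

lemma zpow_congr_of_pow_eq_one {u : ℂ} {n : ℕ} (hu0 : u ≠ 0) (hu : u ^ n = 1) {a b : ℤ}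
    (h : (n : ℤ) ∣ a - b) : u ^ a = u ^ b := by
  obtain ⟨c, hc⟩ := h
  have : a = b + n * c := by omega
  rw [this, zpow_add₀ hu0, _root_.zpow_mul, zpow_natCast, hu, _root_.one_zpow, mul_one]

/-- The character of `H_{p,q}`. -/
def tr (p q : ℕ) (g : U2) : ℂ := LinearMap.trace ℂ _ (rhoPQ 2 p q g)

lemma tr_periodic {g : U2} (hg : ¬ IsScal g) {n p q p' q' : ℕ} (hn : g ^ n = 1)
    (hp : (n : ℤ) ∣ (p : ℤ) - p') (hq : (n : ℤ) ∣ (q : ℤ) - q') : tr p q g = tr p' q' g := by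
  obtain ⟨u, v, htr, hdet, hu, hv, huv, hpow⟩ := exists_eigenvalues g
  have hne : v - u ≠ 0 := fun h => hg ⟨u, huv (sub_eq_zero.1 h).symm⟩
  rw [tr, tr, trace_rhoPQ p q g htr hdet, trace_rhoPQ p' q' g htr hdet]
  apply mul_left_cancel₀ hne
  rw [chi_closed p q hu hv, chi_closed p' q' hu hv]
  obtain ⟨hun, hvn⟩ := hpow n hn
  have h1 : (n : ℤ) ∣ -(p : ℤ) - -(p' : ℤ) := by
    rw [show -(p : ℤ) - -(p' : ℤ) = -((p : ℤ) - p') by ring]; exact hp.neg_right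
  have h2 : (n : ℤ) ∣ ((q : ℤ) + 1) - ((q' : ℤ) + 1) := by
    rw [show ((q : ℤ) + 1) - ((q' : ℤ) + 1) = (q : ℤ) - q' by ring]; exact hq
  rw [zpow_congr_of_pow_eq_one hu hun h1, zpow_congr_of_pow_eq_one hu hun h2,
    zpow_congr_of_pow_eq_one hv hvn h1, zpow_congr_of_pow_eq_one hv hvn h2]

lemma tr_scal {g : U2} {c : ℂ} (hg : (g : Matrix (Fin 2) (Fin 2) ℂ) = c • 1) (p q : ℕ) :
    tr p q g = (p + q + 1 : ℕ) * c ^ ((q : ℤ) - p) := by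
  have hc : c ≠ 0 := by
    rintro rfl
    have := unitary_sum_mul_conj g 0 0
    simp [hg] at this
  rw [tr, trace_rhoPQ p q g (u := c) (v := c), chi_self p q hc]
  · rw [hg, Matrix.trace_fin_two]; simp
  · rw [hg, Matrix.det_fin_two]; simp

variable (G : Subgroup U2) [Finite G]

lemma card_mul_dim (p q : ℕ) :
    (Nat.card G : ℂ) * dimHpqInv 2 p q (G : Set U2) = ∑ g ∈ elems G, tr p q g := by
  have := Fintype.ofFinite G
  rw [card_mul_dimHpqInv, sum_elems]; rfl

open scoped Classical in
/-- The non-scalar elements of a finite subgroup. -/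
def nonscal : Finset U2 := (elems G).filter fun g => ¬ IsScal g

lemma mem_nonscal {G : Subgroup U2} [Finite G] {g : U2} :
    g ∈ nonscal G ↔ g ∈ G ∧ ¬ IsScal g := by
  simp [nonscal]

lemma sum_split {M : Type*} [AddCommMonoid M] (f : U2 → M) :
    ∑ g ∈ elems G, f g = ∑ g ∈ elems (scal G), f g + ∑ g ∈ nonscal G, f g := by
  classical
  rw [← Finset.sum_filter_add_sum_filter_not (elems G) (fun g => IsScal g)]
  congr 1
  · refine Finset.sum_congr ?_ fun _ _ => rfl
    ext g
    simp [mem_scal]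

lemma sum_scal_tr (p q : ℕ) : ∑ g ∈ elems (scal G), tr p q g =
    (p + q + 1 : ℕ) * if (Nat.card (scal G) : ℤ) ∣ (q : ℤ) - p then (Nat.card (scal G) : ℂ) else 0 := by
  have := Fintype.ofFinite (scal G)
  rw [sum_elems, ← injHom_sum_zpow (scalHom G) (scalHom_injective G), Finset.mul_sum]
  exact Finset.sum_congr rfl fun g _ => tr_scal (scalHom_apply g) p q

lemma dim_shift {p q p' q' : ℕ} (hp : (Nat.card G : ℤ) ∣ (p : ℤ) - p')
    (hq : (Nat.card G : ℤ) ∣ (q : ℤ) - q') :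
    Nat.card G * dimHpqInv 2 p q (G : Set U2) +
        (p' + q' + 1) * (if (Nat.card (scal G) : ℤ) ∣ (q : ℤ) - p then Nat.card (scal G) else 0) =
      Nat.card G * dimHpqInv 2 p' q' (G : Set U2) +
        (p + q + 1) * (if (Nat.card (scal G) : ℤ) ∣ (q : ℤ) - p then Nat.card (scal G) else 0) := by
  have hz : ((Nat.card (scal G) : ℤ) ∣ (q' : ℤ) - p') ↔ ((Nat.card (scal G) : ℤ) ∣ (q : ℤ) - p) := by
    have hd : (Nat.card (scal G) : ℤ) ∣ Nat.card G := Int.natCast_dvd_natCast.2 (card_scal_dvd G)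
    have := dvd_sub (hd.trans hq) (hd.trans hp)
    rw [← dvd_add_right this]
    ring_nf
  have h1 := card_mul_dim G p q
  have h2 := card_mul_dim G p' q'
  have h3 : ∑ g ∈ nonscal G, tr p q g = ∑ g ∈ nonscal G, tr p' q' g := by
    refine Finset.sum_congr rfl fun g hg => ?_
    rw [mem_nonscal] at hg
    refine tr_periodic hg.2 (n := Nat.card G) ?_ hp hq
    have := pow_card_eq_one' (x := (⟨g, hg.1⟩ : G))
    exact congrArg Subtype.val this
  rw [sum_split, sum_scal_tr, h3] at h1
  rw [sum_split, sum_scal_tr, if_congr hz rfl rfl] at h2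
  have : ((Nat.card G * dimHpqInv 2 p q (G : Set U2) +
        (p' + q' + 1) * (if (Nat.card (scal G) : ℤ) ∣ (q : ℤ) - p then Nat.card (scal G) else 0) : ℕ) : ℂ) =
      (Nat.card G * dimHpqInv 2 p' q' (G : Set U2) +
        (p + q + 1) * (if (Nat.card (scal G) : ℤ) ∣ (q : ℤ) - p then Nat.card (scal G) else 0) : ℕ) := by
    push_cast at h1 h2 ⊢
    rw [h1, h2]
    ring
  exact_mod_cast this

/-- Half the spectral multiplicity function, indexed by factorisations `m = (p+1) q`. -/
def cSpec (m : ℕ) : ℕ := ∑ x ∈ m.divisorsAntidiagonal, dimHpqInv 2 (x.1 - 1) x.2 (G : Set U2)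

omit [Finite G] in
lemma specMult_two_mul {m : ℕ} (hm : 0 < m) : specMult (G : Set U2) (2 * m) = cSpec G m := by
  rw [specMult, cSpec]
  refine Finset.sum_bij' (fun x _ => (x.1 + 1, x.2)) (fun x _ => (x.1 - 1, x.2)) ?_ ?_ ?_ ?_ ?_
  · rintro ⟨p, q⟩ h
    simp only [Finset.mem_filter] at h
    rw [Nat.mem_divisorsAntidiagonal]
    refine ⟨?_, hm.ne'⟩
    have := h.2.2
    dsimp only at this ⊢
    nlinarith
  · rintro ⟨d, e⟩ h
    rw [Nat.mem_divisorsAntidiagonal] at h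
    dsimp only at h ⊢
    have hd : 0 < d := Nat.pos_of_ne_zero (by rintro rfl; simp at h; omega)
    have he : 0 < e := Nat.pos_of_ne_zero (by rintro rfl; simp at h; omega)
    have h1 : d ≤ m := Nat.le_of_dvd hm ⟨e, h.1.symm⟩
    have h2 : e ≤ m := Nat.le_of_dvd hm ⟨d, by rw [mul_comm]; exact h.1.symm⟩
    simp only [Finset.mem_filter, Finset.mem_product, Finset.mem_range]
    refine ⟨⟨by omega, by omega⟩, he, ?_⟩
    rw [Nat.sub_add_cancel hd, mul_assoc, mul_comm e, h.1]
  · rintro ⟨p, q⟩ h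
    simp
  · rintro ⟨d, e⟩ h
    rw [Nat.mem_divisorsAntidiagonal] at h
    have hd : 0 < d := Nat.pos_of_ne_zero (by rintro rfl; simp at h; omega)
    simp [Nat.sub_add_cancel hd]
  · rintro ⟨p, q⟩ h
    simp

/-- The weighted count of factorisations governing the growth of the spectrum. -/
def bSpec (z r : ℕ) : ℕ :=
  ∑ x ∈ r.divisorsAntidiagonal, (x.1 + x.2) * if (z : ℤ) ∣ (x.1 : ℤ) - x.2 - 1 then 1 else 0

lemma sum_divisorsAntidiagonal_mul_prime {r l : ℕ} (hr : 0 < r) (hl : l.Prime) (hrl : r < l)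
    (f : ℕ × ℕ → ℕ) : ∑ x ∈ (r * l).divisorsAntidiagonal, f x =
      ∑ x ∈ r.divisorsAntidiagonal, (f (x.1 * l, x.2) + f (x.1, x.2 * l)) := by
  classical
  have hl0 : 0 < l := hl.pos
  rw [Finset.sum_add_distrib, ← Finset.sum_filter_add_sum_filter_not _ (fun x => l ∣ x.1)]
  congr 1
  · refine Finset.sum_bij' (fun x _ => (x.1 / l, x.2)) (fun x _ => (x.1 * l, x.2)) ?_ ?_ ?_ ?_ ?_
    · rintro ⟨d, e⟩ h
      simp only [Finset.mem_filter, Nat.mem_divisorsAntidiagonal] at h ⊢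
      obtain ⟨⟨h1, -⟩, ⟨c, rfl⟩⟩ := h
      refine ⟨?_, hr.ne'⟩
      rw [Nat.mul_div_cancel_left _ hl0]
      apply Nat.eq_of_mul_eq_mul_right hl0
      rw [← h1]; ring
    · rintro ⟨d, e⟩ h
      simp only [Finset.mem_filter, Nat.mem_divisorsAntidiagonal] at h ⊢
      refine ⟨⟨?_, by positivity⟩, Dvd.intro_left _ rfl⟩
      rw [← h.1]; ring
    · rintro ⟨d, e⟩ h
      simp only [Finset.mem_filter] at h
      simp [Nat.div_mul_cancel h.2]
    · rintro ⟨d, e⟩ h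
      simp [hl0]
    · rintro ⟨d, e⟩ h
      simp only [Finset.mem_filter] at h
      simp [Nat.div_mul_cancel h.2]
  · refine Finset.sum_bij' (fun x _ => (x.1, x.2 / l)) (fun x _ => (x.1, x.2 * l)) ?_ ?_ ?_ ?_ ?_
    · rintro ⟨d, e⟩ h
      simp only [Finset.mem_filter, Nat.mem_divisorsAntidiagonal] at h ⊢
      obtain ⟨⟨h1, -⟩, h2⟩ := h
      obtain ⟨c, rfl⟩ : l ∣ e := (hl.dvd_mul.1 (Dvd.intro_left r h1.symm)).resolve_left h2
      refine ⟨?_, hr.ne'⟩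
      rw [Nat.mul_div_cancel_left _ hl0]
      apply Nat.eq_of_mul_eq_mul_right hl0
      rw [← h1]; ring
    · rintro ⟨d, e⟩ h
      simp only [Finset.mem_filter, Nat.mem_divisorsAntidiagonal] at h ⊢
      refine ⟨⟨?_, by positivity⟩, fun hd => ?_⟩
      · rw [← h.1]; ring
      · have h3 := Nat.le_of_dvd hr (hd.trans ⟨e, h.1.symm⟩)
        omega
    · rintro ⟨d, e⟩ h
      simp only [Finset.mem_filter, Nat.mem_divisorsAntidiagonal] at h
      have h2 : l ∣ e := (hl.dvd_mul.1 (Dvd.intro_left r h.1.1.symm)).resolve_left h.2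
      simp [Nat.div_mul_cancel h2]
    · rintro ⟨d, e⟩ h
      simp [hl0]
    · rintro ⟨d, e⟩ h
      simp only [Finset.mem_filter, Nat.mem_divisorsAntidiagonal] at h
      have h2 : l ∣ e := (hl.dvd_mul.1 (Dvd.intro_left r h.1.1.symm)).resolve_left h.2
      simp [Nat.div_mul_cancel h2]

lemma cSpec_mul_prime {r l t : ℕ} (hr : 0 < r) (hl : l.Prime) (hrl : r < l)
    (ht : l = 1 + Nat.card G * t) :
    cSpec G (r * l) = 2 * cSpec G r + t * Nat.card (scal G) * bSpec (Nat.card (scal G)) r := by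
  have hn : 0 < Nat.card G := Nat.card_pos
  rw [cSpec, sum_divisorsAntidiagonal_mul_prime hr hl hrl, cSpec, bSpec, Finset.mul_sum,
    Finset.mul_sum, ← Finset.sum_add_distrib]
  refine Finset.sum_congr rfl ?_
  rintro ⟨d, e⟩ h
  rw [Nat.mem_divisorsAntidiagonal] at h
  have hd : 0 < d := Nat.pos_of_ne_zero (by rintro rfl; simp at h; omega)
  dsimp only
  have hl1 : 0 < d * l := Nat.mul_pos hd hl.pos
  set n := Nat.card G with hn'
  set z := Nat.card (scal G) with hz'
  have hzn : (z : ℤ) ∣ n := Int.natCast_dvd_natCast.2 (card_scal_dvd G)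
  have hln : (n : ℤ) ∣ (l : ℤ) - 1 := ⟨t, by rw [ht]; push_cast; ring⟩
  have c1 : ((d * l - 1 : ℕ) : ℤ) = d * l - 1 := by rw [Nat.cast_sub hl1]; push_cast; ring
  have c2 : ((d - 1 : ℕ) : ℤ) = d - 1 := by rw [Nat.cast_sub hd]; push_cast; ring
  have s1 := dim_shift G (p := d * l - 1) (q := e) (p' := d - 1) (q' := e)
    (by rw [c1, c2, show (d * l - 1 - (d - 1) : ℤ) = d * (l - 1) by ring]; exact hln.mul_left _)
    (by simp)
  have s2 := dim_shift G (p := d - 1) (q := e * l) (p' := d - 1) (q' := e)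
    (by simp)
    (by push_cast; rw [show (e * l - e : ℤ) = e * (l - 1) by ring]; exact hln.mul_left _)
  have i1 : ((z : ℤ) ∣ (e : ℤ) - (d * l - 1 : ℕ)) ↔ ((z : ℤ) ∣ (d : ℤ) - e - 1) := by
    rw [c1, ← dvd_neg, ← dvd_add_left ((hzn.trans hln).mul_left (-(d : ℤ)))]
    ring_nf
  have i2 : ((z : ℤ) ∣ ((e * l : ℕ) : ℤ) - (d - 1 : ℕ)) ↔ ((z : ℤ) ∣ (d : ℤ) - e - 1) := by
    rw [c2, ← dvd_neg, ← dvd_add_left ((hzn.trans hln).mul_left (e : ℤ))]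
    push_cast
    ring_nf
  rw [← hz', ← hn', if_congr i1 rfl rfl] at s1
  rw [← hz', ← hn', if_congr i2 rfl rfl] at s2
  have k1 : d * l - 1 + e + 1 = (d + e) + n * (t * d) := by
    rw [ht]
    have : d * (1 + n * t) = d + n * (t * d) := by ring
    omega
  have k2 : d - 1 + e * l + 1 = (d + e) + n * (t * e) := by
    rw [ht]
    have : e * (1 + n * t) = e + n * (t * e) := by ring
    omega
  have k3 : d - 1 + e + 1 = d + e := by omega
  rw [k1, k3] at s1
  rw [k2, k3] at s2
  apply Nat.eq_of_mul_eq_mul_left hn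
  split_ifs at s1 s2 ⊢ <;> nlinarith

end Spectrum

section Asymptotics

lemma bSpec_ratio (G G' : Subgroup U2) [Finite G] [Finite G']
    (h : ∀ m, 0 < m → cSpec G m = cSpec G' m) {r : ℕ} (hr : 0 < r) :
    Nat.card G' * (Nat.card (scal G) * bSpec (Nat.card (scal G)) r) =
      Nat.card G * (Nat.card (scal G') * bSpec (Nat.card (scal G')) r) := by
  have hn : 0 < Nat.card G := Nat.card_pos
  have hn' : 0 < Nat.card G' := Nat.card_pos
  obtain ⟨l, hlr, hl, hmod⟩ := Nat.forall_exists_prime_gt_and_modEq (max r 1)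
    (q := Nat.card G * Nat.card G') (a := 1) (by positivity) (by simp)
  have hrl : r < l := lt_of_le_of_lt (le_max_left _ _) hlr
  obtain ⟨t, ht⟩ := (Nat.modEq_iff_dvd' hl.pos).1 hmod.symm
  have ht0 : 0 < t := Nat.pos_of_ne_zero (by
    rintro rfl
    have := hl.one_lt
    simp at ht
    omega)
  have hl' : l = 1 + Nat.card G * Nat.card G' * t := by have := hl.pos; omega
  have h1 := cSpec_mul_prime G (t := Nat.card G' * t) hr hl hrl (by rw [hl']; ring)
  have h2 := cSpec_mul_prime G' (t := Nat.card G * t) hr hl hrl (by rw [hl']; ring)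
  rw [h _ (Nat.mul_pos hr hl.pos), h2, h _ hr] at h1
  apply Nat.eq_of_mul_eq_mul_right ht0
  nlinarith

lemma bSpec_lt {z z' : ℕ} (hz : 0 < z) (h : z < z') : bSpec z' z < bSpec z z := by
  refine Finset.sum_lt_sum ?_ ⟨(1, z), ?_, ?_⟩
  · rintro ⟨d, e⟩ hx
    rw [Nat.mem_divisorsAntidiagonal] at hx
    refine Nat.mul_le_mul_left _ ?_
    dsimp only at hx ⊢
    split_ifs with h1 h2
    · exact le_rfl
    · refine absurd ?_ h2
      have hd : 0 < d := Nat.pos_of_ne_zero (by rintro rfl; simp at hx; omega)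
      have he : 0 < e := Nat.pos_of_ne_zero (by rintro rfl; simp at hx; omega)
      have hd' : d ≤ z := Nat.le_of_dvd hz ⟨e, hx.1.symm⟩
      have he' : e ≤ z := Nat.le_of_dvd hz ⟨d, by rw [mul_comm]; exact hx.1.symm⟩
      have : (d : ℤ) - e - 1 = 0 := Int.eq_zero_of_abs_lt_dvd h1 (by rw [abs_lt]; omega)
      rw [this]; exact dvd_zero _
    · exact Nat.zero_le _
    · exact le_rfl
  · simp [hz.ne']
  · dsimp only
    rw [if_neg, if_pos]
    · omega
    · rw [Nat.cast_one]; ring_nf; simp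
    · intro hd
      rw [Nat.cast_one, show (1 - (z : ℤ) - 1) = -z by ring, dvd_neg] at hd
      have := Int.le_of_dvd (by omega) hd
      omega

lemma divisorsAntidiagonal_two : Nat.divisorsAntidiagonal 2 = {(1, 2), (2, 1)} := by decide

lemma divisorsAntidiagonal_three : Nat.divisorsAntidiagonal 3 = {(1, 3), (3, 1)} := by decide

lemma divisorsAntidiagonal_four : Nat.divisorsAntidiagonal 4 = {(1, 4), (2, 2), (4, 1)} := by
  decide

lemma divisorsAntidiagonal_six :
    Nat.divisorsAntidiagonal 6 = {(1, 6), (2, 3), (3, 2), (6, 1)} := by decide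

lemma natCast_dvd_one {z : ℕ} : (z : ℤ) ∣ 1 ↔ z = 1 := by
  rw [← Nat.cast_one, Int.natCast_dvd_natCast, Nat.dvd_one]

lemma bSpec_one (z : ℕ) : bSpec z 1 = if z = 1 then 2 else 0 := by
  rw [bSpec, Nat.divisorsAntidiagonal_one, Finset.sum_singleton]
  have : ((z : ℤ) ∣ ((1 : ℕ) : ℤ) - (1 : ℕ) - 1) ↔ z = 1 := by
    norm_num [natCast_dvd_one]
  simp only [this]
  split_ifs <;> simp

lemma bSpec_two (z : ℕ) : bSpec z 2 = 3 * (1 + if z ∣ 2 then 1 else 0) := by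
  rw [bSpec, divisorsAntidiagonal_two, Finset.sum_pair (by decide)]
  have : ((z : ℤ) ∣ -2) ↔ z ∣ 2 := by
    rw [dvd_neg]; exact_mod_cast Int.natCast_dvd_natCast
  norm_num [this]
  split_ifs <;> simp

lemma bSpec_three (z : ℕ) : bSpec z 3 = 4 * ((if z ∣ 3 then 1 else 0) + if z = 1 then 1 else 0) := by
  rw [bSpec, divisorsAntidiagonal_three, Finset.sum_pair (by decide)]
  have : ((z : ℤ) ∣ -3) ↔ z ∣ 3 := by
    rw [dvd_neg]; exact_mod_cast Int.natCast_dvd_natCast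
  norm_num [this, natCast_dvd_one]
  split_ifs <;> simp

lemma bSpec_four (z : ℕ) : bSpec z 4 = 5 * (if z ∣ 4 then 1 else 0) + 4 * (if z = 1 then 1 else 0) +
    5 * (if z ∣ 2 then 1 else 0) := by
  rw [bSpec, divisorsAntidiagonal_four, Finset.sum_insert (by decide), Finset.sum_pair (by decide)]
  have : ((z : ℤ) ∣ -4) ↔ z ∣ 4 := by
    rw [dvd_neg]; exact_mod_cast Int.natCast_dvd_natCast
  have h2 : ((z : ℤ) ∣ 2) ↔ z ∣ 2 := by exact_mod_cast Int.natCast_dvd_natCast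
  have h1 : ((z : ℤ) ∣ -1) ↔ z = 1 := by
    rw [dvd_neg, natCast_dvd_one]
  norm_num [this, h1, h2]
  split_ifs <;> simp

lemma ratio_lt {n n' z z' : ℕ} (hn : 0 < n) (hz : 0 < z) (hlt : z < z')
    (h : ∀ r, 0 < r → n' * (z * bSpec z r) = n * (z' * bSpec z' r)) :
    n = n' ∧ z = 2 ∧ z' = 4 := by
  have hz' : 0 < z' := by omega
  have hn' : 0 < n' := by
    rcases Nat.eq_zero_or_pos n' with h0 | h0
    · have := h 2 (by norm_num)
      rw [h0, zero_mul, bSpec_two] at this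
      have : 0 < n * (z' * (3 * (1 + if z' ∣ 2 then 1 else 0))) := by positivity
      omega
    · exact h0
  have h1 := h 1 one_pos
  have h2 := h 2 two_pos
  have h3 := h 3 three_pos
  have h4 := h 4 four_pos
  rw [bSpec_one, bSpec_one] at h1
  rw [bSpec_two, bSpec_two] at h2
  rw [bSpec_three, bSpec_three] at h3
  rw [bSpec_four, bSpec_four] at h4
  have hz1 : z ≠ 1 := by
    rintro rfl
    rw [if_pos rfl, if_neg (by omega)] at h1
    omega
  have hz2' : ¬ z' ∣ 2 := fun hd => by
    have := Nat.le_of_dvd two_pos hd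
    omega
  rw [if_neg hz2'] at h2 h4
  by_cases hz2 : z = 2
  · subst hz2
    norm_num [hz1, show z' ≠ 1 by omega] at h2 h3 h4
    have hd4 : z' ∣ 4 := by
      by_contra hcon
      rw [if_neg hcon] at h4
      omega
    have hle := Nat.le_of_dvd four_pos hd4
    have : z' = 4 := by interval_cases z' <;> omega
    subst this
    refine ⟨?_, rfl, rfl⟩
    omega
  · exfalso
    have hz2d : ¬ z ∣ 2 := fun hd => by
      have := Nat.le_of_dvd two_pos hd
      omega
    rw [if_neg hz2d] at h2
    have h5 := h z hz
    have hnz : n' * z = n * z' := by nlinarith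
    have h6 : bSpec z z = bSpec z' z := by
      rw [← mul_assoc, ← mul_assoc, hnz] at h5
      exact Nat.eq_of_mul_eq_mul_left (by positivity) h5
    have := bSpec_lt hz hlt
    omega

lemma card_of_isospectral (G G' : Subgroup U2) [Finite G] [Finite G']
    (h : ∀ m, 0 < m → cSpec G m = cSpec G' m) : Nat.card G = Nat.card G' ∧
      (Nat.card (scal G) = Nat.card (scal G') ∨
        (Nat.card (scal G) = 2 ∧ Nat.card (scal G') = 4) ∨
        (Nat.card (scal G) = 4 ∧ Nat.card (scal G') = 2)) := by
  have hn : 0 < Nat.card G := Nat.card_pos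
  have hn' : 0 < Nat.card G' := Nat.card_pos
  have hz : 0 < Nat.card (scal G) := Nat.card_pos
  have hz' : 0 < Nat.card (scal G') := Nat.card_pos
  have hb := fun r hr => bSpec_ratio G G' h (r := r) hr
  rcases lt_trichotomy (Nat.card (scal G)) (Nat.card (scal G')) with hlt | heq | hgt
  · obtain ⟨h1, h2, h3⟩ := ratio_lt hn hz hlt hb
    exact ⟨h1, Or.inr (Or.inl ⟨h2, h3⟩)⟩
  · refine ⟨?_, Or.inl heq⟩
    have := hb 2 two_pos
    rw [← heq, bSpec_two] at this
    exact (Nat.eq_of_mul_eq_mul_right (by positivity) this).symm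
  · obtain ⟨h1, h2, h3⟩ := ratio_lt hn' hz' hgt fun r hr => (hb r hr).symm
    exact ⟨h1.symm, Or.inr (Or.inr ⟨h3, h2⟩)⟩

end Asymptotics

section Poles

/-- Complex `2 × 2` matrices. -/
abbrev M2 := Matrix (Fin 2) (Fin 2) ℂ

/-- Projections of rank one. -/
structure IsPole (E : M2) : Prop where
  idem : E * E = E
  trace_eq : E.trace = 1

lemma M2_ext_iff {A B : M2} :
    A = B ↔ A 0 0 = B 0 0 ∧ A 0 1 = B 0 1 ∧ A 1 0 = B 1 0 ∧ A 1 1 = B 1 1 := by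
  rw [← Matrix.ext_iff]
  simp only [Fin.forall_fin_two, and_assoc]

lemma M2_mul_apply (A B : M2) (i j : Fin 2) : (A * B) i j = A i 0 * B 0 j + A i 1 * B 1 j := by
  rw [Matrix.mul_apply, Fin.sum_univ_two]

lemma M2_cayley (A : M2) : A * A = A.trace • A - A.det • 1 := by
  rw [M2_ext_iff]
  simp only [M2_mul_apply, Matrix.sub_apply, Matrix.smul_apply, smul_eq_mul, Matrix.trace_fin_two,
    Matrix.det_fin_two, Matrix.one_apply]
  norm_num
  refine ⟨?_, ?_, ?_, ?_⟩ <;> ring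

namespace IsPole

variable {E : M2} (hE : IsPole E)
include hE

lemma compl : IsPole (1 - E) := by
  refine ⟨?_, ?_⟩
  · rw [sub_mul, mul_sub, mul_sub, hE.idem]; simp
  · rw [Matrix.trace_sub, hE.trace_eq, Matrix.trace_one]; norm_num

lemma ne_zero : E ≠ 0 := by
  rintro rfl
  have := hE.trace_eq
  simp at this

lemma det_eq : E.det = 0 := by
  have h := M2_cayley E
  rw [hE.idem, hE.trace_eq, one_smul] at h
  have h2 := congrFun (congrFun h 0) 0
  simp at h2
  linear_combination h2

lemma mul_mul_self (X : M2) : E * X * E = (X * E).trace • E := by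
  have h1 := hE.trace_eq
  have h2 := hE.det_eq
  rw [Matrix.trace_fin_two] at h1
  rw [Matrix.det_fin_two] at h2
  rw [M2_ext_iff]
  simp only [M2_mul_apply, Matrix.smul_apply, smul_eq_mul, Matrix.trace_fin_two]
  refine ⟨?_, ?_, ?_, ?_⟩
  · linear_combination (-X 1 1) * h2
  · linear_combination X 0 1 * h2
  · linear_combination X 1 0 * h2
  · linear_combination (-X 0 0) * h2

lemma mul_eq_smul {g : M2} (hg : g * E = E * g) : g * E = (g * E).trace • E := by
  rw [← hE.mul_mul_self, ← hg, mul_assoc, hE.idem]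

lemma decomp {g : M2} (hg : g * E = E * g) :
    g = (g * E).trace • E + (g * (1 - E)).trace • (1 - E) := by
  have hg' : g * (1 - E) = (1 - E) * g := by rw [mul_sub, sub_mul, hg]; simp
  rw [← hE.mul_eq_smul hg, ← hE.compl.mul_eq_smul hg', ← mul_add]
  simp

omit hE in
lemma trace_mul_add (g : M2) : (g * E).trace + (g * (1 - E)).trace = g.trace := by
  rw [← Matrix.trace_add, ← mul_add]; simp

lemma det_of_decomp (a b : ℂ) : (a • E + b • (1 - E)).det = a * b := by
  have h1 := hE.trace_eq
  have h2 := hE.det_eq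
  rw [Matrix.trace_fin_two] at h1
  rw [Matrix.det_fin_two] at h2 ⊢
  simp only [Matrix.add_apply, Matrix.smul_apply, smul_eq_mul, Matrix.sub_apply, Matrix.one_apply]
  norm_num
  linear_combination (a - b) ^ 2 * h2 + (a - b) * b * h1

lemma det_eq_mul {g : M2} (hg : g * E = E * g) :
    g.det = (g * E).trace * (g * (1 - E)).trace := by
  conv_lhs => rw [hE.decomp hg]
  exact hE.det_of_decomp _ _

lemma isScal_iff {g : M2} (hg : g * E = E * g) :
    IsScal g ↔ (g * E).trace = (g * (1 - E)).trace := by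
  constructor
  · rintro ⟨c, rfl⟩
    simp [hE.trace_eq, hE.compl.trace_eq]
  · intro h
    refine ⟨(g * E).trace, ?_⟩
    conv_lhs => rw [hE.decomp hg, ← h, ← smul_add]
    simp

lemma comm_of_comm {g h : M2} (hg : g * E = E * g) (hh : h * E = E * h) : g * h = h * g := by
  have e1 : E * (1 - E) = 0 := by rw [mul_sub, hE.idem]; simp
  have e2 : (1 - E) * E = 0 := by rw [sub_mul, hE.idem]; simp
  rw [hE.decomp hg, hE.decomp hh]
  simp only [mul_add, add_mul, smul_mul_assoc, mul_smul_comm, e1, e2, hE.idem, hE.compl.idem,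
    smul_zero]
  module

lemma comm_of_nonscal {g X : M2} (hg : g * E = E * g) (hgs : ¬ IsScal g) (hX : g * X = X * g) :
    X * E = E * X := by
  have hne : (g * E).trace - (g * (1 - E)).trace ≠ 0 := by
    rw [sub_ne_zero]
    exact fun h => hgs ((hE.isScal_iff hg).2 h)
  have h := hE.decomp hg
  set a := (g * E).trace
  set b := (g * (1 - E)).trace
  have hE' : E = (a - b)⁻¹ • (g - b • 1) := by
    rw [eq_inv_smul_iff₀ hne, h]
    module
  rw [hE']
  simp only [mul_smul_comm, smul_mul_assoc, mul_sub, sub_mul, hX, mul_one, one_mul]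

lemma eq_or_eq_compl {F g : M2} (hF : IsPole F) (hg : g * E = E * g) (hg' : g * F = F * g)
    (hgs : ¬ IsScal g) : F = E ∨ F = 1 - E := by
  have hc : F * E = E * F := hE.comm_of_nonscal hg hgs hg'
  have h := hE.decomp hc
  have hdet := hF.det_eq
  have htr := hF.trace_eq
  rw [hE.det_eq_mul hc] at hdet
  rw [← trace_mul_add (E := E)] at htr
  rcases mul_eq_zero.1 hdet with h0 | h0
  · right
    rw [h0, zero_add] at htr
    rw [h0, htr] at h
    simpa using h
  · left
    rw [h0, add_zero] at htr
    rw [h0, htr] at h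
    simpa using h

end IsPole

lemma comm_of_comm_nonscal {g X Y E : M2} (hE : IsPole E) (hg : g * E = E * g) (hgs : ¬ IsScal g)
    (hX : g * X = X * g) (hY : g * Y = Y * g) : X * Y = Y * X :=
  hE.comm_of_comm (hE.comm_of_nonscal hg hgs hX) (hE.comm_of_nonscal hg hgs hY)

lemma exists_pole (g : U2) : ∃ E, IsPole E ∧ (g : M2) * E = E * g := by
  obtain ⟨u, v, htr, hdet, hu, hv, huv, -⟩ := exists_eigenvalues g
  by_cases h : u = v
  · refine ⟨!![1, 0; 0, 0], ⟨?_, ?_⟩, ?_⟩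
    · ext i j; fin_cases i <;> fin_cases j <;> simp
    · simp [Matrix.trace_fin_two]
    · rw [huv h]; simp
  · have hne : u - v ≠ 0 := sub_ne_zero.2 h
    have hc := M2_cayley g
    rw [← htr, ← hdet] at hc
    refine ⟨(u - v)⁻¹ • ((g : M2) - v • 1), ⟨?_, ?_⟩, ?_⟩
    · have h2 : ((g : M2) - v • 1) * ((g : M2) - v • 1) = (u - v) • ((g : M2) - v • 1) := by
        simp only [smul_mul_assoc, mul_smul_comm, mul_sub, sub_mul, hc, mul_one, one_mul]
        module
      rw [smul_mul_assoc, mul_smul_comm, h2, smul_smul (u - v)⁻¹ (u - v), inv_mul_cancel₀ hne,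
        one_smul]
    · rw [Matrix.trace_smul, Matrix.trace_sub, ← htr, Matrix.trace_smul, Matrix.trace_one]
      simp only [Fintype.card_fin, smul_eq_mul]
      push_cast
      rw [show u + v - v * 2 = u - v by ring, inv_mul_cancel₀ hne]
    · simp only [smul_mul_assoc, mul_smul_comm, mul_sub, sub_mul, mul_one, one_mul]

end Poles

section Torus

/-- The elements of `G` commuting with a given matrix. -/
def tor (G : Subgroup U2) (E : M2) : Subgroup U2 where
  carrier := {g | g ∈ G ∧ (g : M2) * E = E * g}
  mul_mem' := by
    rintro a b ⟨ha, ha'⟩ ⟨hb, hb'⟩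
    refine ⟨mul_mem ha hb, ?_⟩
    rw [UnitaryGroup.mul_val, mul_assoc, hb', ← mul_assoc, ha', mul_assoc]
  one_mem' := ⟨one_mem _, by simp⟩
  inv_mem' := by
    rintro a ⟨ha, h⟩
    refine ⟨inv_mem ha, ?_⟩
    have e1 : ((a⁻¹ : U2) : M2) * a = 1 := by
      rw [← UnitaryGroup.mul_val, inv_mul_cancel]; rfl
    have e2 : (a : M2) * ((a⁻¹ : U2) : M2) = 1 := by
      rw [← UnitaryGroup.mul_val, mul_inv_cancel]; rfl
    calc ((a⁻¹ : U2) : M2) * E = ((a⁻¹ : U2) : M2) * (E * a) * ((a⁻¹ : U2) : M2) := by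
          rw [mul_assoc, mul_assoc, e2, mul_one]
      _ = E * ((a⁻¹ : U2) : M2) := by rw [← h, ← mul_assoc, e1, one_mul]

lemma mem_tor {G : Subgroup U2} {E : M2} {g : U2} :
    g ∈ tor G E ↔ g ∈ G ∧ (g : M2) * E = E * g := Iff.rfl

lemma tor_le (G : Subgroup U2) (E : M2) : tor G E ≤ G := fun _ h => h.1

lemma tor_compl (G : Subgroup U2) (E : M2) : tor G (1 - E) = tor G E := by
  ext g
  rw [mem_tor, mem_tor, mul_sub, sub_mul, mul_one, one_mul, sub_right_inj]

lemma scal_le_tor (G : Subgroup U2) (E : M2) : scal G ≤ tor G E := by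
  rintro g ⟨hg, c, hc⟩
  exact ⟨hg, by rw [hc]; simp⟩

lemma scal_tor (G : Subgroup U2) (E : M2) : scal (tor G E) = scal G := by
  ext g
  exact ⟨fun h => ⟨h.1.1, h.2⟩, fun h => ⟨scal_le_tor G E h, h.2⟩⟩

instance (G : Subgroup U2) (E : M2) [Finite G] : Finite (tor G E) :=
  Finite.of_injective (Subgroup.inclusion (tor_le G E)) (Subgroup.inclusion_injective _)

lemma tor_comm {G : Subgroup U2} {E : M2} (hE : IsPole E) {g h : U2} (hg : g ∈ tor G E)
    (hh : h ∈ tor G E) : g * h = h * g :=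
  Subtype.ext (hE.comm_of_comm hg.2 hh.2)

/-- The eigenvalue of an element of a torus on the range of the pole. -/
def torHom (G : Subgroup U2) {E : M2} (hE : IsPole E) : tor G E →* ℂ where
  toFun g := ((g : U2) * E : M2).trace
  map_one' := by simp [hE.trace_eq]
  map_mul' a b := by
    have h : ((a : U2) : M2) * ((b : U2) * E) = (((b : U2) : M2) * E).trace • ((a : U2) * E : M2) := by
      conv_lhs => rw [hE.mul_eq_smul b.2.2, mul_smul_comm]
    rw [Subgroup.coe_mul, UnitaryGroup.mul_val, mul_assoc, h, Matrix.trace_smul, smul_eq_mul,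
      mul_comm]

lemma torHom_apply (G : Subgroup U2) {E : M2} (hE : IsPole E) (g : tor G E) :
    torHom G hE g = (((g : U2) : M2) * E).trace := rfl

lemma torHom_injective {G : Subgroup U2} (hfree : actsFreely (G : Set U2)) {E : M2}
    (hE : IsPole E) : Function.Injective (torHom G hE) := by
  rw [injective_iff_map_eq_one]
  intro a ha
  rw [torHom_apply] at ha
  have h1 := hE.mul_eq_smul a.2.2
  rw [ha, one_smul] at h1
  refine Subtype.ext (hfree a a.2.1 ?_)
  by_contra hdet
  have h2 : (((a : U2) : M2) - 1) * E = 0 := by rw [sub_mul, h1]; simp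
  have hu : IsUnit (((a : U2) : M2) - 1) := (Matrix.isUnit_iff_isUnit_det _).2 (Ne.isUnit hdet)
  exact hE.ne_zero ((hu.mul_right_eq_zero).1 h2)

end Torus

section Conj

lemma U2_val_inv_mul (h : U2) : ((h⁻¹ : U2) : M2) * h = 1 := by
  rw [← UnitaryGroup.mul_val, inv_mul_cancel]; rfl

lemma U2_val_mul_inv (h : U2) : (h : M2) * ((h⁻¹ : U2) : M2) = 1 := by
  rw [← UnitaryGroup.mul_val, mul_inv_cancel]; rfl

/-- Conjugation of a matrix by a unitary matrix. -/
def cj (h : U2) (E : M2) : M2 := h * E * ((h⁻¹ : U2) : M2)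

lemma cj_one (E : M2) : cj 1 E = E := by simp [cj]

lemma cj_mul (g h : U2) (E : M2) : cj (g * h) E = cj g (cj h E) := by
  simp only [cj, _root_.mul_inv_rev, UnitaryGroup.mul_val, mul_assoc]

lemma cj_eq_iff {h : U2} {E F : M2} : cj h E = F ↔ (h : M2) * E = F * h := by
  constructor
  · rintro rfl
    rw [cj, mul_assoc, U2_val_inv_mul, mul_one]
  · intro e
    rw [cj, e, mul_assoc, U2_val_mul_inv, mul_one]

lemma cj_mul_mul (h : U2) (A B : M2) : cj h (A * B) = cj h A * cj h B := by
  calc cj h (A * B) = (h : M2) * A * 1 * B * ((h⁻¹ : U2) : M2) := by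
        simp only [cj, mul_one, mul_assoc]
    _ = cj h A * cj h B := by rw [← U2_val_inv_mul h]; simp only [cj, mul_assoc]

lemma cj_trace (h : U2) (A : M2) : (cj h A).trace = A.trace := by
  rw [cj, Matrix.trace_mul_comm, ← mul_assoc, U2_val_inv_mul, one_mul]

lemma cj_val (h g : U2) : cj h g = ((h * g * h⁻¹ : U2) : M2) := by
  simp only [cj, UnitaryGroup.mul_val]

lemma cj_inv_cj (h : U2) (A : M2) : cj h⁻¹ (cj h A) = A := by
  rw [← cj_mul, inv_mul_cancel, cj_one]

lemma cj_injective (h : U2) : Function.Injective (cj h) :=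
  Function.LeftInverse.injective (cj_inv_cj h)

lemma IsPole.cj {E : M2} (hE : IsPole E) (h : U2) : IsPole (cj h E) :=
  ⟨by rw [← cj_mul_mul, hE.idem], by rw [cj_trace, hE.trace_eq]⟩

lemma cj_comm_iff (h g : U2) (E : M2) :
    ((h * g * h⁻¹ : U2) : M2) * cj h E = cj h E * ((h * g * h⁻¹ : U2) : M2) ↔
      (g : M2) * E = E * g := by
  rw [← cj_val, ← cj_mul_mul, ← cj_mul_mul, (cj_injective h).eq_iff]

lemma isScal_conj_iff (h g : U2) :
    IsScal ((h * g * h⁻¹ : U2) : M2) ↔ IsScal (g : M2) := by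
  have key : ∀ h g : U2, IsScal (g : M2) → IsScal ((h * g * h⁻¹ : U2) : M2) := by
    rintro h g ⟨c, hc⟩
    refine ⟨c, ?_⟩
    rw [← cj_val, hc, cj, mul_smul_comm, smul_mul_assoc, mul_one, U2_val_mul_inv]
  refine ⟨fun hs => ?_, key h g⟩
  have := key h⁻¹ _ hs
  have e : h⁻¹ * (h * g * h⁻¹) * h⁻¹⁻¹ = g := by group
  rwa [e] at this

lemma mem_tor_cj {G : Subgroup U2} {E : M2} {h g : U2} (hh : h ∈ G) :
    h * g * h⁻¹ ∈ tor G (cj h E) ↔ g ∈ tor G E := by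
  rw [mem_tor, mem_tor, cj_comm_iff]
  refine and_congr_left fun _ => ⟨fun hm => ?_, fun hm => mul_mem (mul_mem hh hm) (inv_mem hh)⟩
  have e : g = h⁻¹ * (h * g * h⁻¹) * h := by group
  rw [e]
  exact mul_mem (mul_mem (inv_mem hh) hm) hh

/-- Tori at conjugate poles are conjugate. -/
def torConj {G : Subgroup U2} {h : U2} (hh : h ∈ G) (E : M2) : tor G E ≃ tor G (cj h E) where
  toFun g := ⟨h * g * h⁻¹, (mem_tor_cj hh).2 g.2⟩
  invFun g := ⟨h⁻¹ * g * h, by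
    rw [← mem_tor_cj hh]
    have e : h * (h⁻¹ * (g : U2) * h) * h⁻¹ = g := by group
    rw [e]; exact g.2⟩
  left_inv g := Subtype.ext (by simp only; group)
  right_inv g := Subtype.ext (by simp only; group)

lemma card_tor_cj {G : Subgroup U2} {h : U2} (hh : h ∈ G) (E : M2) :
    Nat.card (tor G (cj h E)) = Nat.card (tor G E) :=
  (Nat.card_congr (torConj hh E)).symm

lemma sum_nonscal_tor_cj {G : Subgroup U2} [Finite G] {h : U2} (hh : h ∈ G) (E : M2)
    (f : U2 → ℂ) (hf : ∀ g ∈ G, ∀ k ∈ G, f (k * g * k⁻¹) = f g) :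
    ∑ g ∈ nonscal (tor G (cj h E)), f g = ∑ g ∈ nonscal (tor G E), f g := by
  symm
  refine Finset.sum_bij' (fun g _ => h * g * h⁻¹) (fun g _ => h⁻¹ * g * h) ?_ ?_ ?_ ?_ ?_
  · intro g hg
    rw [mem_nonscal] at hg ⊢
    exact ⟨(mem_tor_cj hh).2 hg.1, fun hs => hg.2 ((isScal_conj_iff h g).1 hs)⟩
  · intro g hg
    rw [mem_nonscal] at hg ⊢
    have e : h * (h⁻¹ * (g : U2) * h) * h⁻¹ = g := by group
    refine ⟨?_, fun hs => hg.2 ?_⟩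
    · rw [← mem_tor_cj hh, e]; exact hg.1
    · rw [← isScal_conj_iff h, e] at hs; exact hs
  · intro g _; group
  · intro g _; group
  · intro g hg
    exact (hf g (mem_nonscal.1 hg).1.1 h hh).symm

/-- The poles of the nonscalar elements of a group. -/
def PoleSet (G : Subgroup U2) : Type :=
  {E : M2 // IsPole E ∧ ∃ g ∈ G, ¬ IsScal (g : M2) ∧ (g : M2) * E = E * g}

instance (G : Subgroup U2) : MulAction G (PoleSet G) where
  smul h E := ⟨cj h E.1, E.2.1.cj h, by
    obtain ⟨g, hg, hs, hc⟩ := E.2.2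
    exact ⟨h * g * h⁻¹, mul_mem (mul_mem h.2 hg) (inv_mem h.2),
      fun h' => hs ((isScal_conj_iff _ _).1 h'), (cj_comm_iff _ _ _).2 hc⟩⟩
  one_smul E := Subtype.ext (cj_one _)
  mul_smul g h E := Subtype.ext (cj_mul _ _ _)

instance (G : Subgroup U2) [Finite G] : Finite (PoleSet G) := by
  choose P hP hPc using exists_pole
  have hfin : ((fun g : G => P g) '' Set.univ ∪ (fun g : G => 1 - P g) '' Set.univ).Finite :=
    (Set.toFinite _).union (Set.toFinite _)
  refine (Set.Finite.subset hfin ?_ : Set.Finite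
    {E : M2 | IsPole E ∧ ∃ g ∈ G, ¬ IsScal (g : M2) ∧ (g : M2) * E = E * g})
  rintro E ⟨hE, g, hg, hs, hc⟩
  rcases (hP g).eq_or_eq_compl hE (hPc g) hc hs with h | h
  · exact Or.inl ⟨⟨g, hg⟩, trivial, h.symm⟩
  · exact Or.inr ⟨⟨g, hg⟩, trivial, h.symm⟩

end Conj

section Orbits

variable (G : Subgroup U2) [Finite G]

lemma card_nonscal : ((nonscal G).card : ℤ) = Nat.card G - Nat.card (scal G) := by
  have h := sum_split G (fun _ => (1 : ℤ))
  simp only [Finset.sum_const, card_elems, nsmul_eq_mul, mul_one] at h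
  rw [h]; ring

omit [Finite G] in
lemma card_stabilizer_pole (E : PoleSet G) :
    Nat.card (MulAction.stabilizer G E) = Nat.card (tor G E.1) := by
  refine Nat.card_congr
    { toFun := fun h => ⟨h.1, h.1.2, ?_⟩
      invFun := fun g => ⟨⟨g.1, g.2.1⟩, ?_⟩
      left_inv := fun _ => rfl
      right_inv := fun _ => rfl }
  · have := h.2
    rw [MulAction.mem_stabilizer_iff] at this
    exact cj_eq_iff.1 (congrArg Subtype.val this)
  · rw [MulAction.mem_stabilizer_iff]
    exact Subtype.ext (cj_eq_iff.2 g.2.2)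

lemma card_orbit_pole (E : PoleSet G) :
    Nat.card (MulAction.orbit G E) * Nat.card (tor G E.1) = Nat.card G := by
  classical
  have := Fintype.ofFinite G
  have := Fintype.ofFinite (PoleSet G)
  have := Fintype.ofFinite (MulAction.orbit G E)
  have := Fintype.ofFinite (MulAction.stabilizer G E)
  rw [← card_stabilizer_pole, Nat.card_eq_fintype_card, Nat.card_eq_fintype_card,
    Nat.card_eq_fintype_card, MulAction.card_orbit_mul_card_stabilizer_eq_card_group]

instance (E : M2) : Finite (tor G E) := inferInstance

lemma two_mul_sum_nonscal [Fintype (PoleSet G)] (f : U2 → ℂ) :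
    2 * ∑ g ∈ nonscal G, f g = ∑ E : PoleSet G, ∑ g ∈ nonscal (tor G E.1), f g := by
  classical
  have h1 : ∀ E : PoleSet G, ∑ g ∈ nonscal (tor G E.1), f g =
      ∑ g ∈ nonscal G, if (g : M2) * E.1 = E.1 * g then f g else 0 := by
    intro E
    rw [← Finset.sum_filter]
    refine Finset.sum_congr ?_ fun _ _ => rfl
    ext g
    simp only [mem_nonscal, Finset.mem_filter, mem_tor]
    tauto
  rw [Finset.sum_congr rfl fun E _ => h1 E, Finset.sum_comm, Finset.mul_sum]
  refine Finset.sum_congr rfl fun g hg => ?_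
  rw [mem_nonscal] at hg
  obtain ⟨E, hE, hc⟩ := exists_pole g
  have hc' : (g : M2) * (1 - E) = (1 - E) * g := by rw [mul_sub, sub_mul, hc]; simp
  let E1 : PoleSet G := ⟨E, hE, g, hg.1, hg.2, hc⟩
  let E2 : PoleSet G := ⟨1 - E, hE.compl, g, hg.1, hg.2, hc'⟩
  have hne : E1 ≠ E2 := by
    intro h
    have h' : E = 1 - E := congrArg Subtype.val h
    have h0 : E * E = E * (1 - E) := congrArg (E * ·) h'
    rw [mul_sub, hE.idem] at h0
    exact hE.ne_zero (by simpa using h0)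
  rw [← Finset.sum_filter]
  have : Finset.univ.filter (fun F : PoleSet G => (g : M2) * F.1 = F.1 * g) = {E1, E2} := by
    ext F
    simp only [Finset.mem_filter, Finset.mem_univ, true_and, Finset.mem_insert,
      Finset.mem_singleton]
    constructor
    · intro hF
      rcases hE.eq_or_eq_compl F.2.1 hc hF hg.2 with h | h
      · exact Or.inl (Subtype.ext h)
      · exact Or.inr (Subtype.ext h)
    · rintro (rfl | rfl)
      · exact hc
      · exact hc'
  rw [this, Finset.sum_pair hne]
  ring

/-- Orbits of poles. -/
abbrev PoleOrbit := MulAction.orbitRel.Quotient G (PoleSet G)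

lemma sum_pole_eq_sum_orbit [Fintype (PoleSet G)] [Fintype (PoleOrbit G)] (F : PoleSet G → ℂ)
    (hF : ∀ (h : G) E, F (h • E) = F E) :
    ∑ E, F E = ∑ ω : PoleOrbit G, (Nat.card (MulAction.orbit G ω.out) : ℂ) * F ω.out := by
  classical
  rw [← Finset.sum_fiberwise (s := Finset.univ)
    (g := fun E : PoleSet G => (Quotient.mk'' E : PoleOrbit G))]
  refine Finset.sum_congr rfl fun ω _ => ?_
  have key : ∀ E : PoleSet G, (Quotient.mk'' E : PoleOrbit G) = ω ↔
      E ∈ MulAction.orbit G ω.out := by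
    intro E
    rw [← MulAction.orbitRel_apply]
    conv_lhs => rw [← Quotient.out_eq' ω]
    exact Quotient.eq''
  have h2 : ∀ E ∈ Finset.univ.filter (fun E : PoleSet G => (Quotient.mk'' E : PoleOrbit G) = ω),
      F E = F ω.out := by
    intro E hE
    obtain ⟨h, rfl⟩ := (key E).1 (Finset.mem_filter.1 hE).2
    exact hF h _
  rw [Finset.sum_congr rfl h2, Finset.sum_const, nsmul_eq_mul]
  congr 2
  have := Fintype.ofFinite (MulAction.orbit G ω.out)
  rw [Nat.card_eq_fintype_card, Fintype.card_subtype]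
  congr 1
  ext E
  simp only [Finset.mem_filter, Finset.mem_univ, true_and, key]

/-- Representatives of the three orbits of poles of a nonabelian group, with the orders `r i` of
the tori modulo scalars and the orbit sizes `m i`. -/
structure PoleTriple (E : Fin 3 → M2) (r m : Fin 3 → ℕ) : Prop where
  pole : ∀ i, IsPole (E i)
  card_tor : ∀ i, Nat.card (tor G (E i)) = Nat.card (scal G) * r i
  two_le : ∀ i, 2 ≤ r i
  card_eq : ∀ i, Nat.card (scal G) * (r i * m i) = Nat.card G
  cover : ∀ F, IsPole F → ∀ g ∈ G, ¬ IsScal (g : M2) → (g : M2) * F = F * g →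
    ∃ i, ∃ h ∈ G, (h : M2) * E i = F * h
  sum_eq : ∀ f : U2 → ℂ, (∀ g ∈ G, ∀ h ∈ G, f (h * g * h⁻¹) = f g) →
    2 * ∑ g ∈ nonscal G, f g = ∑ i, (m i : ℂ) * ∑ g ∈ nonscal (tor G (E i)), f g

variable {G} in
lemma PoleTriple.perm {E : Fin 3 → M2} {r m : Fin 3 → ℕ} (h : PoleTriple G E r m)
    (σ : Equiv.Perm (Fin 3)) : PoleTriple G (E ∘ σ) (r ∘ σ) (m ∘ σ) where
  pole i := h.pole _
  card_tor i := h.card_tor _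
  two_le i := h.two_le _
  card_eq i := h.card_eq _
  cover F hF g hg hs hc := by
    obtain ⟨i, k, hk, e⟩ := h.cover F hF g hg hs hc
    exact ⟨σ.symm i, k, hk, by simpa using e⟩
  sum_eq f hf := by
    rw [h.sum_eq f hf]
    exact (Equiv.sum_comp σ fun i => (m i : ℂ) * ∑ g ∈ nonscal (tor G (E i)), f g).symm

lemma exists_poleTriple (hna : ∃ g ∈ G, ∃ h ∈ G, g * h ≠ h * g) :
    ∃ E r m, PoleTriple G E r m := by
  classical
  have := Fintype.ofFinite (PoleSet G)
  have := Fintype.ofFinite (PoleOrbit G)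
  have hz : 0 < Nat.card (scal G) := Nat.card_pos
  have hn : 0 < Nat.card G := Nat.card_pos
  set z := Nat.card (scal G) with hzdef
  have hdvd : ∀ ω : PoleOrbit G, z ∣ Nat.card (tor G ω.out.1) := fun ω =>
    Subgroup.card_dvd_of_le (scal_le_tor G _)
  choose r hr using hdvd
  let m : PoleOrbit G → ℕ := fun ω => Nat.card (MulAction.orbit G ω.out)
  have hm : ∀ ω, z * (r ω * m ω) = Nat.card G := by
    intro ω
    rw [← card_orbit_pole G ω.out, hr ω]
    ring
  have hmpos : ∀ ω, 0 < m ω := fun ω => by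
    rcases Nat.eq_zero_or_pos (m ω) with h | h
    · have := hm ω
      rw [h] at this; simp at this; omega
    · exact h
  have hr2 : ∀ ω, 2 ≤ r ω := by
    intro ω
    obtain ⟨hE, g, hg, hs, hc⟩ := ω.out.2
    by_contra hlt
    have h1 : r ω ≤ 1 := by omega
    have hle : Nat.card (tor G ω.out.1) ≤ z := by
      rw [hr ω]
      calc z * r ω ≤ z * 1 := Nat.mul_le_mul_left _ h1
        _ = z := mul_one z
    have heq := Subgroup.eq_of_le_of_card_ge (scal_le_tor G ω.out.1) hle
    have : g ∈ scal G := by rw [heq]; exact ⟨hg, hc⟩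
    exact hs this.2
  have hsum : ∀ f : U2 → ℂ, (∀ g ∈ G, ∀ h ∈ G, f (h * g * h⁻¹) = f g) →
      2 * ∑ g ∈ nonscal G, f g =
        ∑ ω, (m ω : ℂ) * ∑ g ∈ nonscal (tor G ω.out.1), f g := by
    intro f hf
    rw [two_mul_sum_nonscal]
    exact sum_pole_eq_sum_orbit G (fun E => ∑ g ∈ nonscal (tor G E.1), f g)
      fun h E => sum_nonscal_tor_cj h.2 E.1 f hf
  obtain ⟨N, hN⟩ := card_scal_dvd G
  have hrm : ∀ ω, r ω * m ω = N := fun ω => by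
    have := hm ω
    rw [hN] at this
    exact Nat.eq_of_mul_eq_mul_left hz this
  have hcount : (2 : ℤ) * (N - 1) = ∑ ω, ((N : ℤ) - m ω) := by
    have h1 := hsum (fun _ => 1) (fun _ _ _ _ => rfl)
    simp only [Finset.sum_const, nsmul_eq_mul, mul_one] at h1
    have h2 : (2 : ℤ) * ((nonscal G).card : ℤ) =
        ∑ ω, (m ω : ℤ) * ((nonscal (tor G ω.out.1)).card : ℤ) := by exact_mod_cast h1
    rw [card_nonscal, hN] at h2
    have h3 : ∀ ω : PoleOrbit G, (m ω : ℤ) * ((nonscal (tor G ω.out.1)).card : ℤ) =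
        (z : ℤ) * ((N : ℤ) - m ω) := by
      intro ω
      rw [card_nonscal, hr ω, scal_tor, ← hrm ω]
      push_cast
      ring
    rw [Finset.sum_congr rfl fun ω _ => h3 ω, ← Finset.mul_sum] at h2
    push_cast at h2
    have hz' : (z : ℤ) ≠ 0 := by exact_mod_cast hz.ne'
    apply mul_left_cancel₀ hz'
    rw [← h2]
    ring
  have hNpos : 0 < N := Nat.pos_of_ne_zero fun h => by rw [h] at hN; simp at hN; omega
  have hm1 : ∀ ω : PoleOrbit G, m ω = 1 → False := by
    intro ω hω
    obtain ⟨a, ha, b, hb, hab⟩ := hna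
    have hcard : Nat.card G ≤ Nat.card (tor G ω.out.1) := by
      rw [← card_orbit_pole G ω.out]
      change m ω * _ ≤ _
      rw [hω, one_mul]
    have heq := Subgroup.eq_of_le_of_card_ge (tor_le G ω.out.1) hcard
    exact hab (tor_comm ω.out.2.1 (heq.ge ha) (heq.ge hb))
  have hcard3 : Fintype.card (PoleOrbit G) = 3 := by
    have hlow : ∀ ω ∈ (Finset.univ : Finset (PoleOrbit G)), (N : ℤ) ≤ 2 * ((N : ℤ) - m ω) := by
      intro ω _
      have h1 := hrm ω
      have h2 : 2 * m ω ≤ N := by rw [← h1]; exact Nat.mul_le_mul_right _ (hr2 ω)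
      have : (2 * m ω : ℤ) ≤ N := by exact_mod_cast h2
      linarith
    have hup : ∀ ω ∈ (Finset.univ : Finset (PoleOrbit G)), ((N : ℤ) - m ω) ≤ N - 2 := by
      intro ω _
      have h2 : 2 ≤ m ω := by
        have := hmpos ω
        have : m ω ≠ 1 := hm1 ω
        omega
      have : (2 : ℤ) ≤ m ω := by exact_mod_cast h2
      linarith
    have a1 := Finset.sum_le_sum hlow
    have a2 := Finset.sum_le_sum hup
    rw [← Finset.mul_sum, ← hcount, Finset.sum_const, nsmul_eq_mul] at a1
    rw [← hcount, Finset.sum_const, nsmul_eq_mul] at a2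
    rw [Finset.card_univ] at a1 a2
    set c := Fintype.card (PoleOrbit G)
    have hN' : (0 : ℤ) < N := by exact_mod_cast hNpos
    have hc4 : c < 4 := by
      by_contra hlt
      have : (4 : ℤ) ≤ c := by exact_mod_cast not_lt.1 hlt
      nlinarith
    have hN1 : N ≠ 1 := by
      intro h1
      obtain ⟨a, ha, b, hb, hab⟩ := hna
      have heq := Subgroup.eq_of_le_of_card_ge (fun _ h => h.1 : scal G ≤ G)
        (by rw [hN, h1, mul_one])
      have ha' : a ∈ scal G := heq.ge ha
      obtain ⟨-, s, hs⟩ := ha'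
      apply hab
      apply Subtype.ext
      rw [UnitaryGroup.mul_val, UnitaryGroup.mul_val, hs]
      simp
    have hc2 : 2 < c := by
      by_contra hlt
      have hN2 : (2 : ℤ) ≤ N := by omega
      have : (c : ℤ) ≤ 2 := by exact_mod_cast not_lt.1 hlt
      nlinarith
    omega
  let e : Fin 3 ≃ PoleOrbit G := (Fintype.equivFinOfCardEq hcard3).symm
  refine ⟨fun i => (e i).out.1, fun i => r (e i), fun i => m (e i), ?_⟩
  refine ⟨fun i => (e i).out.2.1, fun i => hr _, fun i => hr2 _, fun i => hm _, ?_, ?_⟩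
  · intro F hF g hg hs hc
    let P : PoleSet G := ⟨F, hF, g, hg, hs, hc⟩
    have h1 : P ∈ MulAction.orbit G (Quotient.mk'' P : PoleOrbit G).out := by
      rw [← MulAction.orbitRel_apply]
      exact Quotient.eq''.1 (Quotient.out_eq' (Quotient.mk'' P : PoleOrbit G)).symm
    obtain ⟨h, hh⟩ := h1
    refine ⟨e.symm (Quotient.mk'' P), h, h.2, ?_⟩
    have := congrArg Subtype.val hh
    simp only [Equiv.apply_symm_apply]
    exact cj_eq_iff.1 this
  · intro f hf
    rw [hsum f hf]
    exact (Equiv.sum_comp e fun ω => (m ω : ℂ) * ∑ g ∈ nonscal (tor G ω.out.1), f g).symm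

end Orbits

section TorusParam

variable {G : Subgroup U2} [Finite G] {E : M2}

/-- The eigenvalue of an element of a torus on the kernel of the pole. -/
def torHom' (G : Subgroup U2) {E : M2} (hE : IsPole E) : tor G E →* ℂ :=
  (torHom G hE.compl).comp (Subgroup.inclusion (tor_compl G E).ge)

omit [Finite G] in
lemma torHom'_apply (hE : IsPole E) (g : tor G E) :
    torHom' G hE g = (((g : U2) : M2) * (1 - E)).trace := rfl

omit [Finite G] in
lemma torHom'_injective (hfree : actsFreely (G : Set U2)) (hE : IsPole E) :
    Function.Injective (torHom' G hE) :=
  (torHom_injective hfree hE.compl).comp (Subgroup.inclusion_injective _)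

omit [Finite G] in
lemma torHom_ne_zero (hE : IsPole E) (g : tor G E) : torHom G hE g ≠ 0 := fun h => by
  have : torHom G hE g * torHom G hE g⁻¹ = 1 := by rw [← map_mul, mul_inv_cancel, map_one]
  simp [h] at this

omit [Finite G] in
lemma isScal_iff_torHom (hE : IsPole E) (g : tor G E) :
    IsScal ((g : U2) : M2) ↔ torHom G hE g = torHom' G hE g :=
  hE.isScal_iff g.2.2

omit [Finite G] in
lemma scal_pow_card {g : U2} {c : ℂ} (hg : g ∈ G) (hc : (g : M2) = c • 1) :
    c ^ Nat.card (scal G) = 1 := by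
  let a : scal G := ⟨g, hg, c, hc⟩
  have h1 : scalHom G a ^ Nat.card (scal G) = 1 := by rw [← map_pow, pow_card_eq_one', map_one]
  have h2 := scalHom_apply a
  have h3 : ((a : U2) : M2) = c • 1 := hc
  rw [h3] at h2
  have h4 := congrFun (congrFun h2 0) 0
  simp at h4
  rwa [← h4] at h1

lemma exists_scal {c : ℂ} (hc : c ^ Nat.card (scal G) = 1) : ∃ g ∈ G, (g : M2) = c • 1 := by
  obtain ⟨a, ha⟩ := injHom_range (scalHom G) (scalHom_injective G) hc
  exact ⟨a, a.2.1, by rw [scalHom_apply, ha]⟩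

omit [Finite G] in
lemma scal_torHom_pow (hE : IsPole E) {g : tor G E} (hg : IsScal ((g : U2) : M2)) :
    torHom G hE g ^ Nat.card (scal G) = 1 := by
  obtain ⟨c, hc⟩ := hg
  have h : torHom G hE g = c := by rw [torHom_apply, hc]; simp [hE.trace_eq]
  rw [h]
  exact scal_pow_card g.2.1 hc

lemma exists_torHom_isPrimitiveRoot (hfree : actsFreely (G : Set U2)) (hE : IsPole E) {d : ℕ}
    (hd : d ∣ Nat.card (tor G E)) {ζ : ℂ} (hζ : IsPrimitiveRoot ζ d) :
    ∃ g : tor G E, torHom G hE g = ζ := by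
  apply injHom_range _ (torHom_injective hfree hE)
  obtain ⟨e, he⟩ := hd
  rw [he, pow_mul, hζ.pow_eq_one, one_pow]

lemma exists_torus_param (hfree : actsFreely (G : Set U2)) (hE : IsPole E) {r : ℕ}
    (hr : Nat.card (tor G E) = Nat.card (scal G) * r) :
    ∃ σ : ℤ, IsCoprime σ (r : ℤ) ∧
      IsCoprime (1 + (Nat.card (scal G) : ℤ) * σ) ((Nat.card (scal G) : ℤ) * r) ∧
      ∀ g : tor G E, torHom' G hE g = torHom G hE g ^ (1 + (Nat.card (scal G) : ℤ) * σ) := by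
  have hcyc := isCyclic_of_injective_ringHom _ (torHom_injective hfree hE)
  obtain ⟨X, hX⟩ := IsCyclic.exists_generator (α := tor G E)
  have hord := orderOf_eq_card_of_forall_mem_zpowers hX
  have hprim : IsPrimitiveRoot (torHom G hE X) (Nat.card (tor G E)) := by
    rw [← hord, ← orderOf_injective _ (torHom_injective hfree hE)]
    exact IsPrimitiveRoot.orderOf _
  have hpos : Nat.card (tor G E) ≠ 0 := Nat.card_pos.ne'
  have : NeZero (Nat.card (tor G E)) := ⟨hpos⟩
  obtain ⟨s, -, hs⟩ := hprim.eq_pow_of_pow_eq_one (ξ := torHom' G hE X)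
    (by rw [← map_pow, pow_card_eq_one', map_one])
  have hall : ∀ g : tor G E, torHom' G hE g = torHom G hE g ^ s := by
    intro g
    obtain ⟨i, rfl⟩ := (mem_powers_iff_mem_zpowers (x := X)).2 (hX g)
    simp only [map_pow]
    rw [← hs, ← pow_mul, ← pow_mul, mul_comm]
  have hz : (Nat.card (scal G) : ℤ) ∣ (s : ℤ) - 1 := by
    rw [← injHom_pow_eq_one (scalHom G) (scalHom_injective G)]
    intro a
    have hval := scalHom_apply a
    let b : tor G E := ⟨a, scal_le_tor G E a.2⟩
    have h1 : torHom G hE b = scalHom G a := by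
      rw [torHom_apply]; change (((a : U2) : M2) * E).trace = _
      rw [hval]; simp [hE.trace_eq]
    have h2 : torHom' G hE b = scalHom G a := by
      rw [torHom'_apply]; change (((a : U2) : M2) * (1 - E)).trace = _
      rw [hval]
      simp only [smul_mul_assoc, one_mul, Matrix.trace_smul, hE.compl.trace_eq, smul_eq_mul,
        mul_one]
    have h3 := hall b
    rw [h1, h2] at h3
    have h0 : scalHom G a ≠ 0 := h1 ▸ torHom_ne_zero hE b
    rw [zpow_sub₀ h0, zpow_natCast, ← h3, zpow_one, div_self h0]
  obtain ⟨σ, hσ⟩ := hz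
  have hs' : (1 + (Nat.card (scal G) : ℤ) * σ) = s := by omega
  have hallz : ∀ g : tor G E,
      torHom' G hE g = torHom G hE g ^ (1 + (Nat.card (scal G) : ℤ) * σ) := by
    intro g
    rw [hs', zpow_natCast, hall]
  have hzpos : 0 < Nat.card (scal G) := Nat.card_pos
  refine ⟨σ, ?_, ?_, hallz⟩
  · rw [Int.isCoprime_iff_gcd_eq_one]
    set d := Int.gcd σ r with hd
    have hd1 : (d : ℤ) ∣ σ := Int.gcd_dvd_left _ _
    have hd2 : d ∣ r := Int.natCast_dvd_natCast.1 (Int.gcd_dvd_right _ _)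
    have hd0 : d ≠ 0 := by
      intro h0
      rw [h0, zero_dvd_iff] at hd2
      rw [hd2, mul_zero] at hr
      exact hpos hr
    have hp := Complex.isPrimitiveRoot_exp (Nat.card (scal G) * d) (mul_ne_zero hzpos.ne' hd0)
    obtain ⟨g, hg⟩ := exists_torHom_isPrimitiveRoot hfree hE
      (hr ▸ Nat.mul_dvd_mul_left _ hd2) hp
    have hsc : IsScal ((g : U2) : M2) := by
      rw [isScal_iff_torHom hE, hallz, hg, zpow_add₀ (hp.ne_zero (mul_ne_zero hzpos.ne' hd0)),
        zpow_one]
      have : (((Nat.card (scal G) * d : ℕ)) : ℤ) ∣ (Nat.card (scal G) : ℤ) * σ := by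
        push_cast
        exact mul_dvd_mul_left _ hd1
      rw [(hp.zpow_eq_one_iff_dvd _).2 this, mul_one]
    have h1 := scal_torHom_pow hE hsc
    rw [hg, hp.pow_eq_one_iff_dvd] at h1
    have h2 := Nat.le_of_dvd hzpos h1
    by_contra hne
    have : 2 ≤ d := by omega
    nlinarith
  · rw [Int.isCoprime_iff_gcd_eq_one]
    set d := Int.gcd (1 + (Nat.card (scal G) : ℤ) * σ) ((Nat.card (scal G) : ℤ) * r) with hd
    have hd1 : (d : ℤ) ∣ 1 + (Nat.card (scal G) : ℤ) * σ := Int.gcd_dvd_left _ _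
    have hd2 : d ∣ Nat.card (scal G) * r := by
      have := Int.gcd_dvd_right (1 + (Nat.card (scal G) : ℤ) * σ) ((Nat.card (scal G) : ℤ) * r)
      exact_mod_cast this
    have hd0 : d ≠ 0 := by
      intro h0
      rw [h0, zero_dvd_iff] at hd2
      exact hpos (hr.trans hd2)
    have hp := Complex.isPrimitiveRoot_exp d hd0
    obtain ⟨g, hg⟩ := exists_torHom_isPrimitiveRoot hfree hE (hr ▸ hd2) hp
    have h1 : torHom' G hE g = 1 := by
      rw [hallz, hg, (hp.zpow_eq_one_iff_dvd _).2 hd1]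
    have h2 : g = 1 := torHom'_injective hfree hE (by rw [h1, map_one])
    rw [h2, map_one] at hg
    exact (hp.pow_eq_one_iff_dvd 1).1 (by rw [← hg, one_pow]) |> Nat.dvd_one.1

/-- The multiplicity count attached to a torus. -/
def cnt (z r : ℕ) (σ : ℤ) (p q : ℕ) : ℕ :=
  ((Finset.range (p + q + 1)).filter fun k : ℕ =>
    ((z * r : ℕ) : ℤ) ∣ ((q : ℤ) - p) + z * σ * ((k : ℤ) - p)).card

lemma sum_tor_tr (hfree : actsFreely (G : Set U2)) (hE : IsPole E) {r : ℕ} {σ : ℤ}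
    (hr : Nat.card (tor G E) = Nat.card (scal G) * r)
    (hσ : ∀ g : tor G E, torHom' G hE g = torHom G hE g ^ (1 + (Nat.card (scal G) : ℤ) * σ))
    (p q : ℕ) : ∑ g ∈ elems (tor G E), tr p q g =
      (Nat.card (scal G) * r : ℕ) * (cnt (Nat.card (scal G)) r σ p q : ℂ) := by
  have := Fintype.ofFinite (tor G E)
  rw [sum_elems]
  have h1 : ∀ g : tor G E, tr p q g = ∑ k ∈ Finset.range (p + q + 1),
      torHom G hE g ^ (((q : ℤ) - p) + Nat.card (scal G) * σ * ((k : ℤ) - p)) := by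
    intro g
    rw [tr, trace_rhoPQ p q g (u := torHom G hE g) (v := torHom' G hE g)
      (IsPole.trace_mul_add _) (hE.det_eq_mul g.2.2).symm, chi]
    refine Finset.sum_congr rfl fun k _ => ?_
    rw [hσ, ← _root_.zpow_mul, ← zpow_add₀ (torHom_ne_zero hE g)]
    congr 1
    ring
  rw [Finset.sum_congr rfl fun g _ => h1 g, Finset.sum_comm]
  simp only [injHom_sum_zpow (torHom G hE) (torHom_injective hfree hE)]
  rw [← Finset.sum_filter, Finset.sum_const, nsmul_eq_mul, mul_comm, cnt, hr]

lemma tr_conj (p q : ℕ) (g h : U2) : tr p q (h * g * h⁻¹) = tr p q g := by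
  obtain ⟨u, v, htr, hdet, -⟩ := exists_eigenvalues g
  rw [tr, tr, trace_rhoPQ p q g htr hdet]
  apply trace_rhoPQ
  · rw [← cj_val, cj_trace, htr]
  · rw [hdet, UnitaryGroup.mul_val, UnitaryGroup.mul_val, Matrix.det_mul, Matrix.det_mul,
      mul_right_comm, ← Matrix.det_mul, U2_val_mul_inv, Matrix.det_one, one_mul]

/-- Parameters of the three tori. -/
structure TripleParam (G : Subgroup U2) (r : Fin 3 → ℕ) (σ : Fin 3 → ℤ) : Prop where
  coprime : ∀ i, IsCoprime (σ i) (r i : ℤ)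
  coprime' : ∀ i, IsCoprime (1 + (Nat.card (scal G) : ℤ) * σ i) ((Nat.card (scal G) : ℤ) * r i)
  dim : ∀ p q, (2 * dimHpqInv 2 p q (G : Set U2) : ℤ) =
    ∑ i, (cnt (Nat.card (scal G)) (r i) (σ i) p q : ℤ) -
      if (Nat.card (scal G) : ℤ) ∣ (q : ℤ) - p then (p + q + 1 : ℤ) else 0

lemma PoleTriple.sum_m {E : Fin 3 → M2} {r m : Fin 3 → ℕ} (h : PoleTriple G E r m) :
    m 0 + m 1 + m 2 = r 0 * m 0 + 2 := by
  have h1 := h.sum_eq (fun _ => 1) (fun _ _ _ _ => rfl)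
  simp only [Finset.sum_const, nsmul_eq_mul, mul_one] at h1
  have h2 : (2 : ℤ) * ((nonscal G).card : ℤ) =
      ∑ i, (m i : ℤ) * ((nonscal (tor G (E i))).card : ℤ) := by exact_mod_cast h1
  simp only [card_nonscal, h.card_tor, scal_tor, Fin.sum_univ_three] at h2
  have hz : (Nat.card (scal G) : ℤ) ≠ 0 := by exact_mod_cast (Nat.card_pos (α := scal G)).ne'
  have c : ∀ i, (Nat.card (scal G) : ℤ) * (r i * m i) = Nat.card G := fun i => by
    exact_mod_cast h.card_eq i
  have c0 := c 0
  have c1 := c 1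
  have c2 := c 2
  push_cast at h2
  have : (m 0 + m 1 + m 2 : ℤ) = r 0 * m 0 + 2 := by
    apply mul_left_cancel₀ hz
    linear_combination h2 + c1 + c2
  exact_mod_cast this

lemma PoleTriple.exists_param (hfree : actsFreely (G : Set U2)) {E : Fin 3 → M2} {r m : Fin 3 → ℕ}
    (h : PoleTriple G E r m) : ∃ σ, TripleParam G r σ ∧ ∀ i (g : tor G (E i)),
      torHom' G (h.pole i) g = torHom G (h.pole i) g ^ (1 + (Nat.card (scal G) : ℤ) * σ i) := by
  choose σ h1 h2 h3 using fun i => exists_torus_param hfree (h.pole i) (h.card_tor i)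
  refine ⟨σ, ⟨h1, h2, fun p q => ?_⟩, h3⟩
  have hd := card_mul_dim G p q
  have hs := h.sum_eq (tr p q) (fun g _ k _ => tr_conj p q g k)
  have ht : ∀ i, ∑ g ∈ nonscal (tor G (E i)), tr p q g =
      (Nat.card (scal G) * r i : ℕ) * (cnt (Nat.card (scal G)) (r i) (σ i) p q : ℂ) -
        (p + q + 1 : ℕ) *
          if (Nat.card (scal G) : ℤ) ∣ (q : ℤ) - p then (Nat.card (scal G) : ℂ) else 0 := by
    intro i
    have := sum_split (tor G (E i)) (tr p q)
    rw [sum_tor_tr hfree (h.pole i) (h.card_tor i) (h3 i)] at this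
    have e : elems (scal (tor G (E i))) = elems (scal G) := by ext; simp [scal_tor]
    rw [e, sum_scal_tr] at this
    rw [this]; ring
  rw [sum_split, sum_scal_tr] at hd
  simp only [ht, Fin.sum_univ_three] at hs
  have hz : (Nat.card (scal G) : ℂ) ≠ 0 := by exact_mod_cast (Nat.card_pos (α := scal G)).ne'
  have hn : (Nat.card G : ℂ) ≠ 0 := by exact_mod_cast (Nat.card_pos (α := G)).ne'
  have c : ∀ i, (Nat.card (scal G) : ℂ) * (r i * m i) = Nat.card G := fun i => by
    exact_mod_cast h.card_eq i
  have c0 := c 0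
  have c1 := c 1
  have c2 := c 2
  have hm : (m 0 + m 1 + m 2 : ℂ) = r 0 * m 0 + 2 := by exact_mod_cast h.sum_m
  have key : (2 * dimHpqInv 2 p q (G : Set U2) : ℂ) =
    ∑ i, (cnt (Nat.card (scal G)) (r i) (σ i) p q : ℂ) -
      if (Nat.card (scal G) : ℤ) ∣ (q : ℤ) - p then (p + q + 1 : ℂ) else 0 := by
    apply mul_left_cancel₀ hn
    rw [Fin.sum_univ_three]
    split_ifs at hs hd ⊢
    · push_cast at *
      linear_combination 2 * hd + hs + (cnt (Nat.card (scal G)) (r 0) (σ 0) p q : ℂ) * c0 + (cnt (Nat.card (scal G)) (r 1) (σ 1) p q : ℂ) * c1 + (cnt (Nat.card (scal G)) (r 2) (σ 2) p q : ℂ) * c2 - (p + q + 1) * Nat.card (scal G) * hm - (p + q + 1) * c0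
    · push_cast at *
      linear_combination 2 * hd + hs + (cnt (Nat.card (scal G)) (r 0) (σ 0) p q : ℂ) * c0 + (cnt (Nat.card (scal G)) (r 1) (σ 1) p q : ℂ) * c1 + (cnt (Nat.card (scal G)) (r 2) (σ 2) p q : ℂ) * c2
  rw [Fin.sum_univ_three] at key ⊢
  split_ifs at key ⊢
  all_goals exact_mod_cast key

end TorusParam

section Classify

/-- The possible orders of the tori modulo scalars, with the order of the group modulo scalars. -/
def TripleType (N : ℕ) (r : Fin 3 → ℕ) : Prop :=
  (r 0 = 2 ∧ r 1 = 2 ∧ N = 2 * r 2) ∨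
    (r 0 = 2 ∧ r 1 = 3 ∧ ((r 2 = 3 ∧ N = 12) ∨ (r 2 = 4 ∧ N = 24) ∨ (r 2 = 5 ∧ N = 60)))

lemma tripleType_of_sum {N : ℕ} {r m : Fin 3 → ℕ} (hN : 0 < N) (h2 : 2 ≤ r 0) (h01 : r 0 ≤ r 1)
    (h12 : r 1 ≤ r 2) (hm : ∀ i, r i * m i = N) (hs : m 0 + m 1 + m 2 = N + 2) :
    TripleType N r := by
  have e0 := hm 0
  have e1 := hm 1
  have e2 := hm 2
  unfold TripleType
  generalize r 0 = a at *
  generalize r 1 = b at *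
  generalize r 2 = c at *
  generalize m 0 = x at *
  generalize m 1 = y at *
  generalize m 2 = w at *
  clear hm
  have hx : 0 < x := Nat.pos_of_ne_zero fun h => by rw [h, mul_zero] at e0; omega
  have hyx : y ≤ x := by
    by_contra hlt
    have := Nat.mul_le_mul h01 (show x + 1 ≤ y by omega)
    nlinarith
  have hwy : w ≤ y := by
    by_contra hlt
    have := Nat.mul_le_mul h12 (show y + 1 ≤ w by omega)
    nlinarith
  have ha : a = 2 := by
    by_contra hne
    have := Nat.mul_le_mul_right x (show 3 ≤ a by omega)
    omega
  subst ha
  have hb : b < 4 := by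
    by_contra hlt
    have := Nat.mul_le_mul_right y (show 4 ≤ b by omega)
    omega
  have hb' : b = 2 ∨ b = 3 := by omega
  rcases hb' with rfl | rfl
  · have : w = 2 := by omega
    subst this
    exact Or.inl ⟨rfl, rfl, by omega⟩
  · refine Or.inr ⟨rfl, rfl, ?_⟩
    have hc : c < 6 := by
      by_contra hlt
      have := Nat.mul_le_mul_right w (show 6 ≤ c by omega)
      omega
    interval_cases c <;> omega

variable {G : Subgroup U2} [Finite G]

lemma exists_tripleType (hna : ∃ g ∈ G, ∃ h ∈ G, g * h ≠ h * g) :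
    ∃ E r m N, PoleTriple G E r m ∧ TripleType N r ∧ Nat.card G = Nat.card (scal G) * N := by
  obtain ⟨E, r, m, h⟩ := exists_poleTriple G hna
  let σ := Tuple.sort r
  have hmono : Monotone (r ∘ σ) := Tuple.monotone_sort r
  have h' := h.perm σ
  have hz : 0 < Nat.card (scal G) := Nat.card_pos
  have hn : 0 < Nat.card G := Nat.card_pos
  have hN : ∀ i, (r ∘ σ) i * (m ∘ σ) i = (r ∘ σ) 0 * (m ∘ σ) 0 := fun i =>
    Nat.eq_of_mul_eq_mul_left hz (by rw [h'.card_eq, h'.card_eq])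
  refine ⟨_, _, _, (r ∘ σ) 0 * (m ∘ σ) 0, h', ?_, (h'.card_eq 0).symm⟩
  refine tripleType_of_sum ?_ (h'.two_le 0) (hmono (by decide)) (hmono (by decide)) hN h'.sum_m
  have := h'.card_eq 0
  exact Nat.pos_of_ne_zero fun h0 => by rw [h0, mul_zero] at this; omega

lemma even_scal_of_even (hfree : actsFreely (G : Set U2)) (h2 : 2 ∣ Nat.card G) :
    2 ∣ Nat.card (scal G) := by
  obtain ⟨g, hg⟩ := exists_prime_orderOf_dvd_card' (G := G) 2 h2
  have h1 : g ≠ 1 := by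
    rintro rfl
    simp at hg
  have hsq : ((g : U2) : M2) * (g : U2) = 1 := by
    have := pow_orderOf_eq_one g
    rw [hg, pow_two] at this
    have h3 := congrArg (fun x : G => ((x : U2) : M2)) this
    simpa using h3
  have hdet : (((g : U2) : M2) - 1).det ≠ 0 := fun h => h1 (Subtype.ext (hfree g g.2 h))
  have hu : IsUnit (((g : U2) : M2) - 1) := (Matrix.isUnit_iff_isUnit_det _).2 (Ne.isUnit hdet)
  have hmul : (((g : U2) : M2) - 1) * ((g : U2) + 1) = 0 := by
    rw [sub_mul, mul_add, hsq, mul_one, one_mul]; abel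
  have hneg := (hu.mul_right_eq_zero).1 hmul
  have hs : ((g : U2) : M2) = (-1 : ℂ) • 1 := by
    rw [neg_one_smul]; exact eq_neg_of_add_eq_zero_left hneg
  have := scal_pow_card g.2 hs
  rw [neg_one_pow_eq_one_iff_even (by norm_num)] at this
  exact this.two_dvd

lemma two_dvd_of_tripleType {N : ℕ} {r : Fin 3 → ℕ} (h : TripleType N r) : 2 ∣ N := by
  unfold TripleType at h
  omega

omit [Finite G] in
lemma card_tor_of_conj {E F : M2} {h : U2} (hh : h ∈ G) (e : (h : M2) * E = F * h) :
    Nat.card (tor G F) = Nat.card (tor G E) := by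
  rw [← cj_eq_iff.2 e, card_tor_cj hh]

lemma exists_nonscal_tor {E : M2} {r : ℕ} (hr : Nat.card (tor G E) = Nat.card (scal G) * r)
    (h2 : 2 ≤ r) : ∃ g ∈ tor G E, ¬ IsScal (g : M2) := by
  by_contra hcon
  push Not at hcon
  have hle : tor G E ≤ scal G := fun g hg => ⟨hg.1, hcon g hg⟩
  have := Nat.le_of_dvd Nat.card_pos (Subgroup.card_dvd_of_le hle)
  have hz : 0 < Nat.card (scal G) := Nat.card_pos
  rw [hr] at this
  nlinarith

lemma PoleTriple.exists_swap {E : Fin 3 → M2} {r m : Fin 3 → ℕ} (h : PoleTriple G E r m) (i : Fin 3)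
    (hi : ∀ j, r j = r i → j = i) : ∃ w ∈ G, (w : M2) * E i = (1 - E i) * w := by
  obtain ⟨g, hg, hs⟩ := exists_nonscal_tor (h.card_tor i) (h.two_le i)
  have hg' : g ∈ tor G (1 - E i) := by rwa [tor_compl]
  obtain ⟨j, k, hk, e⟩ := h.cover _ (h.pole i).compl g hg.1 hs hg'.2
  have hc := card_tor_of_conj hk e
  rw [tor_compl, h.card_tor, h.card_tor] at hc
  have := hi j (Nat.eq_of_mul_eq_mul_left Nat.card_pos hc).symm
  subst this
  exact ⟨k, hk, e⟩

lemma exists_swap_of_index_two {E : M2} (hE : IsPole E) (hc : Nat.card G = 2 * Nat.card (tor G E))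
    {g : U2} (hg : g ∈ tor G E) (hs : ¬ IsScal (g : M2)) :
    ∃ w ∈ G, (w : M2) * E = (1 - E) * w := by
  have hidx : ((tor G E).subgroupOf G).index = 2 := by
    have h1 := Subgroup.card_mul_index ((tor G E).subgroupOf G)
    rw [Nat.card_congr (Subgroup.subgroupOfEquivOfLe (tor_le G E)).toEquiv, hc] at h1
    have : 0 < Nat.card (tor G E) := Nat.card_pos
    nlinarith
  have hnorm := Subgroup.normal_of_index_eq_two hidx
  have hex : ∃ w ∈ G, w ∉ tor G E := by
    by_contra hcon
    push Not at hcon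
    have : G ≤ tor G E := hcon
    have h2 := Nat.le_of_dvd Nat.card_pos (Subgroup.card_dvd_of_le this)
    have : 0 < Nat.card (tor G E) := Nat.card_pos
    omega
  obtain ⟨w, hw, hwt⟩ := hex
  have hconj : w⁻¹ * g * w ∈ tor G E := by
    have := hnorm.conj_mem ⟨g, hg.1⟩ (Subgroup.mem_subgroupOf.2 hg) ⟨w⁻¹, inv_mem hw⟩
    rw [Subgroup.mem_subgroupOf] at this
    simpa using this
  have hcj : (g : M2) * cj w E = cj w E * g := by
    have := (cj_comm_iff w (w⁻¹ * g * w) E).2 hconj.2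
    have e : w * (w⁻¹ * g * w) * w⁻¹ = g := by group
    rwa [e] at this
  refine ⟨w, hw, ?_⟩
  rcases hE.eq_or_eq_compl (hE.cj w) hg.2 hcj hs with h | h
  · exact absurd ⟨hw, cj_eq_iff.1 h⟩ hwt
  · exact cj_eq_iff.1 h

lemma swap_trace {w E : M2} (hE : IsPole E) (hw : w * E = (1 - E) * w) : w.trace = 0 := by
  have h1 : (w * E).trace = 0 := by
    calc (w * E).trace = ((1 - E) * w * E).trace := by rw [← hw, mul_assoc, hE.idem]
      _ = 0 := by
        rw [mul_assoc, Matrix.trace_mul_comm, mul_assoc, mul_sub, hE.idem]; simp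
  have h2 : (w * (1 - E)).trace = 0 := by
    have hw' : w * (1 - E) = E * w := by rw [mul_sub, hw, sub_mul]; simp
    calc (w * (1 - E)).trace = (E * w * (1 - E)).trace := by
          rw [← hw', mul_assoc, hE.compl.idem]
      _ = 0 := by
        rw [mul_assoc, Matrix.trace_mul_comm, mul_assoc, sub_mul, hE.idem]; simp
  rw [← IsPole.trace_mul_add (E := E), h1, h2, add_zero]

/-- A trace zero element of a free group has nonsquare negative determinant among the scalars. -/
lemma neg_det_pow (hfree : actsFreely (G : Set U2)) {y : ℕ} (hy : Nat.card (scal G) = 2 * y)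
    {w : U2} (hw : w ∈ G) (htr : (w : M2).trace = 0) : (-(w : M2).det) ^ y = -1 := by
  have hsq : ((w * w : U2) : M2) = (-(w : M2).det) • 1 := by
    rw [UnitaryGroup.mul_val, M2_cayley, htr]; simp
  have h1 := scal_pow_card (mul_mem hw hw) hsq
  rw [hy, mul_comm, pow_mul] at h1
  have h2 : ((-(w : M2).det) ^ y - 1) * ((-(w : M2).det) ^ y + 1) = 0 := by
    linear_combination h1
  rcases mul_eq_zero.1 h2 with h | h
  · exfalso
    obtain ⟨c, hc⟩ := IsAlgClosed.exists_pow_nat_eq (-(w : M2).det) (n := 2) (by norm_num)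
    have hcz : c⁻¹ ^ Nat.card (scal G) = 1 := by
      rw [_root_.inv_pow, hy, pow_mul, hc, sub_eq_zero.1 h, inv_one]
    have hc0 : c ≠ 0 := by
      rintro rfl
      rw [hy] at hcz
      have hy0 : y ≠ 0 := by
        rintro rfl
        have : 0 < Nat.card (scal G) := Nat.card_pos
        omega
      simp [hy0] at hcz
    obtain ⟨g, hg, hgc⟩ := exists_scal hcz
    have hval : ((g * w : U2) : M2) = c⁻¹ • (w : M2) := by
      rw [UnitaryGroup.mul_val, hgc]; simp
    have hdet : (((g * w : U2) : M2) - 1).det = 0 := by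
      rw [Matrix.trace_fin_two] at htr
      rw [Matrix.det_fin_two] at hc
      rw [hval, Matrix.det_fin_two]
      simp only [Matrix.sub_apply, Matrix.smul_apply, smul_eq_mul, Matrix.one_apply]
      norm_num
      field_simp
      linear_combination hc - c * htr
    have h1 := hfree _ (mul_mem hg hw) hdet
    rw [h1] at hval
    have h2 := congrArg Matrix.trace hval
    rw [Matrix.trace_smul, htr] at h2
    simp at h2
  · exact eq_neg_of_add_eq_zero_left h

lemma det_pow_of_swap (hfree : actsFreely (G : Set U2)) {y : ℕ}
    (hy : Nat.card (scal G) = 2 * y) {E : M2} (hE : IsPole E) {w : U2} (hw : w ∈ G)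
    (hwE : (w : M2) * E = (1 - E) * w) {g : U2} (hg : g ∈ tor G E) : (g : M2).det ^ y = 1 := by
  have h1 := neg_det_pow hfree hy hw (swap_trace hE hwE)
  have h2 : ((w * g : U2) : M2) * E = (1 - E) * ((w * g : U2) : M2) := by
    rw [UnitaryGroup.mul_val, mul_assoc, hg.2, ← mul_assoc, hwE, mul_assoc]
  have h3 := neg_det_pow hfree hy (mul_mem hw hg.1) (swap_trace hE h2)
  rw [UnitaryGroup.mul_val, Matrix.det_mul, ← neg_mul, mul_pow, h1] at h3
  linear_combination -h3

lemma dvd_of_swap (hfree : actsFreely (G : Set U2)) {y : ℕ}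
    (hy : Nat.card (scal G) = 2 * y) {E : M2} (hE : IsPole E) {w : U2} (hw : w ∈ G)
    (hwE : (w : M2) * E = (1 - E) * w) {r : ℕ} {σ : ℤ}
    (hr : Nat.card (tor G E) = Nat.card (scal G) * r)
    (hσ : ∀ g : tor G E, torHom' G hE g = torHom G hE g ^ (1 + (Nat.card (scal G) : ℤ) * σ)) :
    (r : ℤ) ∣ 1 + y * σ := by
  have hpos : 0 < Nat.card (tor G E) := Nat.card_pos
  have hp := Complex.isPrimitiveRoot_exp _ hpos.ne'
  obtain ⟨g, hg⟩ := exists_torHom_isPrimitiveRoot hfree hE dvd_rfl hp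
  have h1 := det_pow_of_swap hfree hy hE hw hwE g.2
  rw [hE.det_eq_mul g.2.2, ← torHom_apply G hE, ← torHom'_apply hE, hσ] at h1
  have h0 := torHom_ne_zero hE g
  have h2 : torHom G hE g ^ ((2 + (Nat.card (scal G) : ℤ) * σ) * y) = 1 := by
    rw [_root_.zpow_mul, zpow_natCast, ← h1]
    congr 1
    nth_rewrite 2 [← zpow_one (torHom G hE g)]
    rw [← zpow_add₀ h0]
    congr 1
    ring
  rw [hg, hp.zpow_eq_one_iff_dvd, hr, hy] at h2
  obtain ⟨c, hc⟩ := h2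
  have hy0 : (y : ℤ) ≠ 0 := by
    have : 0 < Nat.card (scal G) := Nat.card_pos
    omega
  refine ⟨c, ?_⟩
  apply mul_left_cancel₀ (mul_ne_zero two_ne_zero hy0)
  push_cast at hc
  linear_combination hc

end Classify

section Counts

/-- The number of `k < L` with `r ∣ t + σ (k - p)`. -/
def cn (r : ℕ) (σ t : ℤ) (p L : ℕ) : ℕ :=
  ((Finset.range L).filter fun k : ℕ => (r : ℤ) ∣ t + σ * ((k : ℤ) - p)).card

lemma cnt_eq_cn {z r : ℕ} (hz : 0 < z) {σ t : ℤ} {p q : ℕ} (ht : (q : ℤ) - p = z * t) :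
    cnt z r σ p q = cn r σ t p (p + q + 1) := by
  rw [cnt, cn]
  congr 1
  refine Finset.filter_congr fun k _ => ?_
  have hz' : (z : ℤ) ≠ 0 := by exact_mod_cast hz.ne'
  rw [ht, mul_assoc, ← mul_add]
  push_cast
  exact mul_dvd_mul_iff_left hz'

lemma cnt_eq_zero {z r : ℕ} {σ : ℤ} {p q : ℕ} (h : ¬ (z : ℤ) ∣ (q : ℤ) - p) :
    cnt z r σ p q = 0 := by
  rw [cnt, Finset.card_eq_zero, Finset.filter_eq_empty_iff]
  intro k _ hk
  apply h
  have h1 : (z : ℤ) ∣ ((z * r : ℕ) : ℤ) := by push_cast; exact dvd_mul_right _ _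
  have h2 := h1.trans hk
  rwa [mul_assoc, dvd_add_left (dvd_mul_right _ _)] at h2

lemma not_dvd_of_isCoprime {a b : ℤ} (h : IsCoprime a b) {d : ℕ} (hd : 2 ≤ d) (hb : (d : ℤ) ∣ b) :
    ¬ (d : ℤ) ∣ a := fun ha => by
  have := Int.isUnit_iff.1 (h.isUnit_of_dvd' ha hb)
  omega

lemma cn_le_one {r : ℕ} {σ : ℤ} (hc : IsCoprime σ (r : ℤ)) (t : ℤ) (p : ℕ) {L : ℕ} (hL : L ≤ r) :
    cn r σ t p L ≤ 1 := by
  rw [cn, Finset.card_le_one]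
  intro a ha b hb
  rw [Finset.mem_filter, Finset.mem_range] at ha hb
  have h1 : (r : ℤ) ∣ σ * ((a : ℤ) - b) := by
    have := dvd_sub ha.2 hb.2
    have e : t + σ * ((a : ℤ) - p) - (t + σ * ((b : ℤ) - p)) = σ * ((a : ℤ) - b) := by ring
    rwa [e] at this
  have h2 := (hc.symm).dvd_of_dvd_mul_left h1
  by_contra hne
  have h3 := Int.le_of_dvd (abs_pos.2 (show (a : ℤ) - b ≠ 0 by omega)) ((dvd_abs _ _).2 h2)
  rw [le_abs] at h3
  omega

lemma cn_pos {r : ℕ} (σ : ℤ) {p L : ℕ} (h : p < L) : 1 ≤ cn r σ 0 p L := by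
  rw [cn]
  refine Finset.card_pos.2 ⟨p, ?_⟩
  simp [h]

lemma cn_two_a {σ : ℤ} (h : ¬ (2 : ℤ) ∣ σ) : cn 2 σ 0 1 3 = 1 ∧ cn 2 σ 1 0 3 = 1 ∧
    cn 2 σ 0 2 5 = 3 ∧ cn 2 σ (-1) 3 5 = 3 ∧ cn 2 σ 2 0 5 = 3 ∧ cn 2 σ 1 0 5 = 2 ∧
    cn 2 σ (-2) 5 7 = 3 ∧ cn 2 σ 3 0 7 = 3 ∧ cn 2 σ 1 1 5 = 3 ∧ cn 2 σ (-1) 5 7 = 4 := by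
  simp only [cn, Finset.card_filter, Finset.sum_range_succ, Finset.sum_range_zero]
  refine ⟨?_, ?_, ?_, ?_, ?_, ?_, ?_, ?_, ?_, ?_⟩ <;> push_cast <;> split_ifs <;> omega

lemma cn_three {σ : ℤ} (h : ¬ (3 : ℤ) ∣ σ) : cn 3 σ 0 2 5 = 1 ∧ cn 3 σ 1 0 5 ≤ 2 ∧
    cn 3 σ (-2) 5 7 ≤ 3 ∧ cn 3 σ 3 0 7 ≤ 3 ∧ 2 ≤ cn 3 σ (-1) 5 7 := by
  obtain ⟨s, hs⟩ : ∃ s, σ = 3 * s + 1 ∨ σ = 3 * s + 2 := ⟨σ / 3, by omega⟩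
  simp only [cn, Finset.card_filter, Finset.sum_range_succ, Finset.sum_range_zero]
  rcases hs with rfl | rfl
  all_goals refine ⟨?_, ?_, ?_, ?_, ?_⟩ <;> push_cast <;> split_ifs <;> omega

lemma cn_three' {σ : ℤ} (h : σ % 3 = 2) : cn 3 σ (-1) 3 5 = 1 ∧ cn 3 σ 2 0 5 = 1 ∧
    cn 3 σ 1 1 5 = 1 := by
  simp only [cn, Finset.card_filter, Finset.sum_range_succ, Finset.sum_range_zero]
  refine ⟨?_, ?_, ?_⟩ <;> push_cast <;> split_ifs <;> omega

lemma cn_four {σ : ℤ} (h : ¬ (2 : ℤ) ∣ σ) : cn 4 σ 0 2 5 = 1 ∧ cn 4 σ (-1) 3 5 ≤ 2 ∧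
    cn 4 σ 2 0 5 ≤ 2 := by
  simp only [cn, Finset.card_filter, Finset.sum_range_succ, Finset.sum_range_zero]
  refine ⟨?_, ?_, ?_⟩ <;> push_cast <;> split_ifs <;> omega

lemma cn_five (σ : ℤ) : cn 5 σ (-2) 5 7 ≤ 2 ∧ cn 5 σ 3 0 7 ≤ 2 := by
  simp only [cn, Finset.card_filter, Finset.sum_range_succ, Finset.sum_range_zero]
  refine ⟨?_, ?_⟩ <;> push_cast <;> split_ifs <;> omega

end Counts

section Distinguish

/-- Numerical data of a nonabelian group acting freely. -/
structure NAData (G : Subgroup U2) (y N : ℕ) (r : Fin 3 → ℕ) (σ : Fin 3 → ℤ) : Prop where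
  scal_eq : Nat.card (scal G) = 2 * y
  pos : 0 < y
  param : TripleParam G r σ
  type : TripleType N r
  card_eq : Nat.card G = Nat.card (scal G) * N
  two_le : ∀ i, 2 ≤ r i
  dih : r 1 = 2 → (r 2 : ℤ) ∣ 1 + y * σ 2
  poly : r 1 = 3 → (2 : ℤ) ∣ 1 + y * σ 0

namespace NAData

variable {G : Subgroup U2} {y N : ℕ} {r : Fin 3 → ℕ} {σ : Fin 3 → ℤ} (h : NAData G y N r σ)
include h

lemma dim_eq {p q : ℕ} (t : ℤ) (ht : (q : ℤ) - p = (2 * y : ℕ) * t) :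
    (2 * dimHpqInv 2 p q (G : Set U2) : ℤ) = cn (r 0) (σ 0) t p (p + q + 1) +
      cn (r 1) (σ 1) t p (p + q + 1) + cn (r 2) (σ 2) t p (p + q + 1) - (p + q + 1) := by
  have hz : 0 < 2 * y := by have := h.pos; omega
  rw [h.param.dim, Fin.sum_univ_three, h.scal_eq, if_pos ⟨t, ht⟩, cnt_eq_cn hz ht, cnt_eq_cn hz ht,
    cnt_eq_cn hz ht]

lemma dim_zero {p q : ℕ} (hz : ¬ ((2 * y : ℕ) : ℤ) ∣ (q : ℤ) - p) :
    dimHpqInv 2 p q (G : Set U2) = 0 := by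
  have := h.param.dim p q
  rw [Fin.sum_univ_three, h.scal_eq, if_neg hz, cnt_eq_zero hz, cnt_eq_zero hz,
    cnt_eq_zero hz] at this
  push_cast at this
  omega

lemma odd_of_two {i : Fin 3} (hi : r i = 2) : ¬ (2 : ℤ) ∣ σ i :=
  not_dvd_of_isCoprime (h.param.coprime i) (d := 2) le_rfl (by simp [hi])

lemma three_of {i : Fin 3} (hi : r i = 3) : ¬ (3 : ℤ) ∣ σ i :=
  not_dvd_of_isCoprime (h.param.coprime i) (d := 3) (by norm_num) (by simp [hi])

lemma three_of' {i : Fin 3} (hi : r i = 3) : ¬ (3 : ℤ) ∣ 1 + (2 * y : ℕ) * σ i := by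
  have := h.param.coprime' i
  rw [h.scal_eq] at this
  exact not_dvd_of_isCoprime this (d := 3) (by norm_num) (by rw [hi]; exact dvd_mul_left _ _)

lemma r_zero : r 0 = 2 := by
  rcases h.type with h | h <;> exact h.1

lemma r_one : r 1 = 2 ∨ r 1 = 3 := by
  rcases h.type with h | h
  · exact Or.inl h.2.1
  · exact Or.inr h.2.1

lemma cSpec_two : cSpec G 2 = 0 := by
  rw [cSpec, divisorsAntidiagonal_two, Finset.sum_pair (by decide)]
  have key : ∀ t : ℤ, ∀ p, (t = 0 ∧ p = 1) ∨ (t = 1 ∧ p = 0) → ∀ i, cn (r i) (σ i) t p 3 ≤ 1 := by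
    intro t p hp i
    have := h.two_le i
    rcases Nat.lt_or_ge (r i) 3 with h3 | h3
    · have h2 : r i = 2 := by omega
      have := cn_two_a (h.odd_of_two h2)
      rw [h2]
      rcases hp with ⟨rfl, rfl⟩ | ⟨rfl, rfl⟩ <;> omega
    · exact cn_le_one (h.param.coprime i) t p h3
  have e1 := h.dim_eq (p := 1) (q := 1) 0 (by norm_num)
  have k1 := key 0 1 (Or.inl ⟨rfl, rfl⟩)
  have k1a := k1 0
  have k1b := k1 1
  have k1c := k1 2
  have e2 : dimHpqInv 2 0 2 (G : Set U2) = 0 := by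
    by_cases hy : y = 1
    · have e2 := h.dim_eq (p := 0) (q := 2) 1 (by rw [hy]; norm_num)
      have k1 := key 1 0 (Or.inr ⟨rfl, rfl⟩)
      have k1a := k1 0
      have k1b := k1 1
      have k1c := k1 2
      norm_num at e2
      omega
    · apply h.dim_zero
      have := h.pos
      rintro hd
      have := Int.le_of_dvd (by norm_num) hd
      push_cast at this
      omega
  norm_num at e1 ⊢
  omega

lemma dim_two_two : (r 1 = 2 → 1 ≤ dimHpqInv 2 2 2 (G : Set U2)) ∧
    (r 1 = 3 → dimHpqInv 2 2 2 (G : Set U2) = 0) := by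
  have e1 := h.dim_eq (p := 2) (q := 2) 0 (by norm_num)
  have h0 := h.r_zero
  have a0 := cn_two_a (h.odd_of_two h0)
  rw [h0] at e1
  norm_num at e1
  constructor
  · intro h1
    have a1 := cn_two_a (h.odd_of_two h1)
    have a2 := cn_pos (r := r 2) (σ 2) (p := 2) (L := 5) (by norm_num)
    rw [h1] at e1
    omega
  · intro h1
    have a1 := cn_three (h.three_of h1)
    rw [h1] at e1
    have a2 : cn (r 2) (σ 2) 0 2 5 = 1 := by
      rcases h.type with ht | ⟨-, -, ⟨h2, -⟩ | ⟨h2, -⟩ | ⟨h2, -⟩⟩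
      · omega
      · rw [h2]; exact (cn_three (h.three_of h2)).1
      · have : ¬ (2 : ℤ) ∣ σ 2 :=
          not_dvd_of_isCoprime (h.param.coprime 2) (d := 2) le_rfl (by rw [h2]; norm_num)
        rw [h2]; exact (cn_four this).1
      · have b1 := cn_pos (r := r 2) (σ 2) (p := 2) (L := 5) (by norm_num)
        have b2 := cn_le_one (h.param.coprime 2) 0 2 (L := 5) (by omega)
        omega
    omega

lemma mod_three {i : Fin 3} (hy : y = 1) (hi : r i = 3) : σ i % 3 = 2 := by
  have h1 := h.three_of hi
  have h2 := h.three_of' hi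
  rw [hy] at h2
  push_cast at h2
  omega

omit h in
lemma cSpec_four_eq : cSpec G 4 = dimHpqInv 2 0 4 (G : Set U2) + dimHpqInv 2 1 2 (G : Set U2) +
    dimHpqInv 2 3 1 (G : Set U2) := by
  rw [cSpec, divisorsAntidiagonal_four, Finset.sum_insert (by decide),
    Finset.sum_pair (by decide), add_assoc]
  rfl

omit h in
lemma cSpec_six_eq : cSpec G 6 = dimHpqInv 2 0 6 (G : Set U2) + dimHpqInv 2 1 3 (G : Set U2) +
    dimHpqInv 2 2 2 (G : Set U2) + dimHpqInv 2 5 1 (G : Set U2) := by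
  rw [cSpec, divisorsAntidiagonal_six, Finset.sum_insert (by decide),
    Finset.sum_insert (by decide), Finset.sum_pair (by decide)]
  simp only [add_assoc, Nat.sub_self, Nat.add_one_sub_one]

lemma cSpec_four_dih (hy : y = 1) (h1 : r 1 = 2) : 1 ≤ cSpec G 4 := by
  have e1 := h.dim_eq (p := 3) (q := 1) (-1) (by rw [hy]; norm_num)
  have h0 := h.r_zero
  have a0 := cn_two_a (h.odd_of_two h0)
  have a1 := cn_two_a (h.odd_of_two h1)
  rw [h0, h1] at e1
  norm_num at e1
  rw [cSpec_four_eq]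
  omega

lemma cSpec_four_poly (hy : y = 1) (h1 : r 1 = 3) : cSpec G 4 = 0 := by
  have h0 := h.r_zero
  have e1 := h.dim_eq (p := 3) (q := 1) (-1) (by rw [hy]; norm_num)
  have e2 := h.dim_eq (p := 0) (q := 4) 2 (by rw [hy]; norm_num)
  have e3 := h.dim_zero (p := 1) (q := 2) (by rw [hy]; norm_num)
  have a0 := cn_two_a (h.odd_of_two h0)
  have a1 := cn_three' (h.mod_three hy h1)
  rw [h0, h1] at e1 e2
  norm_num at e1 e2
  have a2 : cn (r 2) (σ 2) (-1) 3 5 ≤ 2 ∧ cn (r 2) (σ 2) 2 0 5 ≤ 2 := by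
    rcases h.type with ht | ⟨-, -, ⟨h2, -⟩ | ⟨h2, -⟩ | ⟨h2, -⟩⟩
    · omega
    · have := cn_three' (h.mod_three hy h2)
      rw [h2]; omega
    · have h3 : ¬ (2 : ℤ) ∣ σ 2 :=
        not_dvd_of_isCoprime (h.param.coprime 2) (d := 2) le_rfl (by rw [h2]; norm_num)
      have := cn_four h3
      rw [h2]; omega
    · have b1 := cn_le_one (h.param.coprime 2) (-1) 3 (L := 5) (by omega)
      have b2 := cn_le_one (h.param.coprime 2) 2 0 (L := 5) (by omega)
      omega
  rw [cSpec_four_eq]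
  omega

lemma odd_of_dih_four (hy : y = 2) (h1 : r 1 = 2) : ¬ 2 ∣ r 2 := by
  intro hd
  have h2 := h.dih h1
  have : (2 : ℤ) ∣ 1 + y * σ 2 := (Int.natCast_dvd_natCast.2 hd).trans h2
  rw [hy] at this
  push_cast at this
  omega

lemma cSpec_four_dih_four (hy : y = 2) (h1 : r 1 = 2) : cSpec G 4 = 0 := by
  have h0 := h.r_zero
  have e1 := h.dim_zero (p := 3) (q := 1) (by rw [hy]; norm_num)
  have e3 := h.dim_zero (p := 1) (q := 2) (by rw [hy]; norm_num)
  have e2 := h.dim_eq (p := 0) (q := 4) 1 (by rw [hy]; norm_num)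
  have a0 := cn_two_a (h.odd_of_two h0)
  have a1 := cn_two_a (h.odd_of_two h1)
  rw [h0, h1] at e2
  norm_num at e2
  have hodd := h.odd_of_dih_four hy h1
  have h2 := h.two_le 2
  have a2 : cn (r 2) (σ 2) 1 0 5 ≤ 2 := by
    by_cases h3 : r 2 = 3
    · have := cn_three (h.three_of h3)
      rw [h3]; omega
    · have := cn_le_one (h.param.coprime 2) 1 0 (L := 5) (by omega)
      omega
  rw [cSpec_four_eq]
  omega

lemma cSpec_six_large (hy : 4 ≤ y) : cSpec G 6 = dimHpqInv 2 2 2 (G : Set U2) := by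
  have key : ∀ a : ℤ, a ≠ 0 → |a| ≤ 6 → ¬ ((2 * y : ℕ) : ℤ) ∣ a := by
    intro a ha ha' hd
    have := Int.le_of_dvd (abs_pos.2 ha) ((dvd_abs _ _).2 hd)
    push_cast at this
    omega
  rw [cSpec_six_eq, h.dim_zero (key _ (by norm_num) (by norm_num [abs_le])),
    h.dim_zero (p := 1) (key _ (by norm_num) (by norm_num [abs_le])),
    h.dim_zero (p := 5) (key _ (by norm_num) (by norm_num [abs_le]))]
  omega

lemma cSpec_six_ico (hy : y = 1) (h1 : r 1 = 3) (h2 : r 2 = 5) : cSpec G 6 = 0 := by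
  have h0 := h.r_zero
  have e1 := h.dim_eq (p := 0) (q := 6) 3 (by rw [hy]; norm_num)
  have e2 := h.dim_eq (p := 1) (q := 3) 1 (by rw [hy]; norm_num)
  have e3 := h.dim_two_two.2 h1
  have e4 := h.dim_eq (p := 5) (q := 1) (-2) (by rw [hy]; norm_num)
  have a0 := cn_two_a (h.odd_of_two h0)
  have a1 := cn_three (h.three_of h1)
  have a1' := cn_three' (h.mod_three hy h1)
  have a2 := cn_five (σ 2)
  have a2' := cn_le_one (h.param.coprime 2) 1 1 (L := 5) (by omega)
  rw [h2] at a2'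
  rw [h0, h1, h2] at e1 e2 e4
  norm_num at e1 e2 e4
  rw [cSpec_six_eq]
  omega

lemma cSpec_six_tet (hy : y = 1) (h1 : r 1 = 3) (h2 : r 2 = 3) : cSpec G 6 ≤ 2 := by
  have h0 := h.r_zero
  have e1 := h.dim_eq (p := 0) (q := 6) 3 (by rw [hy]; norm_num)
  have e2 := h.dim_eq (p := 1) (q := 3) 1 (by rw [hy]; norm_num)
  have e3 := h.dim_two_two.2 h1
  have e4 := h.dim_eq (p := 5) (q := 1) (-2) (by rw [hy]; norm_num)
  have a0 := cn_two_a (h.odd_of_two h0)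
  have a1 := cn_three (h.three_of h1)
  have a1' := cn_three' (h.mod_three hy h1)
  have a2 := cn_three (h.three_of h2)
  have a2' := cn_three' (h.mod_three hy h2)
  rw [h0, h1, h2] at e1 e2 e4
  norm_num at e1 e2 e4
  rw [cSpec_six_eq]
  omega

lemma cSpec_six_dih (h1 : r 1 = 2) : 1 ≤ cSpec G 6 := by
  have := h.dim_two_two.1 h1
  rw [cSpec_six_eq]
  omega

lemma cSpec_six_dih_three (hy : y = 2) (h1 : r 1 = 2) (h2 : r 2 = 3) : 3 ≤ cSpec G 6 := by
  have h0 := h.r_zero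
  have e1 := h.dim_two_two.1 h1
  have e4 := h.dim_eq (p := 5) (q := 1) (-1) (by rw [hy]; norm_num)
  have a0 := cn_two_a (h.odd_of_two h0)
  have a1 := cn_two_a (h.odd_of_two h1)
  have a2 := cn_three (h.three_of h2)
  rw [h0, h1, h2] at e4
  norm_num at e4
  rw [cSpec_six_eq]
  omega

lemma coprime_of_dih (h1 : r 1 = 2) {d : ℕ} (hd : 2 ≤ d) (hr : d ∣ r 2) : ¬ d ∣ y := by
  intro hy
  have h2 : (d : ℤ) ∣ 1 + y * σ 2 := (Int.natCast_dvd_natCast.2 hr).trans (h.dih h1)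
  have h3 : (d : ℤ) ∣ y * σ 2 := dvd_mul_of_dvd_left (Int.natCast_dvd_natCast.2 hy) _
  have h4 := Int.le_of_dvd one_pos ((dvd_add_left h3).1 h2)
  omega

lemma not_dih_poly {G' : Subgroup U2} {N' : ℕ} {r' : Fin 3 → ℕ} {σ' : Fin 3 → ℤ}
    (h' : NAData G' y N' r' σ') (hN : N = N') (hc : ∀ m, 0 < m → cSpec G m = cSpec G' m)
    (h1 : r 1 = 2) (h1' : r' 1 = 3) : False := by
  have c4 := hc 4 (by norm_num)
  have c6 := hc 6 (by norm_num)
  by_cases hy : y = 1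
  · have := h.cSpec_four_dih hy h1
    have := h'.cSpec_four_poly hy h1'
    omega
  · have hr : r 2 = 6 ∨ r 2 = 12 ∨ r 2 = 30 := by
      have t := h.type
      have t' := h'.type
      unfold TripleType at t t'
      omega
    have y2 := h.coprime_of_dih h1 (d := 2) le_rfl (by omega)
    have y3 := h.coprime_of_dih h1 (d := 3) (by norm_num) (by omega)
    have := h.pos
    have e1 := h.cSpec_six_large (by omega)
    have e2 := h'.cSpec_six_large (by omega)
    have := h.dim_two_two.1 h1
    have := h'.dim_two_two.2 h1'
    omega

lemma not_two_four {G' : Subgroup U2} {y' N' : ℕ} {r' : Fin 3 → ℕ} {σ' : Fin 3 → ℤ}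
    (h' : NAData G' y' N' r' σ') (hy : y = 1) (hy' : y' = 2) (hN : N = 2 * N')
    (hc : ∀ m, 0 < m → cSpec G m = cSpec G' m) : False := by
  have c4 := hc 4 (by norm_num)
  have c6 := hc 6 (by norm_num)
  have h1' : r' 1 = 2 := by
    rcases h'.r_one with h1' | h1'
    · exact h1'
    · have := h'.poly h1'
      rw [hy'] at this
      push_cast at this
      omega
  have e4 := h'.cSpec_four_dih_four hy' h1'
  have h1 : r 1 = 3 := by
    rcases h.r_one with h1 | h1
    · have := h.cSpec_four_dih hy h1
      omega
    · exact h1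
  have hodd := h'.odd_of_dih_four hy' h1'
  have t := h.type
  have t' := h'.type
  have hr : (r 2 = 3 ∧ r' 2 = 3) ∨ r 2 = 5 := by
    unfold TripleType at t t'
    omega
  rcases hr with ⟨h2, h2'⟩ | h2
  · have := h.cSpec_six_tet hy h1 h2
    have := h'.cSpec_six_dih_three hy' h1' h2'
    omega
  · have := h.cSpec_six_ico hy h1 h2
    have := h'.cSpec_six_dih h1'
    omega

end NAData

/-- Isospectral nonabelian groups have the same numerical type. -/
theorem same_type {G G' : Subgroup U2} [Finite G] [Finite G'] {y y' N N' : ℕ} {r r' : Fin 3 → ℕ}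
    {σ σ' : Fin 3 → ℤ} (h : NAData G y N r σ) (h' : NAData G' y' N' r' σ')
    (hc : ∀ m, 0 < m → cSpec G m = cSpec G' m) : y = y' ∧ r 1 = r' 1 ∧ r 2 = r' 2 := by
  obtain ⟨hn, hz⟩ := card_of_isospectral G G' hc
  have e := h.scal_eq
  have e' := h'.scal_eq
  have n1 := h.card_eq
  have n2 := h'.card_eq
  rw [e] at n1
  rw [e'] at n2
  rcases hz with hz | ⟨hz, hz'⟩ | ⟨hz, hz'⟩
  · have hy : y = y' := by omega
    subst hy
    have hN : N = N' := by
      have := h.pos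
      exact Nat.eq_of_mul_eq_mul_left (show 0 < 2 * y by omega) (by omega)
    refine ⟨rfl, ?_⟩
    have t := h.type
    have t' := h'.type
    have hr : r 1 = r' 1 := by
      rcases h.r_one with h1 | h1 <;> rcases h'.r_one with h1' | h1'
      · omega
      · exact (h.not_dih_poly h' hN hc h1 h1').elim
      · exact (h'.not_dih_poly h hN.symm (fun m hm => (hc m hm).symm) h1' h1).elim
      · omega
    unfold TripleType at t t'
    omega
  · have hy : y = 1 := by omega
    have hy' : y' = 2 := by omega
    subst hy hy'
    exact (h.not_two_four h' rfl rfl (by omega) hc).elim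
  · have hy : y = 2 := by omega
    have hy' : y' = 1 := by omega
    subst hy hy'
    exact (h'.not_two_four h rfl rfl (by omega) fun m hm => (hc m hm).symm).elim

end Distinguish

section Dichotomy

variable {G : Subgroup U2} [Finite G]

omit [Finite G] in
lemma exists_tor_eq_of_comm (hab : ∀ g ∈ G, ∀ h ∈ G, g * h = h * g) :
    ∃ E, IsPole E ∧ tor G E = G := by
  by_cases hs : ∃ g ∈ G, ¬ IsScal (g : M2)
  · obtain ⟨g, hg, hs⟩ := hs
    obtain ⟨E, hE, hgE⟩ := exists_pole g
    refine ⟨E, hE, le_antisymm (tor_le G E) fun h hh => ⟨hh, ?_⟩⟩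
    exact hE.comm_of_nonscal hgE hs (congrArg Subtype.val (hab g hg h hh))
  · push Not at hs
    obtain ⟨E, hE, -⟩ := exists_pole 1
    exact ⟨E, hE, le_antisymm (tor_le G E) fun h hh => scal_le_tor G E ⟨hh, hs h hh⟩⟩

lemma isCyclic_of_comm (hfree : actsFreely (G : Set U2))
    (hab : ∀ g ∈ G, ∀ h ∈ G, g * h = h * g) : IsCyclic G := by
  obtain ⟨E, hE, h⟩ := exists_tor_eq_of_comm hab
  have := isCyclic_of_injective_ringHom _ (torHom_injective hfree hE)
  rwa [h] at this

lemma cSpec_two_pos (hfree : actsFreely (G : Set U2))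
    (hab : ∀ g ∈ G, ∀ h ∈ G, g * h = h * g) : 0 < cSpec G 2 := by
  obtain ⟨E, hE, h⟩ := exists_tor_eq_of_comm hab
  obtain ⟨r, hr⟩ := card_scal_dvd G
  have hr' : Nat.card (tor G E) = Nat.card (scal G) * r := by rw [h, hr]
  obtain ⟨σ, -, -, hσ⟩ := exists_torus_param hfree hE hr'
  have h1 := sum_tor_tr hfree hE hr' hσ 1 1
  have h2 := card_mul_dim G 1 1
  have e : elems (tor G E) = elems G := by ext; simp [h]
  rw [e, ← h2, ← hr] at h1
  have h3 : dimHpqInv 2 1 1 (G : Set U2) = cnt (Nat.card (scal G)) r σ 1 1 := by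
    have hn : (Nat.card G : ℂ) ≠ 0 := by exact_mod_cast (Nat.card_pos (α := G)).ne'
    exact_mod_cast mul_left_cancel₀ hn h1
  have h4 : 0 < cnt (Nat.card (scal G)) r σ 1 1 :=
    Finset.card_pos.2 ⟨1, by simp⟩
  have h5 : cSpec G 2 = dimHpqInv 2 0 2 (G : Set U2) + dimHpqInv 2 1 1 (G : Set U2) := by
    rw [cSpec, divisorsAntidiagonal_two, Finset.sum_pair (by decide)]
    rfl
  omega

lemma exists_naData (hfree : actsFreely (G : Set U2)) (hna : ∃ g ∈ G, ∃ h ∈ G, g * h ≠ h * g) :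
    ∃ (y N : ℕ) (E : Fin 3 → M2) (r m : Fin 3 → ℕ) (σ : Fin 3 → ℤ) (T : PoleTriple G E r m),
      NAData G y N r σ ∧ ∀ i (g : tor G (E i)),
        torHom' G (T.pole i) g = torHom G (T.pole i) g ^ (1 + (Nat.card (scal G) : ℤ) * σ i) := by
  obtain ⟨E, r, m, N, T, hN, hcard⟩ := exists_tripleType hna
  obtain ⟨σ, hparam, hσ⟩ := T.exists_param hfree
  obtain ⟨y, hy⟩ := even_scal_of_even hfree (hcard ▸ (two_dvd_of_tripleType hN).mul_left _)
  have hz : 0 < Nat.card (scal G) := Nat.card_pos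
  refine ⟨y, N, E, r, m, σ, T, ⟨hy, by omega, hparam, hN, hcard, T.two_le, fun h1 => ?_,
    fun h1 => ?_⟩, hσ⟩
  · have hN2 : N = 2 * r 2 := by unfold TripleType at hN; omega
    obtain ⟨g, hg, hs⟩ := exists_nonscal_tor (T.card_tor 2) (T.two_le 2)
    obtain ⟨w, hw, hwE⟩ := exists_swap_of_index_two (T.pole 2)
      (by rw [hcard, T.card_tor, hN2]; ring) hg hs
    exact dvd_of_swap hfree hy (T.pole 2) hw hwE (T.card_tor 2) (hσ 2)
  · have h0 : r 0 = 2 ∧ r 2 ≠ 2 := by unfold TripleType at hN; omega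
    obtain ⟨w, hw, hwE⟩ := T.exists_swap 0 (fun j hj => by
      fin_cases j
      · rfl
      · simp at hj; omega
      · simp at hj; omega)
    have := dvd_of_swap hfree hy (T.pole 0) hw hwE (T.card_tor 0) (hσ 0)
    rwa [h0.1] at this

end Dichotomy

section Conjugation

open scoped ComplexOrder in
lemma trace_vecMulVec_star_ne_zero {x : Fin 2 → ℂ} (hx : x ≠ 0) :
    (vecMulVec x (star x)).trace ≠ 0 := by
  rw [Matrix.trace_vecMulVec]
  exact dotProduct_self_star_eq_zero.not.2 hx

lemma comm_vecMulVec_of_eigenvector {X : U2} {x : Fin 2 → ℂ} {u : ℂ} (hx : x ≠ 0)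
    (h : (X : M2) *ᵥ x = u • x) :
    (X : M2) * vecMulVec x (star x) = vecMulVec x (star x) * X := by
  have h1 : (X : M2) * vecMulVec x (star x) = u • vecMulVec x (star x) := by
    rw [Matrix.mul_vecMulVec, h, Matrix.smul_vecMulVec]
  have hXX : star (X : M2) * X = 1 := UnitaryGroup.star_mul_self X
  have h2 : u • (star (X : M2) *ᵥ x) = x := by
    rw [← Matrix.mulVec_smul, ← h, Matrix.mulVec_mulVec, hXX, Matrix.one_mulVec]
  have hu : u ≠ 0 := by
    rintro rfl
    exact hx (by rw [← h2, zero_smul])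
  have h3 : star (X : M2) *ᵥ x = u⁻¹ • x := by
    rw [eq_inv_smul_iff₀ hu, h2]
  have h4 : star x ᵥ* (X : M2) = star u⁻¹ • star x := by
    have := congrArg star h3
    rw [Matrix.star_mulVec, star_smul, ← Matrix.star_eq_conjTranspose, star_star] at this
    exact this
  have h5 : vecMulVec x (star x) * (X : M2) = star u⁻¹ • vecMulVec x (star x) := by
    rw [Matrix.vecMulVec_mul, h4, Matrix.vecMulVec_smul]
  have htr := trace_vecMulVec_star_ne_zero hx
  have h6 := Matrix.trace_mul_comm (X : M2) (vecMulVec x (star x))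
  rw [h1, h5, Matrix.trace_smul, Matrix.trace_smul, smul_eq_mul, smul_eq_mul] at h6
  rw [h1, h5]
  exact congrArg (· • vecMulVec x (star x)) (mul_right_cancel₀ htr h6)

lemma comm_of_common_eigenvector {X Y : U2} {x : Fin 2 → ℂ} {u α : ℂ} (hx : x ≠ 0)
    (hX : (X : M2) *ᵥ x = u • x) (hY : (Y : M2) *ᵥ x = α • x) : X * Y = Y * X := by
  have h1 := comm_vecMulVec_of_eigenvector hx hX
  have h2 := comm_vecMulVec_of_eigenvector hx hY
  have htr := trace_vecMulVec_star_ne_zero hx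
  set t := (vecMulVec x (star x)).trace with ht
  have hE : IsPole (t⁻¹ • vecMulVec x (star x)) := by
    refine ⟨?_, ?_⟩
    · rw [smul_mul_smul_comm, Matrix.vecMulVec_mul_vecMulVec, dotProduct_comm,
        ← Matrix.trace_vecMulVec, ← ht, Matrix.vecMulVec_smul, smul_smul]
      congr 1
      field_simp
    · rw [Matrix.trace_smul, smul_eq_mul, inv_mul_cancel₀ htr]
  apply Subtype.ext
  apply hE.comm_of_comm
  · rw [mul_smul_comm, smul_mul_assoc, h1]
  · rw [mul_smul_comm, smul_mul_assoc, h2]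

/-- A basis in which two noncommuting unitary matrices take a normal form. -/
lemma exists_frame {X Y : U2} (hne : X * Y ≠ Y * X) {u v : ℂ} (htr : u + v = (X : M2).trace)
    (hdet : u * v = (X : M2).det) : ∃ P : M2, P.det ≠ 0 ∧
      (X : M2) * P = P * !![u, (X * Y : M2).trace - (Y : M2).trace * v; 0, v] ∧
      (Y : M2) * P = P * !![0, -(Y : M2).det; 1, (Y : M2).trace] := by
  have h0 : ((X : M2) - u • 1).det = 0 := by
    rw [Matrix.trace_fin_two] at htr
    rw [Matrix.det_fin_two] at hdet
    rw [Matrix.det_fin_two]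
    simp only [Matrix.sub_apply, Matrix.smul_apply, smul_eq_mul, Matrix.one_apply]
    norm_num
    linear_combination u * htr - hdet
  obtain ⟨x, hx, hXx⟩ := Matrix.exists_mulVec_eq_zero_iff.2 h0
  rw [Matrix.sub_mulVec, Matrix.smul_mulVec, Matrix.one_mulVec, sub_eq_zero] at hXx
  have e0 := congrFun hXx 0
  have e1 := congrFun hXx 1
  simp only [Matrix.mulVec, dotProduct, Fin.sum_univ_two, Pi.smul_apply, smul_eq_mul] at e0 e1
  refine ⟨!![x 0, (Y : M2) 0 0 * x 0 + (Y : M2) 0 1 * x 1;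
    x 1, (Y : M2) 1 0 * x 0 + (Y : M2) 1 1 * x 1], ?_, ?_, ?_⟩
  · intro hd
    rw [Matrix.det_fin_two_of] at hd
    apply hne
    by_cases hx0 : x 0 = 0
    · have hx1 : x 1 ≠ 0 := fun h => hx (by ext i; fin_cases i <;> assumption)
      refine comm_of_common_eigenvector (α := ((Y : M2) 1 0 * x 0 + (Y : M2) 1 1 * x 1) / x 1)
        hx hXx ?_
      ext i
      fin_cases i <;> simp [Matrix.mulVec, dotProduct, Fin.sum_univ_two]
      · field_simp
        linear_combination -hd
      · field_simp
    · refine comm_of_common_eigenvector (α := ((Y : M2) 0 0 * x 0 + (Y : M2) 0 1 * x 1) / x 0)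
        hx hXx ?_
      ext i
      fin_cases i <;> simp [Matrix.mulVec, dotProduct, Fin.sum_univ_two]
      · field_simp
      · field_simp
        linear_combination hd
  · rw [Matrix.trace_fin_two] at htr
    rw [M2_ext_iff]
    simp only [M2_mul_apply, Matrix.trace_fin_two]
    simp
    refine ⟨by linear_combination e0, ?_, by linear_combination e1, ?_⟩
    · linear_combination (Y : M2) 1 1 * e0 - (Y : M2) 0 1 * e1 -
        ((Y : M2) 0 0 * x 0 + (Y : M2) 0 1 * x 1 - ((Y : M2) 0 0 + (Y : M2) 1 1) * x 0) * htr
    · linear_combination (Y : M2) 0 0 * e1 - (Y : M2) 1 0 * e0 -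
        ((Y : M2) 1 0 * x 0 + (Y : M2) 1 1 * x 1 - ((Y : M2) 0 0 + (Y : M2) 1 1) * x 1) * htr
  · rw [M2_ext_iff]
    simp only [M2_mul_apply, Matrix.trace_fin_two, Matrix.det_fin_two]
    simp
    constructor <;> ring

lemma exists_conj {X Y X' Y' : U2} (hne : X * Y ≠ Y * X) (hne' : X' * Y' ≠ Y' * X')
    (h1 : (X : M2).trace = (X' : M2).trace) (h2 : (X : M2).det = (X' : M2).det)
    (h3 : (Y : M2).trace = (Y' : M2).trace) (h4 : (Y : M2).det = (Y' : M2).det)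
    (h5 : (X * Y : M2).trace = (X' * Y' : M2).trace) :
    ∃ Q R : M2, Q * R = 1 ∧ R * Q = 1 ∧ Q * X = X' * Q ∧ Q * Y = Y' * Q := by
  obtain ⟨u, v, htr, hdet, -⟩ := exists_eigenvalues X
  obtain ⟨P, hP, hX, hY⟩ := exists_frame hne htr hdet
  obtain ⟨P', hP', hX', hY'⟩ := exists_frame hne' (htr.trans h1) (hdet.trans h2)
  rw [← h5, ← h3] at hX'
  rw [← h3, ← h4] at hY'
  have u1 : P * P⁻¹ = 1 := Matrix.mul_nonsing_inv _ (Ne.isUnit hP)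
  have u2 : P⁻¹ * P = 1 := Matrix.nonsing_inv_mul _ (Ne.isUnit hP)
  have u3 : P' * P'⁻¹ = 1 := Matrix.mul_nonsing_inv _ (Ne.isUnit hP')
  have u4 : P'⁻¹ * P' = 1 := Matrix.nonsing_inv_mul _ (Ne.isUnit hP')
  have key : ∀ A B C : M2, A * P = P * C → B * P' = P' * C → P' * P⁻¹ * A = B * (P' * P⁻¹) := by
    intro A B C hA hB
    calc P' * P⁻¹ * A = P' * P⁻¹ * (A * P) * P⁻¹ := by
          rw [mul_assoc, mul_assoc, mul_assoc, mul_assoc, u1, mul_one]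
      _ = P' * C * P⁻¹ := by
          rw [hA, ← mul_assoc, mul_assoc P', u2, mul_one]
      _ = B * (P' * P⁻¹) := by rw [← hB, mul_assoc]
  refine ⟨P' * P⁻¹, P * P'⁻¹, ?_, ?_, key _ _ _ hX hX', key _ _ _ hY hY'⟩
  · rw [mul_assoc, ← mul_assoc P⁻¹, u2, one_mul, u3]
  · rw [mul_assoc, ← mul_assoc P'⁻¹, u4, one_mul, u1]

/-- `X` and `Y` generate `G` together with the scalars. -/
def Generates (G : Subgroup U2) (X Y : U2) : Prop :=
  ∀ H ≤ G, scal G ≤ H → X ∈ H → Y ∈ H → Nat.card G ≤ Nat.card H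

lemma nonempty_mulEquiv_of_conj {G G' : Subgroup U2} [Finite G] [Finite G']
    (hcard : Nat.card G = Nat.card G') (hz : Nat.card (scal G) = Nat.card (scal G'))
    {X Y X' Y' : U2} (hX : X ∈ G) (hY : Y ∈ G) (hX' : X' ∈ G') (hY' : Y' ∈ G')
    (hgen : Generates G X Y) {Q R : M2} (hQR : Q * R = 1) (hRQ : R * Q = 1)
    (hQX : Q * X = X' * Q) (hQY : Q * Y = Y' * Q) : Nonempty (G ≃* G') := by
  let K : Subgroup U2 :=
    { carrier := {h | h ∈ G ∧ ∃ h' ∈ G', Q * h = (h' : M2) * Q}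
      one_mem' := ⟨one_mem _, 1, one_mem _, by simp⟩
      mul_mem' := by
        rintro a b ⟨ha, a', ha', e⟩ ⟨hb, b', hb', e'⟩
        refine ⟨mul_mem ha hb, a' * b', mul_mem ha' hb', ?_⟩
        rw [UnitaryGroup.mul_val, UnitaryGroup.mul_val, ← mul_assoc, e, mul_assoc, e', mul_assoc]
      inv_mem' := by
        rintro a ⟨ha, a', ha', e⟩
        refine ⟨inv_mem ha, a'⁻¹, inv_mem ha', ?_⟩
        calc Q * ((a⁻¹ : U2) : M2) = ((a'⁻¹ : U2) : M2) * ((a' : M2) * Q) * ((a⁻¹ : U2) : M2) := by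
              rw [← mul_assoc, U2_val_inv_mul, one_mul]
          _ = ((a'⁻¹ : U2) : M2) * Q := by
              rw [← e, mul_assoc, mul_assoc, U2_val_mul_inv, mul_one] }
  have hKG : K ≤ G := fun h hh => hh.1
  have hsK : scal G ≤ K := by
    rintro h ⟨hh, c, hc⟩
    obtain ⟨h', hh', hc'⟩ := exists_scal (G := G') (c := c) (hz ▸ scal_pow_card hh hc)
    exact ⟨hh, h', hh', by rw [hc, hc']; simp⟩
  have hGK : K = G := by
    have : Finite K := Finite.of_injective _ (Subgroup.inclusion_injective hKG)
    exact SetLike.coe_injective (Set.eq_of_subset_of_ncard_le (t := (G : Set U2)) hKG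
      (hgen K hKG hsK ⟨hX, X', hX', hQX⟩ ⟨hY, Y', hY', hQY⟩) (Set.toFinite _))
  have hex : ∀ h : G, ∃ h' : G', Q * ((h : U2) : M2) = ((h' : U2) : M2) * Q := by
    rintro ⟨h, hh⟩
    obtain ⟨-, h', hh', e⟩ := (hGK ▸ hh : h ∈ K)
    exact ⟨⟨h', hh'⟩, e⟩
  choose f hf using hex
  have hcancel : ∀ {A B : M2}, A * Q = B * Q → A = B := fun {A B} h => by
    have := congrArg (· * R) h
    simpa [mul_assoc, hQR] using this
  have hcancel' : ∀ {A B : M2}, Q * A = Q * B → A = B := fun {A B} h => by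
    have := congrArg (R * ·) h
    simpa [← mul_assoc, hRQ] using this
  let φ : G →* G' := MonoidHom.mk' f fun a b => by
    apply Subtype.ext
    apply Subtype.ext
    apply hcancel
    rw [← hf]
    change Q * ((a : U2) * (b : U2) : M2) = ((f a : U2) * (f b : U2) : M2) * Q
    rw [← mul_assoc, hf, mul_assoc, hf, mul_assoc]
  have hinj : Function.Injective φ := fun a b h => by
    apply Subtype.ext
    apply Subtype.ext
    apply hcancel'
    rw [hf, hf]
    exact congrArg (fun g : G' => ((g : U2) : M2) * Q) h
  exact ⟨MulEquiv.ofBijective φ ((Nat.bijective_iff_injective_and_card φ).2 ⟨hinj, hcard⟩)⟩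

end Conjugation

section Dihedral

variable {G : Subgroup U2} [Finite G]

omit [Finite G] in
lemma trace_eq_torHom_add {E : M2} (hE : IsPole E) (X : tor G E) :
    ((X : U2) : M2).trace = torHom G hE X + torHom' G hE X :=
  (IsPole.trace_mul_add _).symm

omit [Finite G] in
lemma det_eq_torHom_mul {E : M2} (hE : IsPole E) (X : tor G E) :
    ((X : U2) : M2).det = torHom G hE X * torHom' G hE X :=
  hE.det_eq_mul X.2.2

omit [Finite G] in
lemma torHom_pow_card {E : M2} (hE : IsPole E) (X : tor G E) :
    torHom G hE X ^ Nat.card (tor G E) = 1 := by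
  rw [← map_pow, pow_card_eq_one', map_one]

lemma isScal_pow_of_tor (hfree : actsFreely (G : Set U2)) {E : M2} (hE : IsPole E) {r : ℕ}
    (hr : Nat.card (tor G E) = Nat.card (scal G) * r) {g : U2} (hg : g ∈ tor G E) :
    IsScal ((g ^ r : U2) : M2) := by
  obtain ⟨σ, -, -, hσ⟩ := exists_torus_param hfree hE hr
  let X : tor G E := ⟨g, hg⟩
  have h0 := torHom_ne_zero hE X
  refine (isScal_iff_torHom hE (X ^ r)).2 ?_
  rw [hσ, zpow_add₀ (torHom_ne_zero hE _), zpow_one, map_pow, _root_.zpow_mul, zpow_natCast,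
    ← pow_mul, mul_comm r, ← hr, torHom_pow_card, _root_.one_zpow, mul_one]

lemma PoleTriple.exists_isScal_pow (hfree : actsFreely (G : Set U2)) {E : Fin 3 → M2}
    {r m : Fin 3 → ℕ} (h : PoleTriple G E r m) {g : U2} (hg : g ∈ G) (hs : ¬ IsScal (g : M2)) :
    ∃ i, IsScal ((g ^ r i : U2) : M2) := by
  obtain ⟨F, hF, hgF⟩ := exists_pole g
  obtain ⟨i, k, hk, e⟩ := h.cover F hF g hg hs hgF
  exact ⟨i, isScal_pow_of_tor hfree hF ((card_tor_of_conj hk e).trans (h.card_tor i)) ⟨hg, hgF⟩⟩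

lemma tor_le_of_mem {E : M2} (hE : IsPole E) (X : tor G E)
    (hX : IsPrimitiveRoot (torHom G hE X) (Nat.card (tor G E))) {H : Subgroup U2}
    (hXH : (X : U2) ∈ H) : tor G E ≤ H := by
  have ho : Nat.card (tor G E) ≤ orderOf X := by
    apply Nat.le_of_dvd (orderOf_pos X)
    rw [← hX.pow_eq_one_iff_dvd, ← map_pow, pow_orderOf_eq_one, map_one]
  have htop : Subgroup.zpowers X = ⊤ :=
    Subgroup.eq_top_of_le_card _ (by rwa [Nat.card_zpowers])
  intro g hg
  have : (⟨g, hg⟩ : tor G E) ∈ Subgroup.zpowers X := htop ▸ Subgroup.mem_top _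
  obtain ⟨i, hi⟩ := Subgroup.mem_zpowers_iff.1 this
  have e : (X : U2) ^ i = g := by
    have := congrArg Subtype.val hi
    simpa using this
  exact e ▸ zpow_mem hXH i

omit [Finite G] in
lemma not_comm_of_swap {E : M2} (hE : IsPole E) {w : U2} (hw : (w : M2) * E = (1 - E) * w) :
    ¬ (w : M2) * E = E * w := by
  intro h
  have h2 : (w : M2) = (2 : ℂ) • ((w : M2) * E) := by
    have : (w : M2) * E = w - w * E := by
      conv_lhs => rw [hw, sub_mul, one_mul, ← h]
    rw [two_smul]
    nth_rewrite 1 [this]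
    simp
  have h3 := congrArg Matrix.det h2
  rw [Matrix.det_smul, Matrix.det_mul, hE.det_eq] at h3
  have h4 := congrArg Matrix.det (U2_val_mul_inv w)
  rw [Matrix.det_mul, h3] at h4
  simp at h4

lemma IsPrimitiveRoot.pow_half {ω : ℂ} {y : ℕ} (hy : 0 < y) (h : IsPrimitiveRoot ω (2 * y)) :
    ω ^ y = -1 := by
  have h2 : (ω ^ y - 1) * (ω ^ y + 1) = 0 := by
    have := h.pow_eq_one
    rw [mul_comm, pow_mul] at this
    linear_combination this
  rcases mul_eq_zero.1 h2 with h3 | h3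
  · have := Nat.le_of_dvd hy ((h.pow_eq_one_iff_dvd y).1 (sub_eq_zero.1 h3))
    omega
  · exact eq_neg_of_add_eq_zero_left h3

/-- A swapper of a pole can be normalized by a scalar to have a prescribed determinant. -/
lemma exists_swap_det (hfree : actsFreely (G : Set U2)) {y : ℕ} (hy : Nat.card (scal G) = 2 * y)
    {E : M2} (hE : IsPole E) {w : U2} (hw : w ∈ G) (hwE : (w : M2) * E = (1 - E) * w) {ω : ℂ}
    (hω : IsPrimitiveRoot ω (2 * y)) :
    ∃ w' ∈ G, (w' : M2) * E = (1 - E) * w' ∧ (w' : M2).det = -ω := by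
  have hz : 0 < Nat.card (scal G) := Nat.card_pos
  have hypos : 0 < y := by omega
  have h1 := neg_det_pow hfree hy hw (swap_trace hE hwE)
  have hd : (w : M2).det ≠ 0 := fun h => by
    rw [h, neg_zero, zero_pow hypos.ne'] at h1
    norm_num at h1
  obtain ⟨c, hc⟩ := IsAlgClosed.exists_pow_nat_eq (-ω / (w : M2).det) (n := 2) (by norm_num)
  have hcz : c ^ Nat.card (scal G) = 1 := by
    rw [hy, pow_mul, hc, ← neg_div_neg_eq, div_pow, neg_neg, h1, hω.pow_half hypos]
    norm_num
  obtain ⟨g, hg, hgc⟩ := exists_scal hcz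
  have hval : ((g * w : U2) : M2) = c • (w : M2) := by
    rw [UnitaryGroup.mul_val, hgc]; simp
  refine ⟨g * w, mul_mem hg hw, ?_, ?_⟩
  · rw [hval, smul_mul_assoc, mul_smul_comm, hwE]
  · rw [hval, Matrix.det_smul, Fintype.card_fin, hc]
    field_simp

lemma NAData.exists_dih_generators {y N : ℕ} {E : Fin 3 → M2} {r m : Fin 3 → ℕ} {σ : Fin 3 → ℤ}
    (hfree : actsFreely (G : Set U2)) (T : PoleTriple G E r m) (h : NAData G y N r σ)
    (hσ : ∀ i (g : tor G (E i)),
      torHom' G (T.pole i) g = torHom G (T.pole i) g ^ (1 + (Nat.card (scal G) : ℤ) * σ i))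
    (h1 : r 1 = 2) {ζ ω : ℂ} (hζ : IsPrimitiveRoot ζ (2 * y * r 2))
    (hω : IsPrimitiveRoot ω (2 * y)) :
    ∃ X ∈ G, ∃ w ∈ G, X * w ≠ w * X ∧ (X : M2).trace = ζ + ζ ^ (1 + (2 * y : ℕ) * σ 2) ∧
      (X : M2).det = ζ * ζ ^ (1 + (2 * y : ℕ) * σ 2) ∧ (w : M2).trace = 0 ∧
      (w : M2).det = -ω ∧ (X * w : M2).trace = 0 ∧ Generates G X w := by
  have hE := T.pole 2
  have hcard : Nat.card G = 2 * Nat.card (tor G (E 2)) := by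
    have hN2 : N = 2 * r 2 := by have := h.type; unfold TripleType at this; omega
    rw [h.card_eq, T.card_tor, hN2]; ring
  have hct : Nat.card (tor G (E 2)) = 2 * y * r 2 := by rw [T.card_tor, h.scal_eq]
  obtain ⟨g, hg, hs⟩ := exists_nonscal_tor (T.card_tor 2) (T.two_le 2)
  obtain ⟨w₀, hw₀, hwE₀⟩ := exists_swap_of_index_two hE hcard hg hs
  obtain ⟨w, hw, hwE, hdet⟩ := exists_swap_det hfree h.scal_eq hE hw₀ hwE₀ hω
  obtain ⟨X, hX⟩ := exists_torHom_isPrimitiveRoot hfree hE (dvd_of_eq hct.symm) hζ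
  have hX' := hσ 2 X
  rw [hX, h.scal_eq] at hX'
  have hprim : IsPrimitiveRoot (torHom G hE X) (Nat.card (tor G (E 2))) := by rw [hX, hct]; exact hζ
  have hXs : ¬ IsScal ((X : U2) : M2) := by
    intro hs'
    have h2 := scal_torHom_pow hE hs'
    rw [hX, h.scal_eq, hζ.pow_eq_one_iff_dvd] at h2
    have h3 := Nat.le_of_dvd (by have := h.pos; omega) h2
    have h4 := T.two_le 2
    have := h.pos
    nlinarith
  have hnc := not_comm_of_swap hE hwE
  refine ⟨X, X.2.1, w, hw, ?_, ?_, ?_, swap_trace hE hwE, hdet, ?_, ?_⟩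
  · intro hc
    exact hnc (hE.comm_of_nonscal X.2.2 hXs (congrArg Subtype.val hc))
  · rw [trace_eq_torHom_add hE, hX', hX]
  · rw [det_eq_torHom_mul hE, hX', hX]
  · rw [Matrix.trace_mul_comm]
    apply swap_trace hE
    rw [mul_assoc, X.2.2, ← mul_assoc, hwE, mul_assoc]
  · intro H hHG _ hXH hwH
    have hle := tor_le_of_mem hE X hprim hXH
    have : Finite H := Finite.of_injective _ (Subgroup.inclusion_injective hHG)
    obtain ⟨k, hk⟩ := Subgroup.card_dvd_of_le hle
    have hHpos : 0 < Nat.card H := Nat.card_pos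
    rcases Nat.lt_or_ge k 2 with hk2 | hk2
    · exfalso
      have hk1 : k = 1 := by
        interval_cases k
        · omega
        · rfl
      rw [hk1, mul_one] at hk
      have heq : (tor G (E 2) : Set U2) = H :=
        Set.eq_of_subset_of_ncard_le hle hk.le (Set.toFinite _)
      have : w ∈ (tor G (E 2) : Set U2) := heq ▸ hwH
      exact hnc this.2
    · rw [hcard, hk, mul_comm 2]
      exact Nat.mul_le_mul_left _ hk2

/-- Two dihedral type groups with the same numerical data are isomorphic. -/
lemma nonempty_mulEquiv_dih {G' : Subgroup U2} [Finite G'] {y N N' : ℕ} {E E' : Fin 3 → M2}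
    {r m r' m' : Fin 3 → ℕ} {σ σ' : Fin 3 → ℤ}
    (hcard : Nat.card G = Nat.card G')
    (hfree : actsFreely (G : Set U2)) (T : PoleTriple G E r m) (h : NAData G y N r σ)
    (hσ : ∀ i (g : tor G (E i)),
      torHom' G (T.pole i) g = torHom G (T.pole i) g ^ (1 + (Nat.card (scal G) : ℤ) * σ i))
    (hfree' : actsFreely (G' : Set U2)) (T' : PoleTriple G' E' r' m') (h' : NAData G' y N' r' σ')
    (hσ' : ∀ i (g : tor G' (E' i)),
      torHom' G' (T'.pole i) g = torHom G' (T'.pole i) g ^ (1 + (Nat.card (scal G') : ℤ) * σ' i))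
    (h1 : r 1 = 2) (h1' : r' 1 = 2) (h2 : r 2 = r' 2) : Nonempty (G ≃* G') := by
  have hy := h.pos
  have hr : 0 < r 2 := by have := h.two_le 2; omega
  obtain ⟨ζ, hζ⟩ : ∃ ζ : ℂ, IsPrimitiveRoot ζ (2 * y * r 2) :=
    ⟨_, Complex.isPrimitiveRoot_exp _ (by positivity)⟩
  have hω := Complex.isPrimitiveRoot_exp (2 * y) (by positivity)
  obtain ⟨X, hX, w, hw, hne, a1, a2, a3, a4, a5, hgen⟩ :=
    h.exists_dih_generators hfree T hσ h1 hζ hω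
  obtain ⟨X', hX', w', hw', hne', b1, b2, b3, b4, b5, -⟩ :=
    h'.exists_dih_generators hfree' T' hσ' h1' (h2 ▸ hζ) hω
  have hd := h.dih h1
  have hd' := h'.dih h1'
  rw [← h2] at hd'
  have hcop : IsCoprime (r 2 : ℤ) (y : ℤ) := by
    obtain ⟨c, hc⟩ := hd
    exact ⟨c, -σ 2, by linear_combination -hc⟩
  have hdvd : (r 2 : ℤ) ∣ σ' 2 - σ 2 := by
    apply hcop.dvd_of_dvd_mul_left
    have := dvd_sub hd' hd
    convert this using 1
    ring
  have hpow : ζ ^ (1 + (2 * y : ℕ) * σ' 2) = ζ ^ (1 + (2 * y : ℕ) * σ 2) := by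
    have h0 := hζ.ne_zero (by positivity)
    obtain ⟨c, hc⟩ := hdvd
    rw [show (1 + (2 * y : ℕ) * σ' 2 : ℤ) = (1 + (2 * y : ℕ) * σ 2) + ((2 * y * r 2 : ℕ) : ℤ) * c by
      push_cast
      linear_combination 2 * y * hc, zpow_add₀ h0, _root_.zpow_mul ζ _ c, zpow_natCast,
      hζ.pow_eq_one, _root_.one_zpow, mul_one]
  rw [hpow] at b1 b2
  obtain ⟨Q, R, q1, q2, q3, q4⟩ := exists_conj hne hne' (a1.trans b1.symm) (a2.trans b2.symm)
    (a3.trans b3.symm) (a4.trans b4.symm) (a5.trans b5.symm)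
  exact nonempty_mulEquiv_of_conj hcard (h.scal_eq.trans h'.scal_eq.symm) hX hw hX' hw' hgen
    q1 q2 q3 q4

end Dihedral

section Polyhedral

lemma eq_zero_of_isScal_smul_add {A : M2} (hA : ¬ IsScal A) {a b : ℂ}
    (h : IsScal (a • A + b • 1)) : a = 0 := by
  by_contra ha
  obtain ⟨c, hc⟩ := h
  refine hA ⟨a⁻¹ * (c - b), ?_⟩
  have h1 : a • A = (c - b) • 1 := by
    rw [sub_smul, ← hc]; simp
  rw [mul_smul, ← h1, smul_smul, inv_mul_cancel₀ ha, one_smul]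

/-- If a power of a nonscalar matrix is scalar, its trace satisfies an algebraic equation. -/
lemma trace_of_isScal_pow {A : M2} (hA : ¬ IsScal A) {t d : ℂ} (ht : A.trace = t)
    (hd : A.det = d) :
    (IsScal (A ^ 2) → t = 0) ∧ (IsScal (A ^ 3) → t ^ 2 = d) ∧
    (IsScal (A ^ 4) → t * (t ^ 2 - 2 * d) = 0) ∧
    (IsScal (A ^ 5) → t ^ 4 - 3 * t ^ 2 * d + d ^ 2 = 0) := by
  have h2 : A ^ 2 = t • A + (-d) • 1 := by
    rw [pow_two, M2_cayley, ht, hd]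
    module
  have h2' : A * A = t • A + (-d) • 1 := by rw [← pow_two, h2]
  have h3 : A ^ 3 = (t ^ 2 - d) • A + (-(t * d)) • 1 := by
    rw [pow_succ, h2]
    simp only [add_mul, smul_mul_assoc, h2', one_mul]
    module
  have h4 : A ^ 4 = (t * (t ^ 2 - 2 * d)) • A + (-((t ^ 2 - d) * d)) • 1 := by
    rw [pow_succ, h3]
    simp only [add_mul, smul_mul_assoc, h2', one_mul]
    module
  have h5 : A ^ 5 = (t ^ 4 - 3 * t ^ 2 * d + d ^ 2) • A + (-(t * (t ^ 2 - 2 * d) * d)) • 1 := by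
    rw [pow_succ, h4]
    simp only [add_mul, smul_mul_assoc, h2', one_mul]
    module
  refine ⟨fun h => ?_, fun h => ?_, fun h => ?_, fun h => ?_⟩
  · rw [h2] at h
    exact eq_zero_of_isScal_smul_add hA h
  · rw [h3] at h
    exact sub_eq_zero.1 (eq_zero_of_isScal_smul_add hA h)
  · rw [h4] at h
    exact eq_zero_of_isScal_smul_add hA h
  · rw [h5] at h
    exact eq_zero_of_isScal_smul_add hA h

lemma det_smul_inv (Y : U2) :
    (Y : M2).det • ((Y⁻¹ : U2) : M2) = (Y : M2).trace • 1 - Y := by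
  have h := congrArg (((Y⁻¹ : U2) : M2) * ·) (M2_cayley (Y : M2))
  simp only [mul_sub, mul_smul_comm, mul_one, ← mul_assoc, U2_val_inv_mul, one_mul] at h
  rw [eq_sub_iff_add_eq, add_comm]
  exact eq_sub_iff_add_eq.1 h

lemma det_ne_zero_U2 (Y : U2) : (Y : M2).det ≠ 0 := by
  intro h
  have h4 := congrArg Matrix.det (U2_val_mul_inv Y)
  rw [Matrix.det_mul, h] at h4
  simp at h4

lemma det_inv_U2 (Y : U2) : ((Y⁻¹ : U2) : M2).det * (Y : M2).det = 1 := by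
  rw [← Matrix.det_mul, U2_val_inv_mul, Matrix.det_one]

lemma trace_mul_inv (X Y : U2) : (Y : M2).det * ((X * Y⁻¹ : U2) : M2).trace =
    (X : M2).trace * (Y : M2).trace - ((X * Y : U2) : M2).trace := by
  have h := congrArg (fun A => ((X : M2) * A).trace) (det_smul_inv Y)
  simp only [mul_smul_comm, mul_sub, Matrix.trace_smul, Matrix.trace_sub, mul_one,
    smul_eq_mul] at h
  rw [UnitaryGroup.mul_val, UnitaryGroup.mul_val, h]
  ring

lemma not_isScal_mul {X Y : U2} (h : X * Y ≠ Y * X) : ¬ IsScal ((X * Y : U2) : M2) := by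
  rintro ⟨c, hc⟩
  apply h
  have h1 : Y = X⁻¹ * (X * Y) := by group
  have h2 : ((X⁻¹ * (X * Y) : U2) : M2) = (((X * Y) * X⁻¹ : U2) : M2) := by
    rw [UnitaryGroup.mul_val, UnitaryGroup.mul_val (X * Y), hc]
    simp
  have h3 : Y = X * Y * X⁻¹ := h1.trans (Subtype.ext h2)
  calc X * Y = X * Y * X⁻¹ * X := by group
    _ = Y * X := by rw [← h3]

variable {G : Subgroup U2} [Finite G]

lemma exists_not_comm_conj {E : M2} (hE : IsPole E) {X : U2} (hX : X ∈ tor G E)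
    (hs : ¬ IsScal (X : M2)) (hcard : 2 * Nat.card (tor G E) < Nat.card G) :
    ∃ g ∈ G, X * (g * X * g⁻¹) ≠ g * X * g⁻¹ * X := by
  by_contra hcon
  push Not at hcon
  have hcj : ∀ g ∈ G, cj g E = E ∨ cj g E = 1 - E := by
    intro g hg
    have hs' : ¬ IsScal ((g * X * g⁻¹ : U2) : M2) := by rwa [isScal_conj_iff]
    have h1 := hE.comm_of_nonscal hX.2 hs (congrArg Subtype.val (hcon g hg))
    have h2 := (cj_comm_iff g X E).2 hX.2
    exact hE.eq_or_eq_compl (hE.cj g) h1 h2 hs'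
  have hcompl : ∀ g : U2, cj g (1 - E) = 1 - cj g E := fun g => by
    rw [cj, cj, mul_sub, sub_mul, mul_one, U2_val_mul_inv]
  have hmem : ∀ g ∈ G, (g ∈ tor G E ↔ cj g E = E) := fun g hg =>
    ⟨fun h => cj_eq_iff.2 h.2, fun h => ⟨hg, cj_eq_iff.1 h⟩⟩
  have hne : E ≠ 1 - E := by
    intro h
    have h2 := hE.idem
    nth_rewrite 1 [h] at h2
    rw [sub_mul, hE.idem, one_mul, sub_self] at h2
    exact hE.ne_zero h2.symm
  have hcard' := Subgroup.card_mul_index ((tor G E).subgroupOf G)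
  rw [Nat.card_congr (Subgroup.subgroupOfEquivOfLe (tor_le G E)).toEquiv] at hcard'
  by_cases hall : ∀ g ∈ G, g ∈ tor G E
  · have := Nat.le_of_dvd Nat.card_pos (Subgroup.card_dvd_of_le hall)
    have : 0 < Nat.card G := Nat.card_pos
    omega
  · push Not at hall
    obtain ⟨w, hw, hwt⟩ := hall
    have hidx : ((tor G E).subgroupOf G).index = 2 := by
      rw [Subgroup.index_eq_two_iff]
      refine ⟨⟨w, hw⟩, fun b => ?_⟩
      rw [Subgroup.mem_subgroupOf, Subgroup.mem_subgroupOf]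
      have e1 := hmem _ (mul_mem b.2 hw)
      have e2 := hmem _ b.2
      have e3 : cj w E = 1 - E := by
        rcases hcj w hw with h | h
        · exact absurd ((hmem w hw).2 h) hwt
        · exact h
      rw [cj_mul, e3, hcompl] at e1
      rcases hcj b b.2 with h | h
      · exact Or.inr ⟨e2.2 h, fun h' => by
          have := e1.1 h'
          rw [h] at this
          exact hne this.symm⟩
      · refine Or.inl ⟨e1.2 ?_, fun h' => ?_⟩
        · rw [h]; abel
        · have := e2.1 h'
          rw [h] at this
          exact hne this.symm
    rw [hidx] at hcard'
    omega

omit [Finite G] in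
lemma scal_eq_of_le {H : Subgroup U2} (hHG : H ≤ G) (hs : scal G ≤ H) : scal H = scal G :=
  le_antisymm (fun _ h => ⟨hHG h.1, h.2⟩) fun _ h => ⟨hs h, h.2⟩

lemma not_comm_sq {X Y : U2} (h : X * Y ≠ Y * X) (hX : ¬ IsScal ((X ^ 2 : U2) : M2))
    (hY : ¬ IsScal ((Y ^ 2 : U2) : M2)) : X ^ 2 * Y ^ 2 ≠ Y ^ 2 * X ^ 2 := by
  intro hc
  apply h
  obtain ⟨E, hE, hXE⟩ := exists_pole (X ^ 2)
  obtain ⟨F, hF, hYF⟩ := exists_pole (Y ^ 2)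
  have val : ∀ {a b : U2}, a * b = b * a → (a : M2) * b = b * a := fun h =>
    congrArg Subtype.val h
  have h1 : X * Y ^ 2 = Y ^ 2 * X := Subtype.ext
    (comm_of_comm_nonscal hE hXE hX (val (pow_mul_comm' X 2)) (val hc))
  exact Subtype.ext (comm_of_comm_nonscal hF hYF hY (val h1.symm) (val (pow_mul_comm' Y 2)))

lemma NAData.generates_of_poly (hfree : actsFreely (G : Set U2)) {y N : ℕ} {r : Fin 3 → ℕ}
    {σ : Fin 3 → ℤ} (h : NAData G y N r σ) (h1 : r 1 = 3) {X Y : U2} (hne : X * Y ≠ Y * X)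
    (hX : ∀ i, IsScal ((X ^ i : U2) : M2) → r 2 ∣ i) (hY : ¬ IsScal ((Y ^ 2 : U2) : M2)) :
    Generates G X Y := by
  intro H hHG hsH hXH hYH
  have : Finite H := Finite.of_injective _ (Subgroup.inclusion_injective hHG)
  have hscal := scal_eq_of_le hHG hsH
  obtain ⟨E, s, m, M, T, hM, hcard⟩ := exists_tripleType ⟨X, hXH, Y, hYH, hne⟩
  have hfreeH : actsFreely (H : Set U2) := fun g hg => hfree g (hHG hg)
  have htype := h.type
  unfold TripleType at htype hM
  have hr2 : (r 2 = 3 ∧ N = 12) ∨ (r 2 = 4 ∧ N = 24) ∨ (r 2 = 5 ∧ N = 60) := by omega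
  have hX1 : ¬ IsScal (X : M2) := fun hs => by
    have := Nat.le_of_dvd one_pos (hX 1 (by rwa [pow_one]))
    omega
  have hX2 : ¬ IsScal ((X ^ 2 : U2) : M2) := fun hs => by
    have := Nat.le_of_dvd two_pos (hX 2 hs)
    omega
  have hs1 : s 1 ≠ 2 := by
    intro hs1
    have hM2 : M = 2 * s 2 := by omega
    have hidx : ((tor H (E 2)).subgroupOf H).index = 2 := by
      have h1 := Subgroup.card_mul_index ((tor H (E 2)).subgroupOf H)
      rw [Nat.card_congr (Subgroup.subgroupOfEquivOfLe (tor_le H (E 2))).toEquiv, hcard, hM2,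
        T.card_tor] at h1
      have hpos : 0 < Nat.card (scal H) * s 2 :=
        Nat.mul_pos Nat.card_pos (by have := T.two_le 2; omega)
      have h2 : Nat.card (scal H) * s 2 * ((tor H (E 2)).subgroupOf H).index =
        Nat.card (scal H) * s 2 * 2 := by rw [h1]; ring
      exact Nat.eq_of_mul_eq_mul_left hpos h2
    have hsq : ∀ g ∈ H, g ^ 2 ∈ tor H (E 2) := fun g hg => by
      have := Subgroup.sq_mem_of_index_two hidx ⟨g, hg⟩
      rwa [Subgroup.mem_subgroupOf] at this
    exact not_comm_sq hne hX2 hY (tor_comm (T.pole 2) (hsq X hXH) (hsq Y hYH))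
  have hs01 : s 0 = 2 ∧ s 1 = 3 := by omega
  obtain ⟨i, hi⟩ := T.exists_isScal_pow hfreeH hXH hX1
  have hdvd := hX _ hi
  have hNM : N ≤ M := by
    have h3 : s 2 = 3 ∨ s 2 = 4 ∨ s 2 = 5 := by omega
    have h012 : s i = 2 ∨ s i = 3 ∨ s i = s 2 := by
      fin_cases i
      · exact Or.inl hs01.1
      · exact Or.inr (Or.inl hs01.2)
      · exact Or.inr (Or.inr rfl)
    rcases hr2 with ⟨e, f⟩ | ⟨e, f⟩ | ⟨e, f⟩ <;> rw [e] at hdvd <;> omega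
  rw [h.card_eq, hcard, hscal]
  exact Nat.mul_le_mul_left _ hNM

lemma PoleTriple.trace_cases (hfree : actsFreely (G : Set U2)) {E : Fin 3 → M2} {r m : Fin 3 → ℕ}
    (T : PoleTriple G E r m) (h0 : r 0 = 2) (h1 : r 1 = 3) {g : U2} (hg : g ∈ G)
    (hs : ¬ IsScal (g : M2)) {t d : ℂ} (ht : (g : M2).trace = t) (hd : (g : M2).det = d) :
    t = 0 ∨ t ^ 2 = d ∨ (r 2 = 4 ∧ t * (t ^ 2 - 2 * d) = 0) ∨
      (r 2 = 5 ∧ t ^ 4 - 3 * t ^ 2 * d + d ^ 2 = 0) ∨ (r 2 ≠ 3 ∧ r 2 ≠ 4 ∧ r 2 ≠ 5) := by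
  obtain ⟨a2, a3, a4, a5⟩ := trace_of_isScal_pow hs ht hd
  obtain ⟨i, hi⟩ := T.exists_isScal_pow hfree hg hs
  rw [SubmonoidClass.coe_pow] at hi
  fin_cases i
  · simp only [Fin.zero_eta, h0] at hi
    exact Or.inl (a2 hi)
  · simp only [Fin.mk_one, h1] at hi
    exact Or.inr (Or.inl (a3 hi))
  · simp only [Fin.reduceFinMk] at hi
    by_cases e3 : r 2 = 3
    · rw [e3] at hi
      exact Or.inr (Or.inl (a3 hi))
    by_cases e4 : r 2 = 4
    · rw [e4] at hi
      exact Or.inr (Or.inr (Or.inl ⟨e4, a4 hi⟩))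
    by_cases e5 : r 2 = 5
    · rw [e5] at hi
      exact Or.inr (Or.inr (Or.inr (Or.inl ⟨e5, a5 hi⟩)))
    · exact Or.inr (Or.inr (Or.inr (Or.inr ⟨e3, e4, e5⟩)))

end Polyhedral

section PolyhedralIso

lemma eq_one_or_of_three {s s' : ℂ} (hsum : s + s' = 1) (hs : s = 0 ∨ s ^ 2 = 1)
    (hs' : s' = 0 ∨ s' ^ 2 = 1) : s = 1 ∨ s' = 1 := by
  grind

lemma eq_one_or_of_four {s s' : ℂ} (hsum : s + s' = 2)
    (hs : s = 0 ∨ s ^ 2 = 1 ∨ s * (s ^ 2 - 2) = 0)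
    (hs' : s' = 0 ∨ s' ^ 2 = 1 ∨ s' * (s' ^ 2 - 2) = 0) : s = 1 ∨ s' = 1 := by
  have key : ∀ x : ℂ, (x = 0 ∨ x ^ 2 = 1 ∨ x * (x ^ 2 - 2) = 0) →
      x = 0 ∨ x = 1 ∨ x = -1 ∨ x ^ 2 = 2 := by
    intro x h
    rcases h with h | h | h
    · exact Or.inl h
    · rcases (sq_eq_one_iff.1 h) with h | h <;> simp [h]
    · rcases mul_eq_zero.1 h with h | h
      · exact Or.inl h
      · exact Or.inr (Or.inr (Or.inr (sub_eq_zero.1 h)))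
  have e : s' = 2 - s := by linear_combination hsum
  subst e
  rcases key _ hs with h | h | h | h <;> rcases key _ hs' with h' | h' | h' | h' <;> grind

lemma eq_one_or_of_five {t s s' : ℂ} (ht : t ^ 2 = t + 1) (hsum : s + s' = t + 1)
    (hs : s = 0 ∨ s ^ 2 = 1 ∨ s ^ 4 - 3 * s ^ 2 + 1 = 0)
    (hs' : s' = 0 ∨ s' ^ 2 = 1 ∨ s' ^ 4 - 3 * s' ^ 2 + 1 = 0) : s = 1 ∨ s' = 1 := by
  have key : ∀ x : ℂ, (x = 0 ∨ x ^ 2 = 1 ∨ x ^ 4 - 3 * x ^ 2 + 1 = 0) →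
      x = 0 ∨ x = 1 ∨ x = -1 ∨ x = t ∨ x = 1 - t ∨ x = -t ∨ x = t - 1 := by
    intro x h
    rcases h with h | h | h
    · exact Or.inl h
    · have : (x - 1) * (x + 1) = 0 := by linear_combination h
      rcases mul_eq_zero.1 this with h | h
      · exact Or.inr (Or.inl (sub_eq_zero.1 h))
      · exact Or.inr (Or.inr (Or.inl (eq_neg_of_add_eq_zero_left h)))
    · have : ((x - t) * (x - (1 - t))) * ((x + t) * (x - (t - 1))) = 0 := by
        have e1 : (x - t) * (x - (1 - t)) = x ^ 2 - x - 1 := by linear_combination -ht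
        have e2 : (x + t) * (x - (t - 1)) = x ^ 2 + x - 1 := by linear_combination -ht
        rw [e1, e2]
        linear_combination h
      rcases mul_eq_zero.1 this with h | h <;> rcases mul_eq_zero.1 h with h | h
      · simp [sub_eq_zero.1 h]
      · simp [sub_eq_zero.1 h]
      · simp [eq_neg_of_add_eq_zero_left h]
      · simp [sub_eq_zero.1 h]
  have e : s' = t + 1 - s := by linear_combination hsum
  subst e
  rcases key _ hs with h | h | h | h | h | h | h <;>
    rcases key _ hs' with h' | h' | h' | h' | h' | h' | h' <;> grind

end PolyhedralIso

section PolyhedralGenerators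

lemma trace_conj_U2 (g X : U2) : ((g * X * g⁻¹ : U2) : M2).trace = (X : M2).trace := by
  rw [UnitaryGroup.mul_val, Matrix.trace_mul_comm, ← UnitaryGroup.mul_val]
  congr 2
  group

lemma det_conj_U2 (g X : U2) : ((g * X * g⁻¹ : U2) : M2).det = (X : M2).det := by
  rw [UnitaryGroup.mul_val, Matrix.det_mul_comm, ← UnitaryGroup.mul_val]
  congr 2
  group

lemma isScal_inv_iff (X : U2) : IsScal ((X⁻¹ : U2) : M2) ↔ IsScal (X : M2) := by
  have key : ∀ X : U2, IsScal (X : M2) → IsScal ((X⁻¹ : U2) : M2) := by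
    rintro X ⟨c, hc⟩
    have h := det_smul_inv X
    refine ⟨(X : M2).det⁻¹ * ((X : M2).trace - c), ?_⟩
    have h2 : (X : M2).det⁻¹ • ((X : M2).det • ((X⁻¹ : U2) : M2)) = ((X⁻¹ : U2) : M2) := by
      rw [smul_smul, inv_mul_cancel₀ (det_ne_zero_U2 X), one_smul]
    rw [← h2, h, mul_smul, sub_smul, ← hc]
  exact ⟨fun h => by simpa using key _ h, key X⟩

variable {G : Subgroup U2} [Finite G] {y N : ℕ} {E : Fin 3 → M2} {r m : Fin 3 → ℕ}
  {σ : Fin 3 → ℤ}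

lemma NAData.exists_conj_of_poly (T : PoleTriple G E r m)
    (h : NAData G y N r σ) (h1 : r 1 = 3) (X : tor G (E 2))
    (hX : ∀ i, IsScal (((X : U2) ^ i : U2) : M2) → r 2 ∣ i) :
    ∃ Y ∈ G, (X : U2) * Y ≠ Y * X ∧ (Y : M2).trace = ((X : U2) : M2).trace ∧
      (Y : M2).det = ((X : U2) : M2).det ∧ ¬ IsScal ((Y ^ 2 : U2) : M2) := by
  have ht := h.type
  have hpos : 0 < Nat.card (scal G) := Nat.card_pos
  have hc : 3 ≤ r 2 ∧ 2 * r 2 < N := by unfold TripleType at ht; omega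
  have hn : ∀ i, 0 < i → i < 3 → ¬ IsScal (((X : U2) ^ i : U2) : M2) := fun i hi hi' hs => by
    have := Nat.le_of_dvd hi (hX i hs)
    omega
  obtain ⟨g, hg, hne⟩ := exists_not_comm_conj (T.pole 2) X.2
    (by simpa using hn 1 (by norm_num) (by norm_num))
    (by rw [T.card_tor, h.card_eq]; nlinarith)
  refine ⟨g * X * g⁻¹, mul_mem (mul_mem hg X.2.1) (inv_mem hg), hne, trace_conj_U2 _ _,
    det_conj_U2 _ _, ?_⟩
  rw [conj_pow, isScal_conj_iff]
  exact hn 2 (by norm_num) (by norm_num)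

/-- If a maximal torus can be swapped, a polyhedral type group is generated modulo scalars by
two conjugate elements of determinant one whose traces are prescribed. -/
lemma NAData.exists_generators_of_dvd (hfree : actsFreely (G : Set U2)) (T : PoleTriple G E r m)
    (h : NAData G y N r σ)
    (hσ : ∀ i (g : tor G (E i)),
      torHom' G (T.pole i) g = torHom G (T.pole i) g ^ (1 + (Nat.card (scal G) : ℤ) * σ i))
    (h1 : r 1 = 3) (hd : (r 2 : ℤ) ∣ 1 + y * σ 2) {ζ : ℂ} (hζ : IsPrimitiveRoot ζ (2 * r 2)) :
    ∃ X ∈ G, ∃ Y ∈ G, X * Y ≠ Y * X ∧ (X : M2).trace = ζ + ζ⁻¹ ∧ (X : M2).det = 1 ∧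
      (Y : M2).trace = ζ + ζ⁻¹ ∧ (Y : M2).det = 1 ∧ (X * Y : M2).trace = 1 ∧
      Generates G X Y := by
  have hE := T.pole 2
  have h0 : r 0 = 2 := by have := h.type; unfold TripleType at this; omega
  have hct : Nat.card (tor G (E 2)) = 2 * y * r 2 := by rw [T.card_tor, h.scal_eq]
  have hr : 0 < r 2 := by have := h.two_le 2; omega
  have hζ0 : ζ ≠ 0 := hζ.ne_zero (by omega)
  obtain ⟨X, hX⟩ := exists_torHom_isPrimitiveRoot hfree hE
    (show 2 * r 2 ∣ _ from hct ▸ ⟨y, by ring⟩) hζ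
  have hX' : torHom' G hE X = ζ⁻¹ := by
    obtain ⟨k, hk⟩ := hd
    rw [hσ 2 X, hX, h.scal_eq, show (1 + ((2 * y : ℕ) : ℤ) * σ 2) = ((2 * r 2 : ℕ) : ℤ) * k + -1 by
      push_cast
      linear_combination 2 * hk, zpow_add₀ hζ0, _root_.zpow_mul, zpow_natCast, hζ.pow_eq_one,
      _root_.one_zpow, one_mul, _root_.zpow_neg_one]
  have htX : ((X : U2) : M2).trace = ζ + ζ⁻¹ := by rw [trace_eq_torHom_add hE, hX, hX']
  have hdX : ((X : U2) : M2).det = 1 := by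
    rw [det_eq_torHom_mul hE, hX, hX', mul_inv_cancel₀ hζ0]
  have hXi : ∀ i, IsScal (((X : U2) ^ i : U2) : M2) → r 2 ∣ i := by
    intro i hi
    have := (isScal_iff_torHom hE (X ^ i)).1 hi
    rw [map_pow, map_pow, hX, hX', _root_.inv_pow] at this
    have h2 : ζ ^ (2 * i) = 1 := by
      rw [mul_comm, pow_mul, pow_two]
      nth_rewrite 1 [this]
      exact inv_mul_cancel₀ (pow_ne_zero _ hζ0)
    exact Nat.dvd_of_mul_dvd_mul_left two_pos ((hζ.pow_eq_one_iff_dvd _).1 h2)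
  obtain ⟨Y, hY, hne, htY, hdY, hYs⟩ := h.exists_conj_of_poly T h1 X hXi
  rw [htX] at htY
  rw [hdX] at hdY
  have hne' : (X : U2) * Y⁻¹ ≠ Y⁻¹ * X := fun hc => hne (by
    have := (Commute.inv_right_iff (a := (X : U2)) (b := Y)).1 hc
    exact this)
  have hdYi : ((Y⁻¹ : U2) : M2).det = 1 := by simpa [hdY] using det_inv_U2 Y
  have htYi : ((Y⁻¹ : U2) : M2).trace = ζ + ζ⁻¹ := by
    have := trace_mul_inv 1 Y
    rw [hdY, htY, one_mul Y⁻¹, one_mul Y, one_mul, htY, UnitaryGroup.one_val, Matrix.trace_one,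
      Fintype.card_fin] at this
    rw [this]
    push_cast
    ring
  have hsum := trace_mul_inv (X : U2) Y
  rw [hdY, htX, htY, one_mul] at hsum
  have c1 := T.trace_cases hfree h0 h1 (mul_mem X.2.1 hY) (not_isScal_mul hne) rfl
    (d := 1) (by rw [UnitaryGroup.mul_val, Matrix.det_mul, hdX, hdY, one_mul])
  have c2 := T.trace_cases hfree h0 h1 (mul_mem X.2.1 (inv_mem hY)) (not_isScal_mul hne') rfl
    (d := 1) (by rw [UnitaryGroup.mul_val, Matrix.det_mul, hdX, hdYi, one_mul])
  have hpow : ζ ^ r 2 = -1 := hζ.pow_half hr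
  have key : (((X : U2) * Y : U2) : M2).trace = 1 ∨ (((X : U2) * Y⁻¹ : U2) : M2).trace = 1 := by
    have ht := h.type
    generalize (((X : U2) * Y : U2) : M2).trace = s at *
    generalize (((X : U2) * Y⁻¹ : U2) : M2).trace = s' at *
    have hr2 : r 2 = 3 ∨ r 2 = 4 ∨ r 2 = 5 := by unfold TripleType at ht; omega
    have hm1 : ζ + 1 ≠ 0 := fun hc => by
      have h2 : ζ ^ 2 = 1 := by rw [eq_neg_of_add_eq_zero_left hc]; norm_num
      have := Nat.le_of_dvd two_pos ((hζ.pow_eq_one_iff_dvd _).1 h2)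
      have := h.two_le 2
      omega
    have hsum' : s + s' = (ζ + ζ⁻¹) ^ 2 := by rw [hsum]; ring
    rcases hr2 with e | e | e <;> simp only [e] at c1 c2 hpow <;> norm_num at c1 c2
    · have e1 : ζ ^ 2 - ζ + 1 = 0 := by
        apply (mul_eq_zero.1 (show (ζ + 1) * (ζ ^ 2 - ζ + 1) = 0 by
          linear_combination hpow)).resolve_left hm1
      have e2 : ζ + ζ⁻¹ = 1 := by
        field_simp
        linear_combination e1
      rw [e2] at hsum'
      exact eq_one_or_of_three (by simpa using hsum') (by simpa using c1) (by simpa using c2)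
    · have e2 : (ζ + ζ⁻¹) ^ 2 = 2 := by
        field_simp
        linear_combination hpow
      rw [e2] at hsum'
      exact eq_one_or_of_four hsum' (by simpa using c1) (by simpa using c2)
    · have e1 : ζ ^ 4 - ζ ^ 3 + ζ ^ 2 - ζ + 1 = 0 := by
        apply (mul_eq_zero.1 (show (ζ + 1) * (ζ ^ 4 - ζ ^ 3 + ζ ^ 2 - ζ + 1) = 0 by
          linear_combination hpow)).resolve_left hm1
      have e2 : (ζ + ζ⁻¹) ^ 2 = (ζ + ζ⁻¹) + 1 := by
        field_simp
        linear_combination e1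
      exact eq_one_or_of_five e2 (by rw [hsum', e2]) (by simpa using c1) (by simpa using c2)
  rcases key with hk | hk
  · exact ⟨X, X.2.1, Y, hY, hne, htX, hdX, htY, hdY, hk,
      h.generates_of_poly hfree h1 hne hXi hYs⟩
  · refine ⟨X, X.2.1, Y⁻¹, inv_mem hY, hne', htX, hdX, htYi, hdYi, hk,
      h.generates_of_poly hfree h1 hne' hXi ?_⟩
    rwa [_root_.inv_pow, isScal_inv_iff]

end PolyhedralGenerators

section PolyhedralIsomorphism

variable {G : Subgroup U2} [Finite G] {y N : ℕ} {E : Fin 3 → M2} {r m : Fin 3 → ℕ}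
  {σ : Fin 3 → ℤ}

/-- The analogue of `NAData.exists_generators_of_dvd` for the tetrahedral type groups whose
three-fold tori cannot be swapped. -/
lemma NAData.exists_generators_of_three_dvd (hfree : actsFreely (G : Set U2))
    (T : PoleTriple G E r m) (h : NAData G y N r σ)
    (hσ : ∀ i (g : tor G (E i)),
      torHom' G (T.pole i) g = torHom G (T.pole i) g ^ (1 + (Nat.card (scal G) : ℤ) * σ i))
    (h1 : r 1 = 3) (h2 : r 2 = 3) (hy : 3 ∣ y) {ζ : ℂ} (hζ : IsPrimitiveRoot ζ (2 * y * 3)) :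
    ∃ X ∈ G, ∃ Y ∈ G, X * Y ≠ Y * X ∧ (X : M2).trace = ζ + ζ ^ (1 + 2 * y) ∧
      (X : M2).det = ζ * ζ ^ (1 + 2 * y) ∧ (Y : M2).trace = ζ + ζ ^ (1 + 2 * y) ∧
      (Y : M2).det = ζ * ζ ^ (1 + 2 * y) ∧ (X * Y : M2).trace = ζ * ζ ^ (1 + 2 * y) ∧
      Generates G X Y := by
  have hE := T.pole 2
  have h0 : r 0 = 2 := by have := h.type; unfold TripleType at this; omega
  have hct : Nat.card (tor G (E 2)) = 2 * y * 3 := by rw [T.card_tor, h.scal_eq, h2]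
  have hpos := h.pos
  have hζ0 : ζ ≠ 0 := hζ.ne_zero (by omega)
  obtain ⟨k, hk⟩ := hy
  have hcop : (1 + 2 * y).Coprime (2 * y * 3) := by
    have a : (1 + 2 * y).Coprime (2 * y) := by simp
    have b : (1 + 2 * y).Coprime 3 := by
      rw [hk, show 1 + 2 * (3 * k) = 1 + 3 * (2 * k) by ring]; simp
    exact a.mul_right b
  have hex : ∃ X : tor G (E 2),
      (torHom G hE X = ζ ∧ torHom' G hE X = ζ ^ (1 + 2 * y)) ∨
      (torHom G hE X = ζ ^ (1 + 2 * y) ∧ torHom' G hE X = ζ) := by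
    have hs := h.three_of h2
    have hs' : ∃ a, σ 2 = 3 * a + 1 ∨ σ 2 = 3 * a + 2 := ⟨σ 2 / 3, by omega⟩
    obtain ⟨a, ha | ha⟩ := hs'
    · obtain ⟨X, hX⟩ := exists_torHom_isPrimitiveRoot hfree hE (dvd_of_eq hct.symm) hζ
      refine ⟨X, Or.inl ⟨hX, ?_⟩⟩
      rw [hσ 2 X, hX, h.scal_eq, ha, show (1 + ((2 * y : ℕ) : ℤ) * (3 * a + 1)) =
        ((2 * y * 3 : ℕ) : ℤ) * a + ((1 + 2 * y : ℕ) : ℤ) by push_cast; ring,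
        zpow_add₀ hζ0, _root_.zpow_mul, zpow_natCast, hζ.pow_eq_one, _root_.one_zpow, one_mul,
        zpow_natCast]
    · obtain ⟨X, hX⟩ := exists_torHom_isPrimitiveRoot hfree hE (dvd_of_eq hct.symm)
        (hζ.pow_of_coprime _ hcop)
      refine ⟨X, Or.inr ⟨hX, ?_⟩⟩
      rw [hσ 2 X, hX, h.scal_eq, ha, ← zpow_natCast ζ, ← _root_.zpow_mul,
        show (((1 + 2 * y : ℕ) : ℤ) * (1 + ((2 * y : ℕ) : ℤ) * (3 * a + 2))) =
        ((2 * y * 3 : ℕ) : ℤ) * (1 + a + 2 * k * (3 * a + 2)) + 1 by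
          rw [hk]; push_cast; ring,
        zpow_add₀ hζ0, _root_.zpow_mul, zpow_natCast, hζ.pow_eq_one, _root_.one_zpow, one_mul,
        zpow_one]
  obtain ⟨X, hX⟩ := hex
  have htX : ((X : U2) : M2).trace = ζ + ζ ^ (1 + 2 * y) := by
    rw [trace_eq_torHom_add hE]
    rcases hX with ⟨e1, e2⟩ | ⟨e1, e2⟩
    · rw [e1, e2]
    · rw [e1, e2, add_comm]
  have hdX : ((X : U2) : M2).det = ζ * ζ ^ (1 + 2 * y) := by
    rw [det_eq_torHom_mul hE]
    rcases hX with ⟨e1, e2⟩ | ⟨e1, e2⟩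
    · rw [e1, e2]
    · rw [e1, e2, mul_comm]
  have hXi : ∀ i, IsScal (((X : U2) ^ i : U2) : M2) → r 2 ∣ i := by
    intro i hi
    have h3 := (isScal_iff_torHom hE (X ^ i)).1 hi
    rw [map_pow, map_pow] at h3
    have h4 : ζ ^ i = (ζ ^ (1 + 2 * y)) ^ i := by
      rcases hX with ⟨e1, e2⟩ | ⟨e1, e2⟩
      · rwa [e1, e2] at h3
      · rw [e1, e2] at h3; exact h3.symm
    rw [← pow_mul, show (1 + 2 * y) * i = i + 2 * y * i by ring, pow_add] at h4
    have h5 : ζ ^ (2 * y * i) = 1 := (mul_eq_left₀ (pow_ne_zero i hζ0)).1 h4.symm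
    rw [h2]
    exact Nat.dvd_of_mul_dvd_mul_left (by omega) ((hζ.pow_eq_one_iff_dvd _).1 h5)
  obtain ⟨Y, hY, hne, htY, hdY, hYs⟩ := h.exists_conj_of_poly T h1 X hXi
  rw [htX] at htY
  rw [hdX] at hdY
  refine ⟨X, X.2.1, Y, hY, hne, htX, hdX, htY, hdY, ?_, h.generates_of_poly hfree h1 hne hXi hYs⟩
  have hne' : (X : U2) * Y⁻¹ ≠ Y⁻¹ * X := fun hc =>
    hne ((Commute.inv_right_iff (a := (X : U2)) (b := Y)).1 hc)
  have hsum := trace_mul_inv (X : U2) Y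
  have hdXY : (((X : U2) * Y : U2) : M2).det = (ζ * ζ ^ (1 + 2 * y)) ^ 2 := by
    rw [UnitaryGroup.mul_val, Matrix.det_mul, hdX, hdY, pow_two]
  have hdXY' : (((X : U2) * Y⁻¹ : U2) : M2).det = 1 := by
    rw [UnitaryGroup.mul_val, Matrix.det_mul, hdX, ← hdY, mul_comm, det_inv_U2]
  rw [hdY, htX, htY] at hsum
  have c1 := T.trace_cases hfree h0 h1 (mul_mem X.2.1 hY) (not_isScal_mul hne) rfl hdXY
  have c2 := T.trace_cases hfree h0 h1 (mul_mem X.2.1 (inv_mem hY)) (not_isScal_mul hne') rfl hdXY'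
  have c0 : (((X : U2) * Y : U2) : M2).trace ≠ 0 := by
    intro hc
    have h3 := neg_det_pow hfree h.scal_eq (mul_mem X.2.1 hY) hc
    rw [hdXY] at h3
    have h4 : ζ ^ (8 * y) = 1 := by
      have h5 : ((-(ζ * ζ ^ (1 + 2 * y)) ^ 2) ^ y) ^ 2 =
          ζ ^ (8 * y) * (ζ ^ (2 * y * 3)) ^ (4 * k) := by
        rw [← pow_mul, mul_comm y 2, pow_mul (-(ζ * ζ ^ (1 + 2 * y)) ^ 2), neg_sq, ← pow_succ',
          ← pow_mul, ← pow_mul, ← pow_mul, ← pow_mul, ← pow_add]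
        congr 1
        rw [hk]; ring
      rw [h3, hζ.pow_eq_one, one_pow, mul_one] at h5
      rw [← h5]; norm_num
    have h6 := (hζ.pow_eq_one_iff_dvd _).1 h4
    have h7 : 2 * y * 3 ∣ 2 * y * 4 := by convert h6 using 1; ring
    have := Nat.dvd_of_mul_dvd_mul_left (by omega) h7
    norm_num at this
  have hη : ζ ^ (2 * y) = ζ ^ y - 1 := by
    have h3 : (ζ ^ y) ^ 3 = -1 := by
      rw [← pow_mul]
      exact IsPrimitiveRoot.pow_half (by omega) (by convert hζ using 1; ring)
    have h4 : ζ ^ y + 1 ≠ 0 := fun hc => by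
      have h5 : ζ ^ (2 * y) = 1 := by
        rw [mul_comm, pow_mul, eq_neg_of_add_eq_zero_left hc]; norm_num
      have := Nat.le_of_dvd (by omega) ((hζ.pow_eq_one_iff_dvd _).1 h5)
      omega
    have h5 := (mul_eq_zero.1 (show (ζ ^ y + 1) * ((ζ ^ y) ^ 2 - ζ ^ y + 1) = 0 by
      linear_combination h3)).resolve_left h4
    rw [mul_comm, pow_mul]
    linear_combination h5
  have hsq : (ζ + ζ ^ (1 + 2 * y)) * (ζ + ζ ^ (1 + 2 * y)) = ζ * ζ ^ (1 + 2 * y) := by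
    have h3 : ζ ^ (2 * y) = (ζ ^ y) ^ 2 := by rw [mul_comm, pow_mul]
    rw [pow_add, pow_one]
    rw [h3] at hη ⊢
    linear_combination ζ ^ 2 * ((ζ ^ y) ^ 2 + ζ ^ y + 1) * hη
  have hd0 : ζ * ζ ^ (1 + 2 * y) ≠ 0 := mul_ne_zero hζ0 (pow_ne_zero _ hζ0)
  rw [hsq] at hsum
  change (((X : U2) * Y : U2) : M2).trace = _
  generalize (((X : U2) * Y : U2) : M2).trace = s at *
  generalize (((X : U2) * Y⁻¹ : U2) : M2).trace = s' at *
  generalize ζ * ζ ^ (1 + 2 * y) = d at *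
  simp only [h2] at c1 c2
  norm_num only [false_and, or_false, false_or] at c1 c2
  have e1 : s = d ∨ s = -d := sq_eq_sq_iff_eq_or_eq_neg.1 (by tauto)
  refine e1.resolve_right fun hs => ?_
  have e2 : s' = 2 := mul_left_cancel₀ hd0 (by rw [hsum, hs]; ring)
  rw [e2] at c2
  norm_num at c2

lemma nonempty_mulEquiv_of_generators {G' : Subgroup U2} [Finite G']
    (hcard : Nat.card G = Nat.card G') (hz : Nat.card (scal G) = Nat.card (scal G'))
    {t d s : ℂ}
    (h : ∃ X ∈ G, ∃ Y ∈ G, X * Y ≠ Y * X ∧ (X : M2).trace = t ∧ (X : M2).det = d ∧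
      (Y : M2).trace = t ∧ (Y : M2).det = d ∧ (X * Y : M2).trace = s ∧ Generates G X Y)
    (h' : ∃ X ∈ G', ∃ Y ∈ G', X * Y ≠ Y * X ∧ (X : M2).trace = t ∧ (X : M2).det = d ∧
      (Y : M2).trace = t ∧ (Y : M2).det = d ∧ (X * Y : M2).trace = s ∧ Generates G' X Y) :
    Nonempty (G ≃* G') := by
  obtain ⟨X, hX, Y, hY, hne, a1, a2, a3, a4, a5, hgen⟩ := h
  obtain ⟨X', hX', Y', hY', hne', b1, b2, b3, b4, b5, -⟩ := h'
  obtain ⟨Q, R, q1, q2, q3, q4⟩ := exists_conj hne hne' (a1.trans b1.symm) (a2.trans b2.symm)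
    (a3.trans b3.symm) (a4.trans b4.symm) (a5.trans b5.symm)
  exact nonempty_mulEquiv_of_conj hcard hz hX hY hX' hY' hgen q1 q2 q3 q4

lemma NAData.dvd_of_poly (hfree : actsFreely (G : Set U2)) (T : PoleTriple G E r m)
    (h : NAData G y N r σ)
    (hσ : ∀ i (g : tor G (E i)),
      torHom' G (T.pole i) g = torHom G (T.pole i) g ^ (1 + (Nat.card (scal G) : ℤ) * σ i))
    (h1 : r 1 = 3) (hc : ¬ (r 2 = 3 ∧ 3 ∣ y)) : (r 2 : ℤ) ∣ 1 + y * σ 2 := by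
  have ht := h.type
  unfold TripleType at ht
  by_cases h2 : r 2 = 3
  · have a1 := h.three_of h2
    have a2 := h.three_of' h2
    have a3 : ¬ (3 : ℤ) ∣ y := fun hd => hc ⟨h2, by exact_mod_cast hd⟩
    rw [h2]
    push_cast at a2 ⊢
    have b1 : (y : ℤ) % 3 = 1 ∨ (y : ℤ) % 3 = 2 := by omega
    have b2 : σ 2 % 3 = 1 ∨ σ 2 % 3 = 2 := by omega
    have c1 : (2 * (y : ℤ) * σ 2) % 3 = (2 * ((y : ℤ) % 3 * (σ 2 % 3))) % 3 := by
      rw [mul_assoc, Int.mul_emod, Int.mul_emod (y : ℤ)]; omega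
    have c2 : ((y : ℤ) * σ 2) % 3 = ((y : ℤ) % 3 * (σ 2 % 3)) % 3 := Int.mul_emod _ _ _
    rcases b1 with b1 | b1 <;> rcases b2 with b2 | b2 <;> rw [b1, b2] at c1 c2 <;> omega
  · obtain ⟨w, hw, hwE⟩ := T.exists_swap 2 (by
      intro j hj
      fin_cases j
      · simp at hj; omega
      · simp at hj; omega
      · rfl)
    exact dvd_of_swap hfree h.scal_eq (T.pole 2) hw hwE (T.card_tor 2) (hσ 2)

/-- Two polyhedral type groups with the same numerical data are isomorphic. -/
lemma nonempty_mulEquiv_poly {G' : Subgroup U2} [Finite G'] {N' : ℕ}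
    {E' : Fin 3 → M2} {r' m' : Fin 3 → ℕ} {σ' : Fin 3 → ℤ}
    (hcard : Nat.card G = Nat.card G')
    (hfree : actsFreely (G : Set U2)) (T : PoleTriple G E r m) (h : NAData G y N r σ)
    (hσ : ∀ i (g : tor G (E i)),
      torHom' G (T.pole i) g = torHom G (T.pole i) g ^ (1 + (Nat.card (scal G) : ℤ) * σ i))
    (hfree' : actsFreely (G' : Set U2)) (T' : PoleTriple G' E' r' m') (h' : NAData G' y N' r' σ')
    (hσ' : ∀ i (g : tor G' (E' i)),
      torHom' G' (T'.pole i) g = torHom G' (T'.pole i) g ^ (1 + (Nat.card (scal G') : ℤ) * σ' i))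
    (h1 : r 1 = 3) (h1' : r' 1 = 3) (h2 : r 2 = r' 2) : Nonempty (G ≃* G') := by
  have hy := h.pos
  have hr : 0 < r 2 := by have := h.two_le 2; omega
  have hz := h.scal_eq.trans h'.scal_eq.symm
  by_cases hc : r 2 = 3 ∧ 3 ∣ y
  · obtain ⟨ζ, hζ⟩ : ∃ ζ : ℂ, IsPrimitiveRoot ζ (2 * y * 3) :=
      ⟨_, Complex.isPrimitiveRoot_exp _ (by positivity)⟩
    exact nonempty_mulEquiv_of_generators hcard hz
      (h.exists_generators_of_three_dvd hfree T hσ h1 hc.1 hc.2 hζ)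
      (h'.exists_generators_of_three_dvd hfree' T' hσ' h1' (h2 ▸ hc.1) hc.2 hζ)
  · obtain ⟨ζ, hζ⟩ : ∃ ζ : ℂ, IsPrimitiveRoot ζ (2 * r 2) :=
      ⟨_, Complex.isPrimitiveRoot_exp _ (by positivity)⟩
    exact nonempty_mulEquiv_of_generators hcard hz
      (h.exists_generators_of_dvd hfree T hσ h1 (h.dvd_of_poly hfree T hσ h1 hc) hζ)
      (h'.exists_generators_of_dvd hfree' T' hσ' h1'
        (h'.dvd_of_poly hfree' T' hσ' h1' (h2 ▸ hc)) (h2 ▸ hζ))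

end PolyhedralIsomorphism

/-- One can hear the fundamental group of spherical 3-manifolds. -/
theorem isospectral_U2_isomorphic
    (G G' : Subgroup (Matrix.unitaryGroup (Fin 2) ℂ))
    (hGfin : Finite G) (hG'fin : Finite G')
    (hGfree : actsFreely (G : Set (Matrix.unitaryGroup (Fin 2) ℂ)))
    (hG'free : actsFreely (G' : Set (Matrix.unitaryGroup (Fin 2) ℂ)))
    (hspec : ∀ lam : ℕ, 0 < lam → specMult (G : Set _) lam = specMult (G' : Set _) lam) :
    Nonempty (G ≃* G') := by
  have hc : ∀ k, 0 < k → cSpec G k = cSpec G' k := fun k hk => by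
    rw [← specMult_two_mul G hk, ← specMult_two_mul G' hk]
    exact hspec _ (by omega)
  have hcard := (card_of_isospectral G G' hc).1
  by_cases hab : ∀ g ∈ G, ∀ h ∈ G, g * h = h * g
  · by_cases hab' : ∀ g ∈ G', ∀ h ∈ G', g * h = h * g
    · have := isCyclic_of_comm hGfree hab
      have := isCyclic_of_comm hG'free hab'
      exact ⟨mulEquivOfCyclicCardEq hcard⟩
    · push Not at hab'
      obtain ⟨y, N, E, r, m, σ, T, h, -⟩ := exists_naData hG'free hab'
      have h1 := cSpec_two_pos hGfree hab
      rw [hc 2 two_pos, h.cSpec_two] at h1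
      exact absurd h1 (lt_irrefl 0)
  · push Not at hab
    obtain ⟨y, N, E, r, m, σ, T, h, hσ⟩ := exists_naData hGfree hab
    by_cases hab' : ∀ g ∈ G', ∀ h ∈ G', g * h = h * g
    · have h1 := cSpec_two_pos hG'free hab'
      rw [← hc 2 two_pos, h.cSpec_two] at h1
      exact absurd h1 (lt_irrefl 0)
    · push Not at hab'
      obtain ⟨y', N', E', r', m', σ', T', h', hσ'⟩ := exists_naData hG'free hab'
      obtain ⟨e, e1, e2⟩ := same_type h h' hc
      subst e
      rcases h.r_one with h1 | h1
      · exact nonempty_mulEquiv_dih hcard hGfree T h hσ hG'free T' h' hσ' h1 (e1 ▸ h1) e2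
      · exact nonempty_mulEquiv_poly hcard hGfree T h hσ hG'free T' h' hσ' h1 (e1 ▸ h1) e2
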